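/- arXiv:1602.00166 — 8 statements merged into one kernel-verified Lean document; each statement's English description precedes it below -/
import Mathlib

section
/- Let R be a commutative principal ideal ring (a commutative ring with identity, not necessarily a domain, in which every ideal is principal). Then every m×n matrix over R has a Smith normal form: there exist an invertible m×m matrix P and an invertible n×n matrix Q over R such that PAQ vanishes off the main diagonal and its diagonal entries α_1, …, α_{min(m,n)} satisfy α_i | α_{i+1} for all i. -/
/-- An m×n matrix `A` over a commutative ring has a Smith normal form: there are
invertible square matrices `P`, `Q` such that `P * A * Q` vanishes off the main
diagonal and each diagonal entry divides the next. -/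
def HasSmithNormalForm {R : Type*} [CommRing R] {m n : ℕ}
    (A : Matrix (Fin m) (Fin n) R) : Prop :=
  ∃ (P : Matrix (Fin m) (Fin m) R) (Q : Matrix (Fin n) (Fin n) R),
    IsUnit P.det ∧ IsUnit Q.det ∧
    (∀ (i : Fin m) (j : Fin n), (i : ℕ) ≠ (j : ℕ) → (P * A * Q) i j = 0) ∧
    (∀ (i : ℕ) (h1 : i + 1 < m) (h2 : i + 1 < n),
      (P * A * Q) ⟨i, Nat.lt_of_succ_lt h1⟩ ⟨i, Nat.lt_of_succ_lt h2⟩ ∣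
        (P * A * Q) ⟨i + 1, h1⟩ ⟨i + 1, h2⟩)

/-- A simultaneous prime avoidance statement: some element of the coset `a + (e)` avoids every
minimal prime over `I` that does not contain both `a` and `e`. -/
theorem exists_forall_minimalPrimes_add_mul_mem {R : Type*} [CommRing R] [IsNoetherianRing R]
    (I : Ideal R) (a e : R) :
    ∃ x, ∀ p ∈ I.minimalPrimes, a + e * x ∈ p → a ∈ p ∧ e ∈ p := by
  classical
  have hfin := I.finite_minimalPrimes_of_isNoetherianRing
  set S := hfin.toFinset with hS
  have hmem : ∀ p, p ∈ S ↔ p ∈ I.minimalPrimes := fun p => by simp [hS]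
  have key : ¬ (((S.filter (a ∉ ·)).inf id : Ideal R) : Set R) ⊆
      ⋃ p ∈ ((S.filter (a ∈ ·) : Finset (Ideal R)) : Set (Ideal R)), ((id p : Ideal R) : Set R) := by
    rw [Ideal.subset_union_prime (f := id) ⊥ ⊥
      (fun p hp _ _ => ((hmem p).1 (Finset.mem_filter.1 hp).1).1.1)]
    rintro ⟨p, hp, hle⟩
    obtain ⟨hpS, hap⟩ := Finset.mem_filter.1 hp
    have hpI := (hmem p).1 hpS
    obtain ⟨q, hq, hqp⟩ := (hpI.1.1.inf_le').1 hle
    obtain ⟨hqS, haq⟩ := Finset.mem_filter.1 hq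
    exact haq (hpI.2 ((hmem q).1 hqS).1 hqp hap)
  obtain ⟨x, hx, hx'⟩ := Set.not_subset.1 key
  refine ⟨x, fun p hp h => ?_⟩
  have hprime : p.IsPrime := hp.1.1
  by_cases hap : a ∈ p
  · refine ⟨hap, (hprime.mem_or_mem ((p.add_mem_iff_right hap).1 h)).resolve_right fun hxp => hx' ?_⟩
    exact Set.mem_biUnion (Finset.mem_coe.2 (Finset.mem_filter.2 ⟨(hmem p).2 hp, hap⟩)) hxp
  · have hxp : x ∈ p :=
      Finset.inf_le (f := id) (Finset.mem_filter.2 ⟨(hmem p).2 hp, hap⟩) hx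
    exact absurd ((p.add_mem_iff_left (p.mul_mem_left e hxp)).1 h) hap

/-- A Noetherian ring of Krull dimension at most one has stable range at most two. -/
theorem exists_isCoprime_add_mul {R : Type*} [CommRing R] [IsNoetherianRing R]
    [Ring.KrullDimLE 1 R] {a b e : R} (h : Ideal.span {a, b, e} = ⊤) :
    ∃ x y, IsCoprime (a + e * x) (b + e * y) := by
  obtain ⟨x, hx⟩ := exists_forall_minimalPrimes_add_mul_mem (⊥ : Ideal R) a e
  obtain ⟨y, hy⟩ := exists_forall_minimalPrimes_add_mul_mem (Ideal.span {a + e * x}) b e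
  refine ⟨x, y, ?_⟩
  rw [← Ideal.isCoprime_span_singleton_iff, Ideal.isCoprime_iff_sup_eq]
  by_contra hne
  obtain ⟨M, hM, hle⟩ := Ideal.exists_le_maximal _ hne
  have hxM : a + e * x ∈ M := hle (Ideal.mem_sup_left (Ideal.mem_span_singleton_self _))
  have hyM : b + e * y ∈ M := hle (Ideal.mem_sup_right (Ideal.mem_span_singleton_self _))
  have heM : e ∈ M := by
    obtain ⟨P, hP, hPM⟩ := Ideal.exists_minimalPrimes_le (J := M)
      ((Ideal.span_singleton_le_iff_mem M).2 hxM)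
    have hxP : a + e * x ∈ P := (Ideal.span_singleton_le_iff_mem P).1 hP.1.2
    rcases Ring.krullDimLE_one_iff.1 ‹_› P hP.1.1 with hmin | hmax
    · exact hPM (hx P hmin hxP).2
    · obtain rfl := hmax.eq_of_le hM.ne_top hPM
      exact (hy P hP hyM).2
  refine hM.ne_top (top_le_iff.1 (h ▸ Ideal.span_le.2 ?_))
  rintro z (rfl | rfl | rfl)
  · exact (M.add_mem_iff_left (M.mul_mem_right _ heM)).1 hxM
  · exact (M.add_mem_iff_left (M.mul_mem_right _ heM)).1 hyM
  · exact heM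

/-- Over a principal ideal ring, two elements are multiples of a common divisor with coprime
cofactors. -/
theorem exists_eq_mul_isCoprime {R : Type*} [CommRing R] [IsPrincipalIdealRing R] (a b : R) :
    ∃ d a' b', a = d * a' ∧ b = d * b' ∧ IsCoprime a' b' := by
  obtain ⟨d, hd⟩ := (IsPrincipalIdealRing.principal (Ideal.span {a, b})).principal
  change _ = Ideal.span {d} at hd
  obtain ⟨a', ha⟩ : d ∣ a := by
    rw [← Ideal.mem_span_singleton, ← hd]; exact Ideal.subset_span (by simp)
  obtain ⟨b', hb⟩ : d ∣ b := by
    rw [← Ideal.mem_span_singleton, ← hd]; exact Ideal.subset_span (by simp)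
  obtain ⟨s, t, hst⟩ := Ideal.mem_span_pair.1 (hd ▸ Ideal.mem_span_singleton_self d)
  have hann : d * (1 - s * a' - t * b') = 0 := by
    linear_combination (-1 : R) * hst + s * ha + t * hb
  obtain ⟨x, y, hxy⟩ := exists_isCoprime_add_mul (a := a') (b := b') (e := 1 - s * a' - t * b') (by
    rw [Ideal.eq_top_iff_one, Ideal.mem_span_insert]
    exact ⟨s, t * b' + (1 - s * a' - t * b'), Ideal.mem_span_pair.2 ⟨t, 1, by ring⟩, by ring⟩)
  exact ⟨d, _, _, by linear_combination ha - x * hann, by linear_combination hb - y * hann, hxy⟩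

namespace Matrix

/-- Two matrices are equivalent if they differ by invertible row and column transformations. -/
def UnitEquivalent {R : Type*} [CommRing R] {m n : Type*} [Fintype m] [Fintype n] [DecidableEq m]
    [DecidableEq n] (A B : Matrix m n R) : Prop :=
  ∃ (P : Matrix m m R) (Q : Matrix n n R), IsUnit P.det ∧ IsUnit Q.det ∧ P * A * Q = B

namespace UnitEquivalent

variable {R : Type*} [CommRing R] {m n : Type*} [Fintype m] [Fintype n] [DecidableEq m]
    [DecidableEq n] {A B C : Matrix m n R}

theorem refl (A : Matrix m n R) : UnitEquivalent A A :=
  ⟨1, 1, by simp, by simp, by simp⟩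

theorem trans (h : UnitEquivalent A B) (h' : UnitEquivalent B C) : UnitEquivalent A C := by
  obtain ⟨P, Q, hP, hQ, rfl⟩ := h
  obtain ⟨P', Q', hP', hQ', rfl⟩ := h'
  exact ⟨P' * P, Q * Q', by simpa using ⟨hP', hP⟩, by simpa using ⟨hQ, hQ'⟩,
    by simp only [Matrix.mul_assoc]⟩

theorem transpose (h : UnitEquivalent A B) : UnitEquivalent Aᵀ Bᵀ := by
  obtain ⟨P, Q, hP, hQ, rfl⟩ := h
  exact ⟨Qᵀ, Pᵀ, by simpa, by simpa, by simp [Matrix.mul_assoc]⟩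

end UnitEquivalent

theorem det_one_add_vecMulVec {R : Type*} [CommRing R] {m : Type*} [Fintype m] [DecidableEq m]
    (u v : m → R) : (1 + vecMulVec u v).det = 1 + v ⬝ᵥ u := by
  rw [vecMulVec_eq Unit, det_one_add_replicateCol_mul_replicateRow]

/-- Embed a `2 × 2` matrix `X` in the coordinates `i ≠ j`; the determinant is unchanged. -/
theorem det_one_add_embed {R : Type*} [CommRing R] {n : Type*} [Fintype n] [DecidableEq n]
    {i j : n} (hij : i ≠ j) (X : Matrix (Fin 2) (Fin 2) R) :
    (1 + (1 : Matrix n n R).submatrix id ![i, j] *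
      ((X - 1) * (1 : Matrix n n R).submatrix ![i, j] id)).det = X.det := by
  have h : (1 : Matrix n n R).submatrix ![i, j] id * (1 : Matrix n n R).submatrix id ![i, j] = 1 := by
    ext k l
    simp only [Matrix.mul_apply, submatrix_apply, id, Matrix.one_apply, ite_mul, one_mul, zero_mul,
      Finset.sum_ite_eq, Finset.mem_univ, if_true]
    fin_cases k <;> fin_cases l <;> simp [hij, hij.symm]
  rw [det_one_add_mul_comm, Matrix.mul_assoc, h, Matrix.mul_one, add_sub_cancel]

/-- A matrix whose `(i₀, j₀)` entry cannot be replaced by a proper divisor within the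
equivalence class of the matrix. -/
def IsMinimalPivot {R : Type*} [CommRing R] {m n : Type*} [Fintype m] [Fintype n] [DecidableEq m]
    [DecidableEq n] (B : Matrix m n R) (i₀ : m) (j₀ : n) : Prop :=
  ∀ C, UnitEquivalent B C → C i₀ j₀ ∣ B i₀ j₀ → B i₀ j₀ ∣ C i₀ j₀

namespace IsMinimalPivot

variable {R : Type*} [CommRing R] {m n : Type*} [Fintype m] [Fintype n] [DecidableEq m]
    [DecidableEq n] {B C : Matrix m n R} {i₀ : m} {j₀ : n}

theorem exists_unitEquivalent [IsNoetherianRing R] (A : Matrix m n R) (i₀ : m) (j₀ : n) :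
    ∃ B, UnitEquivalent A B ∧ B.IsMinimalPivot i₀ j₀ := by
  obtain ⟨_, ⟨B, hB, rfl⟩, hmax⟩ := set_has_maximal_iff_noetherian.2 ‹IsNoetherianRing R›
    {I : Ideal R | ∃ B, UnitEquivalent A B ∧ Ideal.span {B i₀ j₀} = I} ⟨_, A, .refl A, rfl⟩
  refine ⟨B, hB, fun C hC hdvd => ?_⟩
  have h := hmax _ ⟨C, hB.trans hC, rfl⟩
  by_contra hnot
  exact h (lt_of_le_not_ge (Ideal.span_singleton_le_span_singleton.2 hdvd)
    fun hle => hnot (Ideal.span_singleton_le_span_singleton.1 hle))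

theorem transpose (h : B.IsMinimalPivot i₀ j₀) : Bᵀ.IsMinimalPivot j₀ i₀ :=
  fun C hC hdvd => h Cᵀ (by simpa using hC.transpose) hdvd

theorem of_unitEquivalent (h : B.IsMinimalPivot i₀ j₀) (hBC : UnitEquivalent B C)
    (heq : C i₀ j₀ = B i₀ j₀) : C.IsMinimalPivot i₀ j₀ := fun D hD hdvd => by
  rw [heq] at hdvd ⊢
  exact h D (hBC.trans hD) hdvd

theorem dvd_row [IsPrincipalIdealRing R] (h : B.IsMinimalPivot i₀ j₀) (j : n) :
    B i₀ j₀ ∣ B i₀ j := by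
  rcases eq_or_ne j₀ j with rfl | hj
  · rfl
  obtain ⟨d, a, b, ha, hb, u, v, huv⟩ := exists_eq_mul_isCoprime (B i₀ j₀) (B i₀ j)
  let Q : Matrix n n R := 1 + (1 : Matrix n n R).submatrix id ![j₀, j] *
      ((!![u, -b; v, a] - 1) * (1 : Matrix n n R).submatrix ![j₀, j] id)
  have hQ : IsUnit Q.det := by
    rw [det_one_add_embed hj, det_fin_two_of]
    convert isUnit_one
    linear_combination huv
  have hd : (B * Q) i₀ j₀ = d := by
    have hE : B * (1 : Matrix n n R).submatrix id ![j₀, j] = B.submatrix id ![j₀, j] := by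
      ext k l
      simp [Matrix.mul_apply, Matrix.one_apply]
    simp only [Q, Matrix.mul_add, ← Matrix.mul_assoc, hE]
    simp only [add_apply, Matrix.mul_one, Matrix.mul_apply (n := n) (m := Fin 2),
      Matrix.mul_apply (m := Fin 2), Fin.sum_univ_two]
    simp [hj.symm, Matrix.one_apply]
    linear_combination d * huv + u * ha + v * hb
  have := h (B * Q) ⟨1, Q, by simp, hQ, by simp⟩ (hd ▸ ⟨a, ha⟩)
  exact (hd ▸ this).trans ⟨b, hb⟩

theorem dvd_col [IsPrincipalIdealRing R] (h : B.IsMinimalPivot i₀ j₀) (i : m) :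
    B i₀ j₀ ∣ B i j₀ :=
  h.transpose.dvd_row i

theorem exists_clear [IsPrincipalIdealRing R] (h : B.IsMinimalPivot i₀ j₀) :
    ∃ C, UnitEquivalent B C ∧ C i₀ j₀ = B i₀ j₀ ∧ (∀ j, j ≠ j₀ → C i₀ j = 0) ∧
      ∀ i, i ≠ i₀ → C i j₀ = 0 := by
  choose c hc using h.dvd_row
  choose d hd using h.dvd_col
  refine ⟨_, ⟨1 + vecMulVec (-Function.update d i₀ 0) (Pi.single i₀ 1),
    1 + vecMulVec (Pi.single j₀ 1) (-Function.update c j₀ 0),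
    by rw [det_one_add_vecMulVec]; simp, by rw [det_one_add_vecMulVec]; simp, rfl⟩, ?_⟩
  have key : ∀ i j, ((1 + vecMulVec (-Function.update d i₀ 0) (Pi.single i₀ 1) : Matrix m m R) * B *
      (1 + vecMulVec (Pi.single j₀ 1) (-Function.update c j₀ 0) : Matrix n n R)) i j =
      B i j - Function.update d i₀ 0 i * B i₀ j - (B i j₀ - Function.update d i₀ 0 i * B i₀ j₀) *
        Function.update c j₀ 0 j := by
    intro i j
    simp only [Matrix.mul_add, Matrix.add_mul, Matrix.mul_one, Matrix.one_mul, vecMulVec_mul,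
      mul_vecMulVec, add_apply, vecMulVec_apply]
    simp [vecMulVec_apply]
    ring
  refine ⟨by rw [key]; simp, fun j hj => ?_, fun i hi => ?_⟩
  · rw [key]; simp [hj]; linear_combination hc j
  · rw [key]; simp [hi]; linear_combination hd i

theorem dvd_of_cleared [IsPrincipalIdealRing R] (h : B.IsMinimalPivot i₀ j₀)
    (hrow : ∀ j, j ≠ j₀ → B i₀ j = 0) (hcol : ∀ i, i ≠ i₀ → B i j₀ = 0) (i : m) (j : n) :
    B i₀ j₀ ∣ B i j := by
  rcases eq_or_ne i i₀ with rfl | hi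
  · exact h.dvd_row j
  rcases eq_or_ne j j₀ with rfl | hj
  · exact h.dvd_col i
  let P : Matrix m m R := 1 + vecMulVec (Pi.single i₀ 1) (Pi.single i 1)
  have hent : ∀ l, (P * B) i₀ l = B i₀ l + B i l := by
    intro l
    simp [P, Matrix.add_mul, vecMulVec_mul, vecMulVec_apply]
  have heq : UnitEquivalent B (P * B) :=
    ⟨P, 1, by simp [P, det_one_add_vecMulVec, hi.symm], by simp, Matrix.mul_one _⟩
  have := (h.of_unitEquivalent heq (by simp [hent, hcol i hi])).dvd_row j
  simpa [hent, hcol i hi, hrow j hj] using this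

end IsMinimalPivot

/-- The block diagonal matrix with blocks `x` and `A`. -/
def consDiag {R : Type*} [CommRing R] {m n : ℕ} (x : R) (A : Matrix (Fin m) (Fin n) R) :
    Matrix (Fin (m + 1)) (Fin (n + 1)) R :=
  Fin.cons (Fin.cons x 0) fun i => Fin.cons 0 (A i)

section consDiag

variable {R : Type*} [CommRing R] {l m n : ℕ} (x y : R)

@[simp] theorem consDiag_zero_zero (A : Matrix (Fin m) (Fin n) R) : consDiag x A 0 0 = x := rfl

@[simp] theorem consDiag_zero_succ (A : Matrix (Fin m) (Fin n) R) (j : Fin n) :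
    consDiag x A 0 j.succ = 0 := rfl

@[simp] theorem consDiag_succ_zero (A : Matrix (Fin m) (Fin n) R) (i : Fin m) :
    consDiag x A i.succ 0 = 0 := rfl

@[simp] theorem consDiag_succ_succ (A : Matrix (Fin m) (Fin n) R) (i : Fin m) (j : Fin n) :
    consDiag x A i.succ j.succ = A i j := rfl

theorem consDiag_mul (A : Matrix (Fin l) (Fin m) R) (B : Matrix (Fin m) (Fin n) R) :
    consDiag x A * consDiag y B = consDiag (x * y) (A * B) := by
  ext i j
  refine Fin.cases ?_ (fun i => ?_) i <;> refine Fin.cases ?_ (fun j => ?_) j <;>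
    simp [Matrix.mul_apply, Fin.sum_univ_succ]

theorem det_consDiag (A : Matrix (Fin n) (Fin n) R) : (consDiag x A).det = x * A.det := by
  have : (consDiag x A).submatrix Fin.succ Fin.succ = A := rfl
  simp [det_succ_row_zero, Fin.sum_univ_succ, this]

end consDiag

theorem dvd_mul_mul_apply {R : Type*} [CommRing R] {k l m n : Type*} [Fintype l] [Fintype m]
    {x : R} {A : Matrix l m R} (h : ∀ i j, x ∣ A i j) (P : Matrix k l R) (Q : Matrix m n R)
    (i : k) (j : n) : x ∣ (P * A * Q) i j := by
  simp only [Matrix.mul_apply]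
  exact Finset.dvd_sum fun b _ => Dvd.dvd.mul_right
    (Finset.dvd_sum fun a _ => Dvd.dvd.mul_left (h a b) _) _

end Matrix

open Matrix

theorem HasSmithNormalForm.of_unitEquivalent {R : Type*} [CommRing R] {m n : ℕ}
    {A B : Matrix (Fin m) (Fin n) R} (hAB : UnitEquivalent A B) (hB : HasSmithNormalForm B) :
    HasSmithNormalForm A := by
  obtain ⟨P, Q, hP, hQ, hoff, hdvd⟩ := hB
  obtain ⟨P', Q', hP', hQ', h⟩ := hAB.trans ⟨P, Q, hP, hQ, rfl⟩
  exact ⟨P', Q', hP', hQ', h ▸ hoff, h ▸ hdvd⟩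

theorem HasSmithNormalForm.consDiag {R : Type*} [CommRing R] {m n : ℕ}
    {A : Matrix (Fin m) (Fin n) R} (hA : HasSmithNormalForm A) {x : R} (hx : ∀ i j, x ∣ A i j) :
    HasSmithNormalForm (A.consDiag x) := by
  obtain ⟨P, Q, hP, hQ, hoff, hdvd⟩ := hA
  refine ⟨P.consDiag 1, Q.consDiag 1, by simpa [det_consDiag], by simpa [det_consDiag], ?_, ?_⟩
  · intro i j
    rw [consDiag_mul, consDiag_mul, one_mul, mul_one]
    refine Fin.cases ?_ (fun i => ?_) i <;> refine Fin.cases ?_ (fun j => ?_) j <;> simp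
    exact hoff i j
  · rw [consDiag_mul, consDiag_mul, one_mul, mul_one]
    rintro (_ | i) h1 h2
    · exact dvd_mul_mul_apply hx P Q ⟨0, by omega⟩ ⟨0, by omega⟩
    · exact hdvd i (by omega) (by omega)

/-- Every m×n matrix over a commutative principal ideal ring (not
necessarily a domain) has a Smith normal form. -/
theorem stmt2 (R : Type*) [CommRing R] [IsPrincipalIdealRing R]
    (m n : ℕ) (A : Matrix (Fin m) (Fin n) R) :
    HasSmithNormalForm A := by
  induction m generalizing n with
  | zero => exact ⟨1, 1, by simp, by simp, fun i => i.elim0, fun i h => by omega⟩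
  | succ m ih =>
    cases n with
    | zero => exact ⟨1, 1, by simp, by simp, fun _ j => j.elim0, fun i _ h => by omega⟩
    | succ n =>
      obtain ⟨B, hAB, hB⟩ := IsMinimalPivot.exists_unitEquivalent A 0 0
      obtain ⟨C, hBC, h00, hrow, hcol⟩ := hB.exists_clear
      have hdvd := (hB.of_unitEquivalent hBC h00).dvd_of_cleared hrow hcol
      have hC : consDiag (C 0 0) (C.submatrix Fin.succ Fin.succ) = C := by
        ext i j
        refine Fin.cases ?_ (fun i => ?_) i <;> refine Fin.cases ?_ (fun j => ?_) j <;>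
          simp [hrow, hcol]
      refine .of_unitEquivalent (hAB.trans hBC) (hC ▸ ?_)
      exact (ih n _).consDiag fun i j => hdvd i.succ j.succ
end

section
/- Let R be a commutative ring with identity. Then every square diagonal matrix over R has a Smith normal form if and only if R is a Bézout ring, i.e., every finitely generated ideal of R is principal. -/
namespace Matrix

variable {R : Type*} [CommRing R]

section

variable {ι κ : Type*} [Fintype ι] [DecidableEq ι] [Fintype κ] [DecidableEq κ]

/-- Two square matrices are equivalent if one is obtained from the other by multiplying by
invertible matrices on both sides. -/
def UnitEquiv (A B : Matrix ι ι R) : Prop :=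
  ∃ P Q : Matrix ι ι R, IsUnit P.det ∧ IsUnit Q.det ∧ P * A * Q = B

theorem UnitEquiv.refl (A : Matrix ι ι R) : UnitEquiv A A :=
  ⟨1, 1, by simp, by simp, by simp⟩

theorem UnitEquiv.symm {A B : Matrix ι ι R} (h : UnitEquiv A B) : UnitEquiv B A := by
  obtain ⟨P, Q, hP, hQ, rfl⟩ := h
  refine ⟨P⁻¹, Q⁻¹, isUnit_nonsing_inv_det P hP, isUnit_nonsing_inv_det Q hQ, ?_⟩
  rw [← mul_assoc, ← mul_assoc, nonsing_inv_mul P hP, one_mul, mul_assoc, mul_nonsing_inv Q hQ,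
    mul_one]

theorem UnitEquiv.trans {A B C : Matrix ι ι R} (h₁ : UnitEquiv A B) (h₂ : UnitEquiv B C) :
    UnitEquiv A C := by
  obtain ⟨P, Q, hP, hQ, rfl⟩ := h₁
  obtain ⟨P', Q', hP', hQ', rfl⟩ := h₂
  refine ⟨P' * P, Q * Q', ?_, ?_, by simp only [mul_assoc]⟩
  · rw [det_mul]; exact hP'.mul hP
  · rw [det_mul]; exact hQ.mul hQ'

theorem UnitEquiv.fromBlocks {A B : Matrix ι ι R} {C D : Matrix κ κ R} (h₁ : UnitEquiv A B)
    (h₂ : UnitEquiv C D) : UnitEquiv (fromBlocks A 0 0 C) (fromBlocks B 0 0 D) := by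
  obtain ⟨P, Q, hP, hQ, rfl⟩ := h₁
  obtain ⟨P', Q', hP', hQ', rfl⟩ := h₂
  refine ⟨.fromBlocks P 0 0 P', .fromBlocks Q 0 0 Q', ?_, ?_, by simp [fromBlocks_multiply]⟩
  · rw [det_fromBlocks_zero₂₁]; exact hP.mul hP'
  · rw [det_fromBlocks_zero₂₁]; exact hQ.mul hQ'

theorem UnitEquiv.submatrix {A B : Matrix ι ι R} (h : UnitEquiv A B) (e : κ ≃ ι) :
    UnitEquiv (A.submatrix e e) (B.submatrix e e) := by
  obtain ⟨P, Q, hP, hQ, rfl⟩ := h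
  exact ⟨P.submatrix e e, Q.submatrix e e, by rwa [det_submatrix_equiv_self],
    by rwa [det_submatrix_equiv_self], by simp only [submatrix_mul_equiv]⟩

theorem UnitEquiv.dvd_apply {A B : Matrix ι ι R} (h : UnitEquiv A B) {g : R}
    (hg : ∀ i j, g ∣ A i j) (i j : ι) : g ∣ B i j := by
  obtain ⟨P, Q, -, -, rfl⟩ := h
  simp only [mul_apply]
  exact Finset.dvd_sum fun k _ ↦ Dvd.dvd.mul_right
    (Finset.dvd_sum fun l _ ↦ (hg l k).mul_left _) _

theorem UnitEquiv.dvd_diagonal {d e : ι → R} (h : UnitEquiv (diagonal d) (diagonal e)) {g : R}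
    (hg : ∀ i, g ∣ d i) (i : ι) : g ∣ e i := by
  have := h.dvd_apply (g := g) (fun i j ↦ ?_) i i
  · simpa using this
  · rw [diagonal_apply]
    split_ifs
    exacts [hg i, dvd_zero g]

end

theorem UnitEquiv.diagonal_append {m n : ℕ} {d d' : Fin m → R} {e e' : Fin n → R}
    (h₁ : UnitEquiv (diagonal d) (diagonal d')) (h₂ : UnitEquiv (diagonal e) (diagonal e')) :
    UnitEquiv (diagonal (Fin.append d e)) (diagonal (Fin.append d' e')) := by
  have := (h₁.fromBlocks h₂).submatrix finSumFinEquiv.symm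
  rw [fromBlocks_diagonal, fromBlocks_diagonal, submatrix_diagonal_equiv,
    submatrix_diagonal_equiv] at this
  have key (f : Fin m → R) (g : Fin n → R) :
      Sum.elim f g ∘ finSumFinEquiv.symm = Fin.append f g := by
    rw [Equiv.comp_symm_eq]
    ext (i | i) <;> simp
  rwa [key, key] at this

/-- A matrix with diagonal entries `a`, `b` is equivalent to one with diagonal entries
a greatest common divisor `g` of `a`, `b` and a multiple of `g`. -/
theorem exists_unitEquiv_diagonal_pair [IsBezout R] (a b : R) :
    ∃ g l : R, g ∣ a ∧ g ∣ b ∧ g ∣ l ∧ UnitEquiv (diagonal ![a, b]) (diagonal ![g, l]) := by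
  obtain ⟨g, hg⟩ := (IsBezout.span_pair_isPrincipal a b).principal
  obtain ⟨x, y, hxy⟩ := Ideal.mem_span_pair.1 (hg ▸ Ideal.mem_span_singleton_self g :
    g ∈ Ideal.span {a, b})
  have hmem : ∀ c ∈ ({a, b} : Set R), g ∣ c := fun c hc ↦
    Ideal.mem_span_singleton.1 (hg.le (Ideal.subset_span hc))
  obtain ⟨a', ha⟩ := hmem a (by simp)
  obtain ⟨b', hb⟩ := hmem b (by simp)
  refine ⟨g, -(a' * b), ⟨a', ha⟩, ⟨b', hb⟩, ?_, !![x, 1; 1 - a' * x, -a'],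
    !![1, -b'; y, 1 - b' * y], ?_, ?_, ?_⟩
  · rw [dvd_neg, hb]; exact (dvd_mul_right g b').mul_left a'
  · rw [det_fin_two_of, show x * -a' - 1 * (1 - a' * x) = -1 by ring]; exact isUnit_one.neg
  · rw [det_fin_two_of, show 1 * (1 - b' * y) - -b' * y = 1 by ring]; exact isUnit_one
  · rw [diagonal_vec2, diagonal_vec2, mul_fin_two, mul_fin_two]
    congr! 5
    · linear_combination hxy
    · linear_combination (-b') * hxy + hb
    · linear_combination (-a') * hxy + ha
    · linear_combination a' * b' * hxy - b' * ha

theorem exists_unitEquiv_diagonal_dvd [IsBezout R] (n : ℕ) (d : Fin n → R) :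
    ∃ e : Fin n → R, (∀ i j, i ≤ j → e i ∣ e j) ∧ UnitEquiv (diagonal d) (diagonal e) := by
  induction n with
  | zero => exact ⟨d, fun i ↦ i.elim0, .refl _⟩
  | succ n ih =>
    have cons (a : R) {u v : Fin n → R} (h : UnitEquiv (diagonal u) (diagonal v)) :
        UnitEquiv (diagonal (Fin.cons a u : Fin (n + 1) → R)) (diagonal (Fin.cons a v)) := by
      have := (UnitEquiv.diagonal_append (.refl (diagonal fun _ : Fin 1 ↦ a)) h).submatrix
        (finCongr (add_comm n 1))
      simpa [submatrix_diagonal_equiv, Fin.append_left_eq_cons, Function.comp_def] using this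
    obtain ⟨u, hu, hdu⟩ := ih (Fin.tail d)
    have h₁ := cons (d 0) hdu
    rw [Fin.cons_self_tail] at h₁
    obtain ⟨g, w, hgw, hdw⟩ : ∃ (g : R) (w : Fin n → R), (∀ i, g ∣ w i) ∧
        UnitEquiv (diagonal (Fin.cons (d 0) u : Fin (n + 1) → R)) (diagonal (Fin.cons g w)) := by
      cases n with
      | zero => exact ⟨d 0, u, fun i ↦ i.elim0, .refl _⟩
      | succ n =>
        obtain ⟨g, l, -, hgb, hgl, h⟩ := exists_unitEquiv_diagonal_pair (d 0) (u 0)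
        refine ⟨g, Fin.cons l (Fin.tail u), ?_, ?_⟩
        · refine Fin.cases hgl fun i ↦ ?_
          rw [Fin.cons_succ]
          exact hgb.trans (hu _ _ (Fin.zero_le _))
        · have := (h.diagonal_append (.refl (diagonal (Fin.tail u)))).submatrix
            (finCongr (add_comm n 2))
          rw [submatrix_diagonal_equiv, submatrix_diagonal_equiv] at this
          have key (a b : R) : Fin.append ![a, b] (Fin.tail u) ∘ finCongr (add_comm n 2) =
              Fin.cons a (Fin.cons b (Fin.tail u)) := by
            rw [← Equiv.eq_comp_symm]
            ext i
            refine Fin.addCases (fun i ↦ ?_) (fun i ↦ ?_) i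
            · rw [Fin.append_left]
              fin_cases i <;> rfl
            · rw [Fin.append_right]
              have : (finCongr (add_comm n 2)).symm (Fin.natAdd 2 i) = i.succ.succ := by
                ext; simp
              rw [Function.comp_apply, this, Fin.cons_succ, Fin.cons_succ]
          rwa [key, key, Fin.cons_self_tail] at this
    obtain ⟨v, hv, hwv⟩ := ih w
    refine ⟨Fin.cons g v, ?_, (h₁.trans hdw).trans (cons g hwv)⟩
    refine Fin.cases (Fin.cases (by simp) fun j _ ↦ ?_) fun i ↦ Fin.cases (by simp) fun j hij ↦ ?_
    · simpa using hwv.dvd_diagonal hgw j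
    · simpa using hv i j (by simpa using hij)

end Matrix

open Matrix in
/-- Over a commutative ring `R`, every square diagonal matrix has a
Smith normal form if and only if `R` is a Bézout ring (every finitely generated
ideal is principal). -/
theorem stmt3 (R : Type*) [CommRing R] :
    (∀ (n : ℕ) (A : Matrix (Fin n) (Fin n) R),
        (∀ i j : Fin n, i ≠ j → A i j = 0) → HasSmithNormalForm A) ↔
      IsBezout R := by
  refine ⟨fun H ↦ IsBezout.iff_span_pair_isPrincipal.2 fun a b ↦ ?_, fun _ n A hA ↦ ?_⟩
  · obtain ⟨P, Q, hP, hQ, hoff, hdvd⟩ := H 2 (diagonal ![a, b]) fun i j h ↦ diagonal_apply_ne _ h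
    have hdvd := hdvd 0 (by simp) (by simp)
    have hB : UnitEquiv (diagonal ![a, b]) (P * diagonal ![a, b] * Q) := ⟨P, Q, hP, hQ, rfl⟩
    refine ⟨(P * diagonal ![a, b] * Q) 0 0, le_antisymm ?_ ?_⟩
    · have hg : ∀ i j, (P * diagonal ![a, b] * Q) 0 0 ∣ (P * diagonal ![a, b] * Q) i j := by
        intro i j
        by_cases hij : i = j
        · subst hij
          fin_cases i
          exacts [dvd_rfl, hdvd]
        · rw [hoff i j fun h ↦ hij (Fin.ext h)]
          exact dvd_zero _
      have hA := hB.symm.dvd_apply hg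
      refine Ideal.span_le.2 ?_
      rintro c (rfl | rfl)
      · exact Ideal.mem_span_singleton.2 (by simpa using hA 0 0)
      · exact Ideal.mem_span_singleton.2 (by simpa using hA 1 1)
    · refine (Ideal.span_singleton_le_iff_mem _).2 (Ideal.mem_span_pair.2
        ⟨P 0 0 * Q 0 0, P 0 1 * Q 1 0, ?_⟩)
      simp [mul_apply, Fin.sum_univ_two]
      ring
  · obtain ⟨e, he, P, Q, hP, hQ, h⟩ := exists_unitEquiv_diagonal_dvd n A.diag
    have hAd : diagonal A.diag = A := by
      ext i j
      by_cases hij : i = j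
      · subst hij; simp
      · rw [diagonal_apply_ne _ hij, hA i j hij]
    rw [hAd] at h
    refine ⟨P, Q, hP, hQ, fun i j hij ↦ ?_, fun i h₁ h₂ ↦ ?_⟩
    · rw [h, diagonal_apply_ne _ fun hc ↦ hij (congrArg _ hc)]
    · rw [h, diagonal_apply_eq, diagonal_apply_eq]
      exact he _ _ (by simp [Fin.le_def])
end

section
/- Let R be an integral domain and let A be an m×n matrix over R. Suppose B = PAQ and B′ = P′AQ′ are both Smith normal forms of A, with diagonal entries α_1, …, α_{min(m,n)} and α′_1, …, α′_{min(m,n)} respectively. Then for each i there exists a unit u_i ∈ R with α′_i = u_i α_i; that is, the Smith normal form is unique up to multiplication of each diagonal entry by a unit. -/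
/-- For a divisibility chain, the product of the first `k` terms divides the product of any `k`
distinct terms. -/
theorem prod_fin_dvd_prod_of_injective {R : Type*} [CommMonoid R] {a : ℕ → R}
    (ha : ∀ i j, i ≤ j → a i ∣ a j) {k : ℕ} (f : Fin k → ℕ) (hf : Function.Injective f) :
    ∏ i : Fin k, a i ∣ ∏ i : Fin k, a (f i) := by
  classical
  have hcard : (Finset.univ.image f).card = k := by
    rw [Finset.card_image_of_injective _ hf, Finset.card_fin]
  have himage : ∏ i : Fin k, a (f i) = ∏ x ∈ Finset.univ.image f, a x :=
    (Finset.prod_image fun _ _ _ _ h => hf h).symm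
  have hsorted : ∏ i : Fin k, a ((Finset.univ.image f).orderEmbOfFin hcard i) =
      ∏ x ∈ Finset.univ.image f, a x := by
    conv_rhs => rw [← Finset.map_orderEmbOfFin_univ (Finset.univ.image f) hcard]
    rw [Finset.prod_map]
    rfl
  rw [himage, ← hsorted]
  refine Finset.prod_dvd_prod_of_dvd _ _ fun i _ => ha _ _ ?_
  have hle : ∀ (j : ℕ) (hj : j < k), j ≤ (Finset.univ.image f).orderEmbOfFin hcard ⟨j, hj⟩ := by
    intro j
    induction j with
    | zero => intro _; exact Nat.zero_le _
    | succ j ih =>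
      intro hj
      exact (ih (by omega)).trans_lt
        (((Finset.univ.image f).orderEmbOfFin hcard).strictMono (Nat.lt_succ_self j))
  exact hle i i.2

namespace Matrix

variable {R : Type*} [CommRing R]

/-- If `d` divides every maximal minor of `N`, it divides the determinant of `M * N`. -/
theorem dvd_det_mul_of_forall_dvd_det_submatrix {k m : ℕ} {d : R}
    (M : Matrix (Fin k) (Fin m) R) (N : Matrix (Fin m) (Fin k) R)
    (h : ∀ f : Fin k → Fin m, d ∣ (N.submatrix f id).det) : d ∣ (M * N).det := by
  have hrows : M * N = fun i => ∑ j, M i j • N j := by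
    ext i l
    simp [Matrix.mul_apply, Finset.sum_apply]
  change d ∣ detRowAlternating.toMultilinearMap (M * N)
  rw [hrows, MultilinearMap.map_sum]
  refine Finset.dvd_sum fun f _ => ?_
  rw [MultilinearMap.map_smul_univ]
  exact (h f).mul_left _

/-- If `d` divides every `k × k` minor of `B`, it divides every `k × k` minor of `X * B * Y`. -/
theorem dvd_det_submatrix_mul_mul {k m n p q : ℕ} {d : R} (B : Matrix (Fin m) (Fin n) R)
    (h : ∀ (f : Fin k → Fin m) (g : Fin k → Fin n), d ∣ (B.submatrix f g).det)
    (X : Matrix (Fin p) (Fin m) R) (Y : Matrix (Fin n) (Fin q) R)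
    (r : Fin k → Fin p) (c : Fin k → Fin q) : d ∣ ((X * B * Y).submatrix r c).det := by
  have hprod : (X * B * Y).submatrix r c = X.submatrix r id * (B * Y.submatrix id c) := by
    ext i j
    simp [Matrix.mul_assoc, Matrix.mul_apply]
  rw [hprod]
  refine dvd_det_mul_of_forall_dvd_det_submatrix _ _ fun f => ?_
  have htranspose : ((B * Y.submatrix id c).submatrix f id)ᵀ =
      (Y.submatrix id c)ᵀ * (B.submatrix f id)ᵀ := by
    ext i j
    simp [Matrix.mul_apply, mul_comm]
  rw [← det_transpose, htranspose]
  refine dvd_det_mul_of_forall_dvd_det_submatrix _ _ fun g => ?_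
  rw [← det_transpose]
  exact h f g

/-- Each `k × k` minor of a diagonal matrix whose entries form a divisibility chain is divisible
by the product of the first `k` diagonal entries. -/
theorem prod_dvd_det_submatrix_of_diagonal {k m n : ℕ} {a : ℕ → R}
    (ha : ∀ i j, i ≤ j → a i ∣ a j) (B : Matrix (Fin m) (Fin n) R)
    (hB : ∀ i j, B i j = if (i : ℕ) = j then a i else 0)
    (f : Fin k → Fin m) (g : Fin k → Fin n) :
    ∏ i : Fin k, a i ∣ (B.submatrix f g).det := by
  by_cases hf : Function.Injective f
  · rw [det_apply]
    refine Finset.dvd_sum fun σ _ => ?_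
    rw [Units.smul_def, zsmul_eq_mul]
    refine Dvd.dvd.mul_left ?_ _
    by_cases hσ : ∀ i, (f (σ i) : ℕ) = g i
    · have hterm : ∏ i, B.submatrix f g (σ i) i = ∏ i, a (f (σ i)) :=
        Finset.prod_congr rfl fun i _ => by rw [submatrix_apply, hB, if_pos (hσ i)]
      rw [hterm]
      exact prod_fin_dvd_prod_of_injective ha (fun i => (f (σ i) : ℕ))
        (Fin.val_injective.comp (hf.comp σ.injective))
    · push Not at hσ
      obtain ⟨i, hi⟩ := hσ
      have hzero : B.submatrix f g (σ i) i = 0 := by rw [submatrix_apply, hB, if_neg hi]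
      rw [Finset.prod_eq_zero (f := fun i => B.submatrix f g (σ i) i) (Finset.mem_univ i) hzero]
      exact dvd_zero _
  · simp only [Function.Injective, not_forall] at hf
    obtain ⟨i, j, hij, hne⟩ := hf
    rw [det_zero_of_row_eq hne (by ext l; simp [submatrix_apply, hij])]
    exact dvd_zero _

/-- If `B' = X * B * Y` with `B` and `B'` diagonal and the entries of `B` a divisibility chain,
the product of the first `k` entries of `B` divides that of `B'`. -/
theorem prod_dvd_prod_of_eq_mul_mul {k m n : ℕ} (hm : k ≤ m) (hn : k ≤ n) {a a' : ℕ → R}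
    (ha : ∀ i j, i ≤ j → a i ∣ a j) {B B' : Matrix (Fin m) (Fin n) R}
    (hB : ∀ i j, B i j = if (i : ℕ) = j then a i else 0)
    (hB' : ∀ i j, B' i j = if (i : ℕ) = j then a' i else 0)
    (X : Matrix (Fin m) (Fin m) R) (Y : Matrix (Fin n) (Fin n) R) (h : B' = X * B * Y) :
    ∏ i : Fin k, a i ∣ ∏ i : Fin k, a' i := by
  have hdvd := dvd_det_submatrix_mul_mul B (prod_dvd_det_submatrix_of_diagonal ha B hB) X Y
    (Fin.castLE hm) (Fin.castLE hn)
  have hdiagonal : B'.submatrix (Fin.castLE hm) (Fin.castLE hn) =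
      diagonal fun i : Fin k => a' i := by
    ext i j
    simp [hB', diagonal_apply, Fin.ext_iff]
  rwa [← h, hdiagonal, det_diagonal] at hdvd

/-- The diagonal entries of a matrix, continued by zero. -/
def diagEntry {m n : ℕ} (B : Matrix (Fin m) (Fin n) R) (i : ℕ) : R :=
  if h : i < m ∧ i < n then B ⟨i, h.1⟩ ⟨i, h.2⟩ else 0

theorem diagEntry_of_lt {m n : ℕ} (B : Matrix (Fin m) (Fin n) R) {i : ℕ} (h1 : i < m)
    (h2 : i < n) : diagEntry B i = B ⟨i, h1⟩ ⟨i, h2⟩ :=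
  dif_pos ⟨h1, h2⟩

theorem apply_eq_ite_diagEntry {m n : ℕ} {B : Matrix (Fin m) (Fin n) R}
    (hdiag : ∀ (i : Fin m) (j : Fin n), (i : ℕ) ≠ (j : ℕ) → B i j = 0) (i : Fin m) (j : Fin n) :
    B i j = if (i : ℕ) = j then diagEntry B i else 0 := by
  split_ifs with h
  · rw [diagEntry_of_lt B i.2 (h ▸ j.2)]
    congr 1
    exact Fin.ext h.symm
  · exact hdiag i j h

theorem diagEntry_dvd_diagEntry {m n : ℕ} {B : Matrix (Fin m) (Fin n) R}
    (hchain : ∀ (i : ℕ) (h1 : i + 1 < m) (h2 : i + 1 < n),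
      B ⟨i, Nat.lt_of_succ_lt h1⟩ ⟨i, Nat.lt_of_succ_lt h2⟩ ∣ B ⟨i + 1, h1⟩ ⟨i + 1, h2⟩)
    (i j : ℕ) (hij : i ≤ j) : diagEntry B i ∣ diagEntry B j := by
  induction j, hij using Nat.le_induction with
  | base => exact dvd_rfl
  | succ j _ ih =>
    refine ih.trans ?_
    by_cases h : j + 1 < m ∧ j + 1 < n
    · rw [diagEntry_of_lt B h.1 h.2,
        diagEntry_of_lt B (Nat.lt_of_succ_lt h.1) (Nat.lt_of_succ_lt h.2)]
      exact hchain j h.1 h.2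
    · rw [diagEntry, diagEntry, dif_neg h]
      exact dvd_zero _

/-- Two matrices equivalent to the same matrix are equivalent to each other. -/
theorem eq_mul_mul_of_eq_mul_mul {m n : ℕ} {A B B' : Matrix (Fin m) (Fin n) R}
    {P P' : Matrix (Fin m) (Fin m) R} {Q Q' : Matrix (Fin n) (Fin n) R}
    (hP : IsUnit P.det) (hQ : IsUnit Q.det) (hB : B = P * A * Q) (hB' : B' = P' * A * Q') :
    B' = (P' * P⁻¹) * B * (Q⁻¹ * Q') := by
  have hA : P⁻¹ * B * Q⁻¹ = A := by
    rw [hB, Matrix.mul_assoc P, nonsing_inv_mul_cancel_left _ _ hP,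
      mul_nonsing_inv_cancel_right _ _ hQ]
  rw [hB', ← hA]
  simp only [Matrix.mul_assoc]

end Matrix

/-- If two divisibility chains in a domain have associated products of their first `i` and of
their first `i + 1` terms, their terms of index `i` are associated. -/
theorem associated_of_associated_prod {R : Type*} [CommRing R] [IsDomain R] {a a' : ℕ → R}
    (ha : ∀ i j, i ≤ j → a i ∣ a j) (ha' : ∀ i j, i ≤ j → a' i ∣ a' j) {i : ℕ}
    (h : Associated (∏ j : Fin i, a j) (∏ j : Fin i, a' j))
    (hsucc : Associated (∏ j : Fin (i + 1), a j) (∏ j : Fin (i + 1), a' j)) :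
    Associated (a i) (a' i) := by
  have eq_zero : ∀ {b : ℕ → R}, (∀ i j, i ≤ j → b i ∣ b j) → ∏ j : Fin i, b j = 0 → b i = 0 := by
    intro b hb h0
    obtain ⟨j, -, hj⟩ := Finset.prod_eq_zero_iff.mp h0
    exact zero_dvd_iff.mp (hj ▸ hb j i j.2.le)
  by_cases h0 : ∏ j : Fin i, a j = 0
  · rw [eq_zero ha h0, eq_zero ha' (h.eq_zero_iff.mp h0)]
  · rw [Fin.prod_univ_castSucc, Fin.prod_univ_castSucc] at hsucc
    exact hsucc.of_mul_left h h0

/-- Over an integral domain `R`, the Smith normal form of an m×n matrix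
`A` is unique up to multiplication of each diagonal entry by a unit: if `B = P*A*Q`
and `B' = P'*A*Q'` are both Smith normal forms of `A`, then for each `i` there is a
unit `u_i` with `B'_{ii} = u_i B_{ii}`. -/
theorem stmt6 (R : Type*) [CommRing R] [IsDomain R] (m n : ℕ)
    (A : Matrix (Fin m) (Fin n) R)
    (P P' : Matrix (Fin m) (Fin m) R) (Q Q' : Matrix (Fin n) (Fin n) R)
    (hP : IsUnit P.det) (hQ : IsUnit Q.det) (hP' : IsUnit P'.det) (hQ' : IsUnit Q'.det)
    (B B' : Matrix (Fin m) (Fin n) R) (hB : B = P * A * Q) (hB' : B' = P' * A * Q')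
    (hdiag : ∀ (i : Fin m) (j : Fin n), (i : ℕ) ≠ (j : ℕ) → B i j = 0)
    (hdiag' : ∀ (i : Fin m) (j : Fin n), (i : ℕ) ≠ (j : ℕ) → B' i j = 0)
    (hchain : ∀ (i : ℕ) (h1 : i + 1 < m) (h2 : i + 1 < n),
      B ⟨i, Nat.lt_of_succ_lt h1⟩ ⟨i, Nat.lt_of_succ_lt h2⟩ ∣ B ⟨i + 1, h1⟩ ⟨i + 1, h2⟩)
    (hchain' : ∀ (i : ℕ) (h1 : i + 1 < m) (h2 : i + 1 < n),
      B' ⟨i, Nat.lt_of_succ_lt h1⟩ ⟨i, Nat.lt_of_succ_lt h2⟩ ∣ B' ⟨i + 1, h1⟩ ⟨i + 1, h2⟩) :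
    ∀ (i : ℕ) (h1 : i < m) (h2 : i < n),
      ∃ u : Rˣ, B' ⟨i, h1⟩ ⟨i, h2⟩ = u * B ⟨i, h1⟩ ⟨i, h2⟩ := by
  intro i h1 h2
  have hXY := Matrix.eq_mul_mul_of_eq_mul_mul hP hQ hB hB'
  have hXY' := Matrix.eq_mul_mul_of_eq_mul_mul hP' hQ' hB' hB
  have ha := Matrix.diagEntry_dvd_diagEntry hchain
  have ha' := Matrix.diagEntry_dvd_diagEntry hchain'
  have hb := Matrix.apply_eq_ite_diagEntry hdiag
  have hb' := Matrix.apply_eq_ite_diagEntry hdiag'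
  have hprod : ∀ k, k ≤ m → k ≤ n → Associated (∏ j : Fin k, Matrix.diagEntry B j)
      (∏ j : Fin k, Matrix.diagEntry B' j) := fun k hm hn =>
    associated_of_dvd_dvd (Matrix.prod_dvd_prod_of_eq_mul_mul hm hn ha hb hb' _ _ hXY)
      (Matrix.prod_dvd_prod_of_eq_mul_mul hm hn ha' hb' hb _ _ hXY')
  obtain ⟨u, hu⟩ := associated_of_associated_prod ha ha' (hprod i h1.le h2.le)
    (hprod (i + 1) h1 h2)
  rw [Matrix.diagEntry_of_lt B h1 h2, Matrix.diagEntry_of_lt B' h1 h2] at hu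
  exact ⟨u, by rw [← hu, mul_comm]⟩
end

section
/- Let n ≥ 1 and let M be the n×n integer matrix with rows and columns indexed by 0, 1, …, n−1 whose (i,j)-entry is the central binomial coefficient C(2(i+j), i+j). Then M has Smith normal form over ℤ with diagonal entries (1, 2, 2, …, 2), i.e., one entry equal to 1 followed by n−1 entries equal to 2. In particular, det M = ±2^{n−1}. -/
/-- Vandermonde's identity for the central binomial coefficient, with the terms that are symmetric
about the middle grouped together. -/
theorem choose_two_mul_add_eq_symm_sum (i j m : ℕ) (hi : i ≤ m) (hj : j ≤ m) :
    (2 * (i + j)).choose (i + j) = (2 * i).choose i * (2 * j).choose j +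
      2 * ∑ k ∈ Finset.range m, (2 * i).choose (i + (k + 1)) * (2 * j).choose (j + (k + 1)) := by
  have lower : ∑ a ∈ Finset.range i, (2 * i).choose a * (2 * j).choose (i + j - a) =
      ∑ k ∈ Finset.range m, (2 * i).choose (i + (k + 1)) * (2 * j).choose (j + (k + 1)) := by
    rw [← Finset.sum_range_reflect]
    rw [← Finset.sum_subset (Finset.range_mono hi)]
    · refine Finset.sum_congr rfl fun k hk => ?_
      rw [Finset.mem_range] at hk
      rw [← Nat.choose_symm_of_eq_add (show 2 * i = (i - 1 - k) + (i + (k + 1)) by omega),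
        show i + j - (i - 1 - k) = j + (k + 1) by omega]
    · intro k _ hk
      rw [Finset.mem_range] at hk
      rw [Nat.choose_eq_zero_of_lt (show 2 * i < i + (k + 1) by omega), zero_mul]
  have upper : ∑ k ∈ Finset.range j,
      (2 * i).choose (i + (k + 1)) * (2 * j).choose (i + j - (i + (k + 1))) =
      ∑ k ∈ Finset.range m, (2 * i).choose (i + (k + 1)) * (2 * j).choose (j + (k + 1)) := by
    rw [← Finset.sum_subset (Finset.range_mono hj)]
    · refine Finset.sum_congr rfl fun k hk => ?_
      rw [Finset.mem_range] at hk
      rw [Nat.choose_symm_of_eq_add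
        (show 2 * j = (i + j - (i + (k + 1))) + (j + (k + 1)) by omega)]
    · intro k _ hk
      rw [Finset.mem_range] at hk
      rw [Nat.choose_eq_zero_of_lt (show 2 * j < j + (k + 1) by omega), mul_zero]
  rw [mul_add, Nat.add_choose_eq,
    Finset.Nat.sum_antidiagonal_eq_sum_range_succ
      (fun a b => (2 * i).choose a * (2 * j).choose b),
    Nat.succ_eq_add_one, add_assoc i j 1, Finset.sum_range_add, Finset.sum_range_succ', lower, upper, add_zero,
    Nat.add_sub_cancel_left]
  ring

/-- The unitriangular matrix with entries `C(2i, i+k)`. -/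
def centralBinomFactor (n : ℕ) : Matrix (Fin n) (Fin n) ℤ :=
  Matrix.of fun i k => ((2 * (i : ℕ)).choose ((i : ℕ) + (k : ℕ)) : ℤ)

theorem det_centralBinomFactor (n : ℕ) : (centralBinomFactor n).det = 1 := by
  rw [Matrix.det_of_isLowerTriangular]
  · refine Finset.prod_eq_one fun i _ => ?_
    simp [centralBinomFactor, ← two_mul]
  · intro i k hik
    have hlt : (i : ℕ) < k := hik
    simp only [centralBinomFactor, Matrix.of_apply, Nat.cast_eq_zero]
    exact Nat.choose_eq_zero_of_lt (by omega)

theorem centralBinomFactor_mul_diagonal_mul_transpose_apply (n : ℕ) (i j : Fin n) :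
    (centralBinomFactor n * Matrix.diagonal (fun k : Fin n => if (k : ℕ) = 0 then 1 else (2 : ℤ)) *
      (centralBinomFactor n).transpose) i j =
      (Nat.choose (2 * ((i : ℕ) + (j : ℕ))) ((i : ℕ) + (j : ℕ)) : ℤ) := by
  obtain _ | m := n
  · exact i.elim0
  rw [choose_two_mul_add_eq_symm_sum i j m (by omega) (by omega), Matrix.mul_apply]
  simp only [Matrix.mul_diagonal, Matrix.transpose_apply, centralBinomFactor, Matrix.of_apply]
  rw [Fin.sum_univ_succ, ← Fin.sum_univ_eq_sum_range
    (fun k => (2 * (i : ℕ)).choose (i + (k + 1)) * (2 * (j : ℕ)).choose (j + (k + 1))),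
    Finset.mul_sum]
  push_cast
  simp only [Fin.val_zero, Fin.val_succ, add_zero, if_true, mul_one, Nat.succ_ne_zero, if_false]
  congr 1
  exact Finset.sum_congr rfl fun k _ => by ring


/-- The n×n matrix `M` with entries `M i j = C(2(i+j), i+j)` (central
binomial coefficients, rows and columns indexed by `0, …, n-1`) has Smith normal form
`diag(1, 2, 2, …, 2)` over `ℤ`.  In particular `det M = ±2^{n-1}`. -/
theorem stmt9 (n : ℕ) (hn : 1 ≤ n)
    (M : Matrix (Fin n) (Fin n) ℤ)
    (hM : ∀ i j : Fin n, M i j = (Nat.choose (2 * ((i : ℕ) + (j : ℕ))) ((i : ℕ) + (j : ℕ)) : ℤ)) :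
    (∃ (P Q : Matrix (Fin n) (Fin n) ℤ),
       IsUnit P.det ∧ IsUnit Q.det ∧
       P * M * Q = Matrix.diagonal (fun i : Fin n => if (i : ℕ) = 0 then 1 else (2 : ℤ))) ∧
    (M.det = 2 ^ (n - 1) ∨ M.det = -(2 ^ (n - 1))) := by
  set D : Matrix (Fin n) (Fin n) ℤ :=
    Matrix.diagonal (fun i : Fin n => if (i : ℕ) = 0 then 1 else (2 : ℤ)) with hD
  set L := centralBinomFactor n
  have hLdet : L.det = 1 := det_centralBinomFactor n
  have hfac : M = L * D * L.transpose := by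
    ext i j
    rw [hM, centralBinomFactor_mul_diagonal_mul_transpose_apply]
  have hLu : IsUnit L.det := by simp [hLdet]
  have hLtu : IsUnit L.transpose.det := by simp [hLdet]
  refine ⟨⟨L⁻¹, L.transpose⁻¹, L.isUnit_nonsing_inv_det hLu,
    L.transpose.isUnit_nonsing_inv_det hLtu, ?_⟩, Or.inl ?_⟩
  · rw [hfac, Matrix.mul_assoc L, Matrix.nonsing_inv_mul_cancel_left _ _ hLu,
      Matrix.mul_nonsing_inv_cancel_right _ _ hLtu]
  · obtain ⟨m, rfl⟩ := Nat.exists_eq_add_of_le' hn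
    rw [hfac, Matrix.det_mul, Matrix.det_mul, Matrix.det_transpose, hLdet, hD,
      Matrix.det_diagonal, Fin.prod_univ_succ]
    simp
end

section
/- Let N ≥ 2 and j ≥ 1 be integers. For k ≥ 1 let f(k) be the number of vectors (a_1, …, a_N) with each a_i an integer in the interval [−k, k] such that gcd(a_1, …, a_N) = j. Then lim_{k→∞} f(k)/(2k+1)^N = 1/(j^N ζ(N)), where ζ denotes the Riemann zeta function. -/
open Filter

theorem card_filter_dvd_Icc_neg (k m : ℕ) (hm : m ≠ 0) :
    ((Finset.Icc (-(k : ℤ)) k).filter ((m : ℤ) ∣ ·)).card = 2 * (k / m) + 1 := by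
  have hm' : (0 : ℤ) < m := by positivity
  have h : (Finset.Icc (-(k : ℤ)) k).filter ((m : ℤ) ∣ ·) =
      (Finset.Icc (-((k / m : ℕ) : ℤ)) ((k / m : ℕ) : ℤ)).image ((m : ℤ) * ·) := by
    ext x
    simp only [Finset.mem_filter, Finset.mem_Icc, Finset.mem_image, Int.natCast_div]
    constructor
    · rintro ⟨⟨h1, h2⟩, c, rfl⟩
      refine ⟨c, ⟨?_, ?_⟩, rfl⟩
      · rw [neg_le, Int.le_ediv_iff_mul_le hm']
        linarith
      · rw [Int.le_ediv_iff_mul_le hm']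
        linarith
    · rintro ⟨c, ⟨h1, h2⟩, rfl⟩
      rw [neg_le, Int.le_ediv_iff_mul_le hm'] at h1
      rw [Int.le_ediv_iff_mul_le hm'] at h2
      exact ⟨⟨by linarith, by linarith⟩, dvd_mul_right _ _⟩
  rw [h, Finset.card_image_of_injective _ (mul_right_injective₀ hm'.ne'), Int.card_Icc]
  omega

theorem card_filter_dvd_gcd (N k m : ℕ) (hm : m ≠ 0) :
    ((Fintype.piFinset fun _ : Fin N => Finset.Icc (-(k : ℤ)) k).filter
      fun a => (m : ℤ) ∣ Finset.univ.gcd a).card = (2 * (k / m) + 1) ^ N := by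
  have h : (Fintype.piFinset fun _ : Fin N => Finset.Icc (-(k : ℤ)) k).filter
      (fun a => (m : ℤ) ∣ Finset.univ.gcd a) =
      Fintype.piFinset fun _ : Fin N => (Finset.Icc (-(k : ℤ)) k).filter ((m : ℤ) ∣ ·) := by
    ext a
    simp [Fintype.mem_piFinset, Finset.dvd_gcd_iff, forall_and]
  rw [h, Fintype.card_piFinset]
  simp [card_filter_dvd_Icc_neg k m hm]

theorem sum_moebius_filter_mul_dvd {k j g : ℕ} (hg : g ≠ 0) (hgk : g ≤ k) (hj : j ≠ 0) :
    ∑ d ∈ Finset.Icc 1 k, (if j * d ∣ g then ArithmeticFunction.moebius d else 0) =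
      if g = j then 1 else 0 := by
  by_cases hjg : j ∣ g
  · obtain ⟨c, rfl⟩ := hjg
    have hc : c ≠ 0 := right_ne_zero_of_mul hg
    have hck : c ≤ k := (Nat.le_mul_of_pos_left c (Nat.pos_of_ne_zero hj)).trans hgk
    have hdiv : (Finset.Icc 1 k).filter (fun d => j * d ∣ j * c) = c.divisors := by
      ext d
      simp only [Finset.mem_filter, Finset.mem_Icc, Nat.mul_dvd_mul_iff_left
        (Nat.pos_of_ne_zero hj), Nat.mem_divisors]
      exact ⟨fun h => ⟨h.2, hc⟩, fun h =>
        ⟨⟨Nat.pos_of_dvd_of_pos h.1 (Nat.pos_of_ne_zero hc),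
          (Nat.le_of_dvd (Nat.pos_of_ne_zero hc) h.1).trans hck⟩, h.1⟩⟩
    rw [← Finset.sum_filter, hdiv, ← ArithmeticFunction.coe_mul_zeta_apply,
      ArithmeticFunction.moebius_mul_coe_zeta, ArithmeticFunction.one_apply]
    simp [hj]
  · rw [if_neg (fun h => hjg h.symm.dvd)]
    exact Finset.sum_eq_zero fun d _ => if_neg fun h => hjg (dvd_of_mul_right_dvd h)

theorem natAbs_gcd_le {N k : ℕ} {a : Fin N → ℤ} (ha : ∀ i, a i ∈ Finset.Icc (-(k : ℤ)) k)
    (h0 : a ≠ 0) : (Finset.univ.gcd a).natAbs ≤ k := by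
  obtain ⟨i, hi⟩ := Function.ne_iff.mp h0
  have h1 := Nat.le_of_dvd (Int.natAbs_pos.mpr hi)
    (Int.natAbs_dvd_natAbs.mpr (Finset.gcd_dvd (f := a) (Finset.mem_univ i)))
  have h2 := Finset.mem_Icc.mp (ha i)
  omega

theorem card_gcd_eq (N j k : ℕ) (hj : j ≠ 0) :
    (Nat.card {a : Fin N → ℤ //
        (∀ i, a i ∈ Finset.Icc (-(k : ℤ)) k) ∧ Finset.univ.gcd a = (j : ℤ)} : ℤ) =
      ∑ d ∈ Finset.Icc 1 k,
        ArithmeticFunction.moebius d * ((2 * ((k / (j * d) : ℕ) : ℤ) + 1) ^ N - 1) := by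
  set B := Fintype.piFinset fun _ : Fin N => Finset.Icc (-(k : ℤ)) k with hB
  have hcard : (Nat.card {a : Fin N → ℤ //
        (∀ i, a i ∈ Finset.Icc (-(k : ℤ)) k) ∧ Finset.univ.gcd a = (j : ℤ)} : ℤ) =
      ∑ a ∈ B.erase 0, if (Finset.univ.gcd a).natAbs = j then (1 : ℤ) else 0 := by
    rw [Finset.sum_boole, Nat.cast_inj, ← Nat.card_eq_finsetCard]
    refine Nat.card_congr (Equiv.subtypeEquivRight fun a => ?_)
    have hnorm : 0 ≤ Finset.univ.gcd a :=
      Int.nonneg_iff_normalize_eq_self _ |>.mp Finset.normalize_gcd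
    rw [Finset.mem_filter, Finset.mem_erase, hB, Fintype.mem_piFinset]
    constructor
    · rintro ⟨hbox, hgcd⟩
      refine ⟨⟨?_, hbox⟩, by omega⟩
      rintro rfl
      have := Finset.gcd_eq_zero_iff.mpr fun (i : Fin N) (_ : i ∈ Finset.univ) =>
        Pi.zero_apply (M := fun _ => ℤ) i
      omega
    · rintro ⟨⟨-, hbox⟩, hgcd⟩
      exact ⟨hbox, by omega⟩
  have hinner (a : Fin N → ℤ) (ha : a ∈ B.erase 0) :
      (if (Finset.univ.gcd a).natAbs = j then (1 : ℤ) else 0) =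
        ∑ d ∈ Finset.Icc 1 k,
          if ((j * d : ℕ) : ℤ) ∣ Finset.univ.gcd a then ArithmeticFunction.moebius d else 0 := by
    rw [Finset.mem_erase, hB, Fintype.mem_piFinset] at ha
    have hg : (Finset.univ.gcd a).natAbs ≠ 0 := by
      rw [Ne, Int.natAbs_eq_zero, Finset.gcd_eq_zero_iff]
      exact fun h => ha.1 (funext fun i => h i (Finset.mem_univ i))
    rw [← sum_moebius_filter_mul_dvd hg (natAbs_gcd_le ha.2 ha.1) hj]
    simp only [Int.natCast_dvd]
  rw [hcard, Finset.sum_congr rfl hinner, Finset.sum_comm]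
  refine Finset.sum_congr rfl fun d hd => ?_
  have hm : j * d ≠ 0 := mul_ne_zero hj (by have := (Finset.mem_Icc.mp hd).1; omega)
  have h0 : (0 : Fin N → ℤ) ∈ B.filter fun a => ((j * d : ℕ) : ℤ) ∣ Finset.univ.gcd a := by
    simp [hB, Fintype.mem_piFinset, Finset.dvd_gcd_iff]
  have hc := Finset.card_erase_add_one h0
  rw [card_filter_dvd_gcd N k _ hm] at hc
  rw [← Finset.sum_filter, Finset.sum_const, Finset.filter_erase, nsmul_eq_mul, mul_comm]
  congr 1
  rw [eq_sub_iff_add_eq]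
  exact_mod_cast hc

theorem tendsto_inv_two_mul_natCast_add_one :
    Tendsto (fun k : ℕ => ((2 * k + 1 : ℝ))⁻¹) atTop (nhds 0) :=
  tendsto_inv_atTop_zero.comp (tendsto_atTop_add_const_right _ _
    (tendsto_natCast_atTop_atTop.const_mul_atTop two_pos))

theorem tendsto_two_mul_div_add_one (m : ℕ) (hm : m ≠ 0) :
    Tendsto (fun k : ℕ => (2 * ((k / m : ℕ) : ℝ) + 1) / (2 * k + 1)) atTop (nhds (1 / m)) := by
  have hm' : (0 : ℝ) < m := by positivity
  have hlow : Tendsto (fun k : ℕ => (1 / m : ℝ) - 2 * ((2 * k + 1 : ℝ))⁻¹) atTop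
      (nhds (1 / m)) := by
    simpa using (tendsto_inv_two_mul_natCast_add_one.const_mul 2).const_sub (1 / m : ℝ)
  have hupp : Tendsto (fun k : ℕ => (1 / m : ℝ) + 1 * ((2 * k + 1 : ℝ))⁻¹) atTop
      (nhds (1 / m)) := by
    simpa using (tendsto_inv_two_mul_natCast_add_one.const_mul 1).const_add (1 / m : ℝ)
  refine tendsto_of_tendsto_of_tendsto_of_le_of_le hlow hupp (fun k => ?_) fun k => ?_
  · have h1 : (k : ℝ) ≤ m * ((k / m : ℕ) : ℝ) + m := by
      exact_mod_cast (Nat.lt_mul_div_succ k (Nat.pos_of_ne_zero hm)).le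
    have h2 : (1 : ℝ) ≤ m := by exact_mod_cast Nat.one_le_iff_ne_zero.mpr hm
    rw [← sub_nonneg]
    have : (2 * ((k / m : ℕ) : ℝ) + 1) / (2 * k + 1) - ((1 / m : ℝ) - 2 * ((2 * k + 1 : ℝ))⁻¹) =
      (m * (2 * ((k / m : ℕ) : ℝ) + 1) - (2 * k + 1) + 2 * m) / (m * (2 * k + 1)) := by
      field_simp
      ring
    rw [this]
    apply div_nonneg
    · linarith
    · positivity
  · have h1 : (m : ℝ) * ((k / m : ℕ) : ℝ) ≤ k := by exact_mod_cast Nat.mul_div_le k m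
    rw [← sub_nonneg]
    have : ((1 / m : ℝ) + 1 * ((2 * k + 1 : ℝ))⁻¹) - (2 * ((k / m : ℕ) : ℝ) + 1) / (2 * k + 1) =
      (2 * k + 1 - 2 * (m * ((k / m : ℕ) : ℝ))) / (m * (2 * k + 1)) := by
      field_simp
      ring
    rw [this]
    apply div_nonneg
    · linarith
    · positivity

theorem count_ratio_le (N k m : ℕ) :
    ((2 * ((k / m : ℕ) : ℝ) + 1) ^ N - 1) / (2 * k + 1) ^ N ≤ 2 ^ N * (1 / (m : ℝ) ^ N) := by
  by_cases h : k / m = 0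
  · simp only [h, Nat.cast_zero, mul_zero, zero_add, one_pow, sub_self, zero_div]
    positivity
  · have hm : (0 : ℝ) < m := by
      have : m ≠ 0 := by rintro rfl; simp at h
      positivity
    have h1 : (m : ℝ) * ((k / m : ℕ) : ℝ) ≤ k := by exact_mod_cast Nat.mul_div_le k m
    have h2 : (1 : ℝ) ≤ ((k / m : ℕ) : ℝ) := by exact_mod_cast Nat.one_le_iff_ne_zero.mpr h
    calc _ ≤ (2 * ((k / m : ℕ) : ℝ) + 1) ^ N / (2 * k + 1) ^ N := by gcongr; linarith
      _ = ((2 * ((k / m : ℕ) : ℝ) + 1) / (2 * k + 1)) ^ N := (div_pow ..).symm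
      _ ≤ (2 * (1 / m)) ^ N := by
        gcongr
        rw [div_le_iff₀ (by positivity), mul_one_div, div_mul_eq_mul_div, le_div_iff₀ hm]
        nlinarith
      _ = _ := by rw [mul_pow, one_div_pow]

theorem tsum_moebius_div_pow (N : ℕ) (hN : 2 ≤ N) :
    ∑' d : ℕ, (ArithmeticFunction.moebius d : ℝ) * (1 / (d : ℝ) ^ N) =
      (∑' m : ℕ, 1 / ((m : ℝ) + 1) ^ N)⁻¹ := by
  have hre : 1 < ((N : ℂ)).re := by simpa using (by exact_mod_cast hN : (1 : ℝ) < N)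
  have h := ArithmeticFunction.LSeries_zeta_mul_Lseries_moebius hre
  rw [ArithmeticFunction.LSeries_zeta_eq_riemannZeta hre,
    zeta_eq_tsum_one_div_nat_add_one_cpow hre] at h
  have hzeta : ∑' m : ℕ, 1 / ((m : ℂ) + 1) ^ (N : ℂ) =
      ((∑' m : ℕ, 1 / ((m : ℝ) + 1) ^ N : ℝ) : ℂ) := by
    push_cast
    simp only [Complex.cpow_natCast]
  have hmu : LSeries (fun n => ((ArithmeticFunction.moebius n : ℤ) : ℂ)) N =
      ((∑' d : ℕ, (ArithmeticFunction.moebius d : ℝ) * (1 / (d : ℝ) ^ N) : ℝ) : ℂ) := by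
    rw [LSeries, Complex.ofReal_tsum]
    refine tsum_congr fun d => ?_
    rcases eq_or_ne d 0 with rfl | hd
    · simp
    · rw [LSeries.term_of_ne_zero hd]
      simp [div_eq_mul_inv]
  rw [hzeta, hmu, ← Complex.ofReal_mul, Complex.ofReal_eq_one] at h
  exact eq_inv_of_mul_eq_one_right h

/-- For integers `N ≥ 2` and `j ≥ 1`, let `f(k)` be the number of vectors
`(a_1, …, a_N)` of integers with `|a_i| ≤ k` and `gcd(a_1, …, a_N) = j`.  Then
`f(k)/(2k+1)^N → 1/(j^N ζ(N))` as `k → ∞`, where `ζ(N) = ∑_{m ≥ 1} m^{-N}`. -/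
theorem stmt10 (N j : ℕ) (hN : 2 ≤ N) (hj : 1 ≤ j) :
    Tendsto
      (fun k : ℕ =>
        (Nat.card {a : Fin N → ℤ //
            (∀ i, a i ∈ Finset.Icc (-(k : ℤ)) (k : ℤ)) ∧
            Finset.univ.gcd a = (j : ℤ)} : ℝ) / (2 * (k : ℝ) + 1) ^ N)
      atTop
      (nhds (1 / ((j : ℝ) ^ N * ∑' m : ℕ, 1 / ((m : ℝ) + 1) ^ N))) := by
  have hj0 : j ≠ 0 := by omega
  have hN0 : N ≠ 0 := by omega
  have hlim : 1 / ((j : ℝ) ^ N * ∑' m : ℕ, 1 / ((m : ℝ) + 1) ^ N) =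
      ∑' d : ℕ, (ArithmeticFunction.moebius d : ℝ) * (1 / ((j * d : ℕ) : ℝ) ^ N) := by
    rw [one_div, mul_inv, ← tsum_moebius_div_pow N hN, ← tsum_mul_left]
    refine tsum_congr fun d => ?_
    push_cast
    rw [mul_pow, one_div, one_div, mul_inv]
    ring
  have hcount (k : ℕ) : (Nat.card {a : Fin N → ℤ //
            (∀ i, a i ∈ Finset.Icc (-(k : ℤ)) (k : ℤ)) ∧
            Finset.univ.gcd a = (j : ℤ)} : ℝ) / (2 * (k : ℝ) + 1) ^ N =
      ∑' d : ℕ, (ArithmeticFunction.moebius d : ℝ) *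
        (((2 * ((k / (j * d) : ℕ) : ℝ) + 1) ^ N - 1) / (2 * k + 1) ^ N) := by
    rw [tsum_eq_sum (s := Finset.Icc 1 k), ← Int.cast_natCast, card_gcd_eq N j k hj0]
    · simp only [Int.cast_sum, Int.cast_mul, Int.cast_sub, Int.cast_pow, Int.cast_add,
        Int.cast_one, Int.cast_ofNat, Int.cast_natCast, Finset.sum_div, mul_div_assoc]
    · intro d hd
      have : k / (j * d) = 0 := by
        rcases Nat.eq_zero_or_pos d with rfl | hd0
        · simp
        · refine Nat.div_eq_of_lt (lt_of_lt_of_le ?_ (Nat.le_mul_of_pos_left d hj))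
          by_contra! hle
          exact hd (Finset.mem_Icc.mpr ⟨hd0, hle⟩)
      simp [this]
  simp_rw [hcount, hlim]
  refine tendsto_tsum_of_dominated_convergence
    (bound := fun d : ℕ => 2 ^ N * (1 / (d : ℝ) ^ N)) ?_ (fun d => ?_) (.of_forall fun k d => ?_)
  · exact (Real.summable_one_div_nat_pow.mpr hN).mul_left _
  · rcases eq_or_ne d 0 with rfl | hd
    · simp
    · refine Tendsto.const_mul _ ?_
      have h := ((tendsto_two_mul_div_add_one (j * d) (mul_ne_zero hj0 hd)).pow N).sub
        (tendsto_inv_two_mul_natCast_add_one.pow N)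
      rw [zero_pow hN0, sub_zero, one_div_pow] at h
      refine h.congr fun k => ?_
      rw [div_pow, inv_pow, sub_div, one_div]
  · have hmu : |(ArithmeticFunction.moebius d : ℝ)| ≤ 1 := by
      exact_mod_cast ArithmeticFunction.abs_moebius_le_one (n := d)
    have hnn : 0 ≤ ((2 * ((k / (j * d) : ℕ) : ℝ) + 1) ^ N - 1) / (2 * k + 1) ^ N := by
      refine div_nonneg (sub_nonneg.mpr (one_le_pow₀ ?_)) (by positivity)
      linarith [Nat.cast_nonneg (α := ℝ) (k / (j * d))]
    rw [Real.norm_eq_abs, abs_mul, abs_of_nonneg hnn]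
    refine (mul_le_of_le_one_left hnn hmu).trans ((count_ratio_le N k (j * d)).trans ?_)
    rcases eq_or_ne d 0 with rfl | hd
    · simp
    · have : d ≤ j * d := Nat.le_mul_of_pos_left d hj
      gcongr
end

section
/- For n ≥ 2, define σ(n) = ∏_p (1 + p^{−2} + p^{−3} + ⋯ + p^{−n}) / ∏_{j≥2} ζ(j), where the first product ranges over all primes p and ζ denotes the Riemann zeta function. Then lim_{n→∞} σ(n) = 1/(ζ(6) ∏_{j≥4} ζ(j)). -/
open Filter

/-- The completely multiplicative function `m ↦ m ^ (-s)`. -/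
noncomputable def invPowHom (s : ℕ) (hs : s ≠ 0) : ℕ →*₀ ℝ where
  toFun m := (1 / (m : ℝ)) ^ s
  map_zero' := by simp [hs]
  map_one' := by simp
  map_mul' a b := by simp [mul_pow, mul_comm]

lemma summable_one_div_pow_nat {s : ℕ} (hs : 2 ≤ s) :
    Summable fun m : ℕ ↦ (1 / (m : ℝ)) ^ s := by
  simpa [one_div_pow] using Real.summable_one_div_nat_pow.mpr (by lia : 1 < s)

lemma summable_one_div_succ_pow {s : ℕ} (hs : 2 ≤ s) :
    Summable fun m : ℕ ↦ 1 / ((m : ℝ) + 1) ^ s := by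
  simpa [one_div_pow] using (summable_nat_add_iff 1).mpr (summable_one_div_pow_nat hs)

lemma tsum_one_div_pow_nat {s : ℕ} (hs : 2 ≤ s) :
    ∑' m : ℕ, (1 / (m : ℝ)) ^ s = ∑' m : ℕ, 1 / ((m : ℝ) + 1) ^ s := by
  rw [(summable_one_div_pow_nat hs).tsum_eq_zero_add]
  simp [show s ≠ 0 by lia]

lemma hasProd_primes_one_sub_inv {s : ℕ} (hs : 2 ≤ s) :
    HasProd (fun p : Nat.Primes ↦ (1 - (1 / ((p : ℕ) : ℝ)) ^ s)⁻¹)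
      (∑' m : ℕ, 1 / ((m : ℝ) + 1) ^ s) := by
  rw [← tsum_one_div_pow_nat hs]
  refine EulerProduct.eulerProduct_completely_multiplicative_hasProd
    (f := invPowHom s (by lia)) ?_
  exact (summable_one_div_pow_nat hs).norm

lemma one_le_tsum_one_div_succ_pow {s : ℕ} (hs : 2 ≤ s) :
    1 ≤ ∑' m : ℕ, 1 / ((m : ℝ) + 1) ^ s := by
  simpa using (summable_one_div_succ_pow hs).le_tsum 0 (fun m _ ↦ by positivity)

lemma multipliable_tsum_one_div_succ_pow (k : ℕ) (hk : 2 ≤ k) :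
    Multipliable fun j : ℕ ↦ ∑' m : ℕ, 1 / ((m : ℝ) + 1) ^ (j + k) := by
  have hs : Summable fun m : ℕ ↦ 1 / ((m : ℝ) + 2) ^ k := by
    simpa [add_assoc, one_add_one_eq_two] using
      (summable_nat_add_iff 1).mpr (summable_one_div_succ_pow hk)
  have hsplit (j : ℕ) : ∑' m : ℕ, 1 / ((m : ℝ) + 1) ^ (j + k) =
      1 + ∑' m : ℕ, 1 / ((m : ℝ) + 2) ^ (j + k) := by
    rw [(summable_one_div_succ_pow (by lia)).tsum_eq_zero_add]
    simp [add_assoc, one_add_one_eq_two]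
  have hterm (j m : ℕ) :
      1 / ((m : ℝ) + 2) ^ (j + k) ≤ (1 / 2) ^ j * (1 / ((m : ℝ) + 2) ^ k) := by
    rw [pow_add, ← one_div_mul_one_div, one_div_pow]
    gcongr
    linarith [(m.cast_nonneg : (0 : ℝ) ≤ m)]
  simp_rw [hsplit]
  refine Real.multipliable_one_add_of_summable ?_
  refine Summable.of_nonneg_of_le (fun j ↦ tsum_nonneg fun m ↦ by positivity) (fun j ↦ ?_)
    ((summable_geometric_of_lt_one (r := (1 / 2 : ℝ)) (by norm_num) (by norm_num)).mul_right
      (∑' m : ℕ, 1 / ((m : ℝ) + 2) ^ k))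
  rw [← tsum_mul_left]
  exact (Summable.of_nonneg_of_le (fun m ↦ by positivity) (hterm j)
    (hs.mul_left _)).tsum_le_tsum (hterm j) (hs.mul_left _)

lemma hasSum_pow_add_two {x : ℝ} (h0 : 0 ≤ x) (h1 : x < 1) :
    HasSum (fun i : ℕ ↦ x ^ (i + 2)) (x ^ 2 / (1 - x)) := by
  simpa [pow_add, mul_comm, div_eq_mul_inv] using (hasSum_geometric_of_lt_one h0 h1).mul_left (x ^ 2)

lemma sum_Icc_two_pow (x : ℝ) (n : ℕ) :
    ∑ i ∈ Finset.Icc 2 n, x ^ i = ∑ i ∈ Finset.range (n - 1), x ^ (i + 2) := by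
  rw [← Finset.Ico_succ_right_eq_Icc, Finset.sum_Ico_eq_sum_range]
  refine Finset.sum_congr ?_ fun i _ ↦ by rw [add_comm]
  simp

lemma Nat.Primes.one_div_le_half (p : Nat.Primes) : 1 / ((p : ℕ) : ℝ) ≤ 1 / 2 := by
  have : (2 : ℝ) ≤ (p : ℕ) := by exact_mod_cast p.2.two_le
  gcongr

lemma sq_div_one_sub_le {x : ℝ} (h1 : x ≤ 1 / 2) : x ^ 2 / (1 - x) ≤ 2 * x ^ 2 := by
  rw [div_le_iff₀ (by linarith)]
  nlinarith [sq_nonneg x]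

lemma summable_primes_two_mul_sq :
    Summable fun p : Nat.Primes ↦ 2 * (1 / ((p : ℕ) : ℝ)) ^ 2 :=
  ((summable_one_div_pow_nat le_rfl).comp_injective Nat.Primes.coe_nat_injective).mul_left 2

lemma tendsto_tprod_primes_one_add_sum :
    Tendsto (fun n : ℕ ↦ ∏' p : Nat.Primes,
        (1 + ∑ i ∈ Finset.Icc 2 n, (1 / ((p : ℕ) : ℝ)) ^ i)) atTop
      (nhds (∏' p : Nat.Primes,
        (1 + (1 / ((p : ℕ) : ℝ)) ^ 2 / (1 - 1 / ((p : ℕ) : ℝ))))) := by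
  have hsum (p : Nat.Primes) := hasSum_pow_add_two (x := 1 / ((p : ℕ) : ℝ)) (by positivity)
    (p.one_div_le_half.trans_lt (by norm_num))
  refine tendsto_tprod_one_add_of_dominated_convergence summable_primes_two_mul_sq
    (fun p ↦ ?_) (.of_forall fun n p ↦ ?_)
  · simp_rw [sum_Icc_two_pow]
    exact (hsum p).tendsto_sum_nat.comp (tendsto_sub_atTop_nat 1)
  · rw [Real.norm_of_nonneg (by positivity), sum_Icc_two_pow]
    exact (sum_le_hasSum _ (fun i _ ↦ by positivity) (hsum p)).trans
      (sq_div_one_sub_le p.one_div_le_half)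

lemma tprod_primes_mul_zeta_six :
    (∏' p : Nat.Primes, (1 + (1 / ((p : ℕ) : ℝ)) ^ 2 / (1 - 1 / ((p : ℕ) : ℝ)))) *
        ∑' m : ℕ, 1 / ((m : ℝ) + 1) ^ 6 =
      (∑' m : ℕ, 1 / ((m : ℝ) + 1) ^ 2) * ∑' m : ℕ, 1 / ((m : ℝ) + 1) ^ 3 := by
  have hmul : Multipliable fun p : Nat.Primes ↦
      1 + (1 / ((p : ℕ) : ℝ)) ^ 2 / (1 - 1 / ((p : ℕ) : ℝ)) := by
    refine Real.multipliable_one_add_of_summable (summable_primes_two_mul_sq.of_nonneg_of_le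
      (fun p ↦ ?_) fun p ↦ sq_div_one_sub_le p.one_div_le_half)
    have := p.one_div_le_half
    exact div_nonneg (by positivity) (by linarith)
  refine (hmul.hasProd.mul (hasProd_primes_one_sub_inv (s := 6) (by norm_num))).unique ?_
  convert (hasProd_primes_one_sub_inv (s := 2) le_rfl).mul
    (hasProd_primes_one_sub_inv (s := 3) (by norm_num)) using 2 with p
  have h0 : 0 ≤ 1 / ((p : ℕ) : ℝ) := by positivity
  have h1 : 1 / ((p : ℕ) : ℝ) < 1 := p.one_div_le_half.trans_lt (by norm_num)
  generalize 1 / ((p : ℕ) : ℝ) = x at h0 h1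
  have hx (k : ℕ) (hk : k ≠ 0) : 1 - x ^ k ≠ 0 := (sub_pos.mpr (pow_lt_one₀ h0 h1 hk)).ne'
  have := hx 2 (by norm_num)
  have := hx 3 (by norm_num)
  have := hx 6 (by norm_num)
  have : 1 - x ≠ 0 := (sub_pos.mpr h1).ne'
  field_simp
  ring

/-- With `ζ(s) = ∑_{m ≥ 1} m^{-s}` and
`σ(n) = ∏_p (1 + p^{-2} + ⋯ + p^{-n}) / ∏_{j ≥ 2} ζ(j)` (product over all primes `p`),
we have `lim_{n → ∞} σ(n) = 1/(ζ(6) ∏_{j ≥ 4} ζ(j))`. -/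
theorem stmt12
    (zeta : ℕ → ℝ) (hzeta : ∀ s, zeta s = ∑' m : ℕ, 1 / ((m : ℝ) + 1) ^ s)
    (σ : ℕ → ℝ)
    (hσ : ∀ n, σ n =
      (∏' p : Nat.Primes, (1 + ∑ i ∈ Finset.Icc 2 n, (1 / ((p : ℕ) : ℝ)) ^ i)) /
        ∏' j : ℕ, zeta (j + 2)) :
    Tendsto σ atTop (nhds (1 / (zeta 6 * ∏' j : ℕ, zeta (j + 4)))) := by
  have hne (s : ℕ) (hs : 2 ≤ s) : zeta s ≠ 0 := by
    rw [hzeta]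
    exact (zero_lt_one.trans_le (one_le_tsum_one_div_succ_pow hs)).ne'
  have hmul : Multipliable fun j ↦ zeta (j + 4) := by
    simpa only [hzeta] using multipliable_tsum_one_div_succ_pow 4 (by norm_num)
  have hprod : ∏' j : ℕ, zeta (j + 2) = zeta 2 * zeta 3 * ∏' j : ℕ, zeta (j + 4) := by
    rw [← Multipliable.prod_mul_tprod_nat_mul' (f := fun j ↦ zeta (j + 2)) (k := 2) hmul]
    simp [Finset.prod_range_succ]
  have heuler := tprod_primes_mul_zeta_six
  rw [← hzeta, ← hzeta, ← hzeta] at heuler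
  rw [funext hσ, hprod]
  convert tendsto_tprod_primes_one_add_sum.div_const _ using 2
  rw [eq_div_of_mul_eq (hne 6 (by norm_num)) heuler]
  have := hne 2 le_rfl
  have := hne 3 (by norm_num)
  field_simp
end

section
/- Fix n ≥ 1 and let M_n be the square integer matrix with rows and columns indexed by the partitions of n, whose (λ, ν)-entry equals the number of partitions μ of n+1 whose Young diagram contains both the Young diagram of λ and the Young diagram of ν. (M_n is the matrix of the operator ψ_n(f) = (∂/∂p_1)(p_1 f) on symmetric functions of degree n with respect to the Schur function basis.) Then det M_n = ∏_{λ ⊢ n} (m_1(λ) + 1), where m_1(λ) denotes the number of parts of λ equal to 1. -/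
open scoped Classical

/-- Young-diagram containment of partitions: `a ⊆ b` iff `a_i ≤ b_i` for all `i`,
equivalently the conjugate parts satisfy `a'_j ≤ b'_j` for all `j ≥ 1`, where
`a'_j` is the number of parts of `a` that are `≥ j`. -/
def PartitionLE {n m : ℕ} (a : Nat.Partition n) (b : Nat.Partition m) : Prop :=
  ∀ j : ℕ, 1 ≤ j →
    Multiset.card (a.parts.filter (fun p => j ≤ p)) ≤
      Multiset.card (b.parts.filter (fun p => j ≤ p))

/-- The matrix of the operator `ψ_n(f) = (∂/∂p₁)(p₁ f)` in the Schur basis: rows and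
columns are indexed by partitions of `n`, and the `(λ, ν)` entry is the number of
partitions `μ ⊢ n+1` whose Young diagram contains those of both `λ` and `ν`. -/
noncomputable def psiMatrix (n : ℕ) :
    Matrix (Nat.Partition n) (Nat.Partition n) ℤ :=
  fun lam nu =>
    (Nat.card {μ : Nat.Partition (n + 1) // PartitionLE lam μ ∧ PartitionLE nu μ} : ℤ)

namespace YoungDiagram

theorem colLen_mono {a b : YoungDiagram} (h : a ≤ b) (j : ℕ) : a.colLen j ≤ b.colLen j := by
  rw [colLen_eq_card, colLen_eq_card]
  refine Finset.card_le_card fun c hc => ?_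
  rw [mem_col_iff] at hc ⊢
  exact ⟨h hc.1, hc.2⟩

theorem le_iff_colLen_le {a b : YoungDiagram} : a ≤ b ↔ ∀ j, a.colLen j ≤ b.colLen j := by
  refine ⟨colLen_mono, fun h => ?_⟩
  rintro ⟨i, j⟩ hc
  exact mem_iff_lt_colLen.2 ((mem_iff_lt_colLen.1 hc).trans_le (h j))

theorem eq_of_le_of_card_le {a b : YoungDiagram} (h : a ≤ b) (hc : b.card ≤ a.card) : a = b :=
  YoungDiagram.ext (Finset.eq_of_subset_of_card_le (cells_subset_iff.2 h) hc)

theorem card_sup_add_card_inf (a b : YoungDiagram) :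
    (a ⊔ b).card + (a ⊓ b).card = a.card + b.card :=
  Finset.card_union_add_card_inter _ _

theorem sum_rowLens (a : YoungDiagram) : a.rowLens.sum = a.card := by
  have h : a.card = ∑ i ∈ Finset.range (a.colLen 0), a.rowLen i := by
    rw [YoungDiagram.card, Finset.card_eq_sum_card_fiberwise (f := Prod.fst)
      (t := Finset.range (a.colLen 0))]
    · exact Finset.sum_congr rfl fun i _ => a.rowLen_eq_card.symm
    · rintro ⟨i, j⟩ hc
      have hc' : (i, j) ∈ a := hc
      simpa using mem_iff_lt_colLen.1 (a.up_left_mem le_rfl (Nat.zero_le j) hc')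
  rw [h, rowLens, Finset.sum_range]
  simp [Fin.sum_univ_def, ← List.map_coe_finRange_eq_range, Function.comp_def]

theorem card_filter_rowLens (a : YoungDiagram) (j : ℕ) :
    Multiset.card ((a.rowLens : Multiset ℕ).filter (fun p => j + 1 ≤ p)) = a.colLen j := by
  have h : ((a.rowLens : Multiset ℕ)) = (Multiset.range (a.colLen 0)).map a.rowLen := rfl
  rw [h, Multiset.filter_map, Multiset.card_map]
  change ((Finset.range (a.colLen 0)).filter _).card = _
  rw [← Finset.card_range (a.colLen j)]
  congr 1
  ext i
  simp only [Finset.mem_filter, Finset.mem_range, Function.comp_apply, Nat.succ_le_iff,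
    ← mem_iff_lt_rowLen, ← mem_iff_lt_colLen, and_iff_right_iff_imp]
  exact a.up_left_mem le_rfl (Nat.zero_le j)

/-- The rows of a Young diagram to which a cell can be added. -/
def addableRows (a : YoungDiagram) : Set ℕ := {i | ∀ k, i = k + 1 → a.rowLen i < a.rowLen k}

/-- The rows of a Young diagram from which a cell can be removed. -/
def removableRows (a : YoungDiagram) : Set ℕ := {i | a.rowLen (i + 1) < a.rowLen i}

theorem addableRows_eq_insert (a : YoungDiagram) :
    a.addableRows = insert 0 (Nat.succ '' a.removableRows) := by
  ext i
  cases i <;> simp [addableRows, removableRows]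

theorem finite_removableRows (a : YoungDiagram) : a.removableRows.Finite := by
  refine (Set.finite_lt_nat (a.colLen 0)).subset fun i hi => ?_
  have : (i, 0) ∈ a := mem_iff_lt_rowLen.2 (Nat.zero_lt_of_lt hi)
  exact mem_iff_lt_colLen.1 this

theorem ncard_addableRows (a : YoungDiagram) :
    a.addableRows.ncard = a.removableRows.ncard + 1 := by
  rw [addableRows_eq_insert, Set.ncard_insert_of_notMem (by simp) (a.finite_removableRows.image _),
    Set.ncard_image_of_injective _ Nat.succ_injective]

theorem cells_injective : Function.Injective cells := fun _ _ => YoungDiagram.ext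

theorem image_cells_upperCovers (a : YoungDiagram) :
    cells '' {b | a ≤ b ∧ b.card = a.card + 1} =
      (fun i => insert (i, a.rowLen i) a.cells) '' a.addableRows := by
  ext s
  constructor
  · rintro ⟨b, ⟨hab, hb⟩, rfl⟩
    obtain ⟨⟨i, j⟩, hc, hs⟩ := Finset.exists_eq_insert_iff.2
      ⟨cells_subset_iff.2 hab, hb.symm⟩
    have hmem (x y : ℕ) : (x, y) ∈ b ↔ (x = i ∧ y = j) ∨ (x, y) ∈ a := by
      rw [← mem_cells, ← hs]; simp
    have hca : ¬ j < a.rowLen i := by rwa [mem_cells, mem_iff_lt_rowLen] at hc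
    have hj : a.rowLen i = j := by
      have h1 : (i, a.rowLen i) ∈ b :=
        b.up_left_mem le_rfl (not_lt.1 hca) ((hmem i j).2 (Or.inl ⟨rfl, rfl⟩))
      rcases (hmem _ _).1 h1 with h | h
      · exact h.2
      · exact absurd (mem_iff_lt_rowLen.1 h) (lt_irrefl _)
    refine ⟨i, ?_, by simpa [hj] using hs⟩
    rintro k rfl
    have h1 : (k, j) ∈ b := b.up_left_mem k.le_succ le_rfl ((hmem _ _).2 (Or.inl ⟨rfl, rfl⟩))
    rcases (hmem _ _).1 h1 with h | h
    · omega
    · rw [hj]; exact mem_iff_lt_rowLen.1 h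
  · rintro ⟨i, hi, rfl⟩
    have hn : (i, a.rowLen i) ∉ a.cells := by simp [mem_iff_lt_rowLen]
    refine ⟨⟨insert (i, a.rowLen i) a.cells, ?_⟩, ⟨?_, ?_⟩, rfl⟩
    · rintro ⟨x, y⟩ ⟨x', y'⟩ ⟨hx, hy⟩ h
      simp only [Finset.coe_insert, Set.mem_insert_iff, Finset.mem_coe, mem_cells,
        Prod.mk.injEq] at h hx hy ⊢
      rcases h with ⟨rfl, rfl⟩ | h
      · rcases hx.eq_or_lt with rfl | hlt
        · rcases hy.eq_or_lt with rfl | hlt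
          · exact Or.inl ⟨rfl, rfl⟩
          · exact Or.inr (mem_iff_lt_rowLen.2 hlt)
        · obtain ⟨k, rfl⟩ : ∃ k, x = k + 1 := ⟨x - 1, by omega⟩
          refine Or.inr (a.up_left_mem (Nat.le_of_lt_succ hlt) hy (mem_iff_lt_rowLen.2 ?_))
          exact hi k rfl
      · exact Or.inr (a.up_left_mem hx hy h)
    · exact cells_subset_iff.1 (Finset.subset_insert _ _)
    · exact Finset.card_insert_of_notMem hn

theorem image_cells_lowerCovers (a : YoungDiagram) :
    cells '' {b | b ≤ a ∧ b.card + 1 = a.card} =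
      (fun i => a.cells.erase (i, a.rowLen i - 1)) '' a.removableRows := by
  ext s
  constructor
  · rintro ⟨b, ⟨hab, hb⟩, rfl⟩
    obtain ⟨⟨i, j⟩, hc, hs⟩ := Finset.exists_eq_insert_iff.2
      ⟨cells_subset_iff.2 hab, hb⟩
    have hmem (x y : ℕ) : (x, y) ∈ a ↔ (x = i ∧ y = j) ∨ (x, y) ∈ b := by
      rw [← mem_cells, ← hs]; simp
    have hij : j < a.rowLen i := mem_iff_lt_rowLen.1 ((hmem i j).2 (Or.inl ⟨rfl, rfl⟩))
    have hcb : (i, j) ∉ b := hc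
    have hj : a.rowLen i = j + 1 := by
      refine le_antisymm (not_lt.1 fun h => ?_) hij
      rcases (hmem _ _).1 (mem_iff_lt_rowLen.2 h) with h | h
      · omega
      · exact hcb (b.up_left_mem le_rfl j.le_succ h)
    refine ⟨i, ?_, ?_⟩
    · change a.rowLen (i + 1) < a.rowLen i
      rw [hj, Nat.lt_succ_iff]
      refine not_lt.1 fun h => ?_
      rcases (hmem _ _).1 (mem_iff_lt_rowLen.2 h) with h | h
      · omega
      · exact hcb (b.up_left_mem i.le_succ le_rfl h)
    · simp only [hj, Nat.add_sub_cancel, ← hs]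
      exact Finset.erase_insert hc
  · rintro ⟨i, hi, rfl⟩
    have hi' : a.rowLen (i + 1) < a.rowLen i := hi
    have hn : (i, a.rowLen i - 1) ∈ a.cells := by
      rw [mem_cells, mem_iff_lt_rowLen]; omega
    refine ⟨⟨a.cells.erase (i, a.rowLen i - 1), ?_⟩, ⟨?_, ?_⟩, rfl⟩
    · rintro ⟨x, y⟩ ⟨x', y'⟩ ⟨hx, hy⟩ h
      simp only [Finset.coe_erase, Set.mem_sdiff, Set.mem_singleton_iff, Finset.mem_coe, mem_cells,
        Prod.mk.injEq] at h hx hy ⊢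
      refine ⟨a.up_left_mem hx hy h.1, ?_⟩
      rintro ⟨rfl, rfl⟩
      have h1 := mem_iff_lt_rowLen.1 h.1
      rcases hx.eq_or_lt with rfl | hlt
      · exact h.2 ⟨rfl, by omega⟩
      · have := a.rowLen_anti (x' + 1) x hlt
        omega
    · exact cells_subset_iff.1 (Finset.erase_subset _ _)
    · exact Finset.card_erase_add_one hn

theorem ncard_upperCovers (a : YoungDiagram) :
    {b | a ≤ b ∧ b.card = a.card + 1}.ncard = a.addableRows.ncard := by
  rw [← Set.ncard_image_of_injective _ cells_injective, image_cells_upperCovers]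
  refine Set.InjOn.ncard_image fun i _ k _ h => ?_
  have h1 : (i, a.rowLen i) ∈ insert (k, a.rowLen k) a.cells := by
    rw [← show _ = insert (k, a.rowLen k) a.cells from h]
    exact Finset.mem_insert_self _ _
  rcases Finset.mem_insert.1 h1 with h1 | h1
  · exact congrArg Prod.fst h1
  · exact absurd (mem_iff_lt_rowLen.1 h1) (lt_irrefl _)

theorem ncard_lowerCovers (a : YoungDiagram) :
    {b | b ≤ a ∧ b.card + 1 = a.card}.ncard = a.removableRows.ncard := by
  rw [← Set.ncard_image_of_injective _ cells_injective, image_cells_lowerCovers]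
  refine Set.InjOn.ncard_image fun i hi k _ h => ?_
  have hi' : a.rowLen (i + 1) < a.rowLen i := hi
  have hn : (i, a.rowLen i - 1) ∈ a.cells := by
    rw [mem_cells, mem_iff_lt_rowLen]; omega
  by_contra hik
  have h1 : (i, a.rowLen i - 1) ∈ a.cells.erase (k, a.rowLen k - 1) :=
    Finset.mem_erase.2 ⟨fun e => hik (congrArg Prod.fst e), hn⟩
  rw [← show _ = a.cells.erase (k, a.rowLen k - 1) from h] at h1
  exact Finset.notMem_erase _ _ h1

theorem ncard_commonUpperCovers {m : ℕ} (a b : YoungDiagram) (ha : a.card = m + 1)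
    (hb : b.card = m + 1) :
    {c : YoungDiagram | c.card = m + 2 ∧ a ≤ c ∧ b ≤ c}.ncard =
      {c : YoungDiagram | c.card = m ∧ c ≤ a ∧ c ≤ b}.ncard + if a = b then 1 else 0 := by
  by_cases hab : a = b
  · subst hab
    have hu : {c : YoungDiagram | c.card = m + 2 ∧ a ≤ c ∧ a ≤ c} =
        {c | a ≤ c ∧ c.card = a.card + 1} := by
      ext c; simp only [Set.mem_ofPred_eq, ha]; tauto
    have hl : {c : YoungDiagram | c.card = m ∧ c ≤ a ∧ c ≤ a} =
        {c | c ≤ a ∧ c.card + 1 = a.card} := by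
      ext c; simp only [Set.mem_ofPred_eq, ha, Nat.add_right_cancel_iff]; tauto
    rw [hu, hl, ncard_upperCovers, ncard_lowerCovers, ncard_addableRows, if_pos rfl]
  · have hsi := card_sup_add_card_inf a b
    have hlt : m + 1 < (a ⊔ b).card := by
      by_contra! h
      have h1 := eq_of_le_of_card_le (le_sup_left : a ≤ a ⊔ b) (h.trans ha.ge)
      have h2 := eq_of_le_of_card_le (le_sup_right : b ≤ a ⊔ b) (h.trans hb.ge)
      exact hab (h1.trans h2.symm)
    have hmono {c d : YoungDiagram} (h : c ≤ d) : c.card ≤ d.card :=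
      Finset.card_le_card (cells_subset_iff.2 h)
    rw [if_neg hab, add_zero]
    by_cases hs : (a ⊔ b).card = m + 2
    · have hu : {c : YoungDiagram | c.card = m + 2 ∧ a ≤ c ∧ b ≤ c} = {a ⊔ b} := by
        ext c
        simp only [Set.mem_ofPred_eq, Set.mem_singleton_iff]
        constructor
        · rintro ⟨h, h1, h2⟩
          exact (eq_of_le_of_card_le (sup_le h1 h2) (by omega)).symm
        · rintro rfl
          exact ⟨hs, le_sup_left, le_sup_right⟩
      have hl : {c : YoungDiagram | c.card = m ∧ c ≤ a ∧ c ≤ b} = {a ⊓ b} := by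
        ext c
        simp only [Set.mem_ofPred_eq, Set.mem_singleton_iff]
        constructor
        · rintro ⟨h, h1, h2⟩
          exact eq_of_le_of_card_le (le_inf h1 h2) (by omega)
        · rintro rfl
          exact ⟨by omega, inf_le_left, inf_le_right⟩
      rw [hu, hl, Set.ncard_singleton, Set.ncard_singleton]
    · have hu : {c : YoungDiagram | c.card = m + 2 ∧ a ≤ c ∧ b ≤ c} = ∅ := by
        refine Set.eq_empty_of_forall_notMem ?_
        rintro c ⟨h, h1, h2⟩
        have := hmono (sup_le h1 h2)
        omega
      have hl : {c : YoungDiagram | c.card = m ∧ c ≤ a ∧ c ≤ b} = ∅ := by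
        refine Set.eq_empty_of_forall_notMem ?_
        rintro c ⟨h, h1, h2⟩
        have := hmono (le_inf h1 h2)
        omega
      rw [hu, hl]

/-- The partition of `n` given by the row lengths of a Young diagram with `n` cells. -/
def toPartition {n : ℕ} (a : {a : YoungDiagram // a.card = n}) : n.Partition where
  parts := a.1.rowLens
  parts_pos := fun {i} hi => a.1.pos_of_mem_rowLens i (by simpa using hi)
  parts_sum := by rw [Multiset.sum_coe, sum_rowLens, a.2]

theorem toPartition_bijective (n : ℕ) : Function.Bijective (toPartition (n := n)) := by
  constructor
  · intro a b h
    have h1 : (a.1.rowLens : Multiset ℕ) = b.1.rowLens := congrArg Nat.Partition.parts h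
    have h2 : a.1.rowLens = b.1.rowLens :=
      (Multiset.coe_eq_coe.1 h1).eq_of_sortedGE a.1.rowLens_sorted b.1.rowLens_sorted
    exact Subtype.ext (equivListRowLens.injective (Subtype.ext h2))
  · intro p
    have hs : (p.parts.sort (· ≥ ·)).SortedGE := (Multiset.pairwise_sort p.parts _).sortedGE
    have hr : (ofRowLens _ hs).rowLens = p.parts.sort (· ≥ ·) :=
      rowLens_ofRowLens_eq_self fun x hx => p.parts_pos (by simpa using hx)
    have hp : ((ofRowLens _ hs).rowLens : Multiset ℕ) = p.parts := by
      rw [hr, Multiset.sort_eq]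
    refine ⟨⟨ofRowLens _ hs, ?_⟩, Nat.Partition.ext hp⟩
    rw [← sum_rowLens, ← Multiset.sum_coe, hp, p.parts_sum]

theorem partitionLE_toPartition_iff {n m : ℕ} (a : {a : YoungDiagram // a.card = n})
    (b : {b : YoungDiagram // b.card = m}) :
    PartitionLE (toPartition a) (toPartition b) ↔ a.1 ≤ b.1 := by
  rw [le_iff_colLen_le]
  constructor
  · intro h j
    have := h (j + 1) (Nat.le_add_left 1 j)
    rwa [toPartition, toPartition, card_filter_rowLens, card_filter_rowLens] at this
  · intro h j hj
    obtain ⟨k, rfl⟩ : ∃ k, j = k + 1 := ⟨j - 1, by omega⟩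
    rw [toPartition, toPartition, card_filter_rowLens, card_filter_rowLens]
    exact h k

theorem natCard_partition_subtype {n : ℕ} (P : n.Partition → Prop) (Q : YoungDiagram → Prop)
    (h : ∀ a, P (toPartition a) ↔ Q a.1) :
    Nat.card {p // P p} = {c : YoungDiagram | c.card = n ∧ Q c}.ncard := by
  rw [← Nat.card_coe_set_eq]
  refine Nat.card_congr (Equiv.trans ?_
    (Equiv.subtypeSubtypeEquivSubtypeInter (fun c : YoungDiagram => c.card = n) Q))
  exact ((Equiv.ofBijective _ (toPartition_bijective n)).subtypeEquiv fun a => (h a).symm).symm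

end YoungDiagram

open YoungDiagram in
theorem natCard_common_upper_eq {m : ℕ} (p q : (m + 1).Partition) :
    Nat.card {r : (m + 2).Partition // PartitionLE p r ∧ PartitionLE q r} =
      Nat.card {r : m.Partition // PartitionLE r p ∧ PartitionLE r q} + if p = q then 1 else 0 := by
  obtain ⟨a, rfl⟩ := (toPartition_bijective _).2 p
  obtain ⟨b, rfl⟩ := (toPartition_bijective _).2 q
  rw [natCard_partition_subtype _ (fun c => a.1 ≤ c ∧ b.1 ≤ c)
      fun c => by simp only [partitionLE_toPartition_iff],
    natCard_partition_subtype _ (fun c => c ≤ a.1 ∧ c ≤ b.1)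
      fun c => by simp only [partitionLE_toPartition_iff],
    ncard_commonUpperCovers a.1 b.1 a.2 b.2]
  simp only [(toPartition_bijective _).1.eq_iff, Subtype.ext_iff]

/-- The matrix of multiplication by `p₁` in the Schur basis. -/
noncomputable def upMatrix (n : ℕ) : Matrix n.Partition (n + 1).Partition ℤ :=
  fun p q => if PartitionLE p q then 1 else 0

open Matrix Polynomial

theorem psiMatrix_eq_mul_transpose (n : ℕ) : psiMatrix n = upMatrix n * (upMatrix n)ᵀ := by
  ext p q
  simp only [psiMatrix, mul_apply, transpose_apply, upMatrix, ← ite_and, mul_ite, mul_one,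
    mul_zero, Finset.sum_boole, Nat.card_eq_fintype_card, Fintype.card_subtype]
  congr 3
  ext; tauto

theorem psiMatrix_succ (n : ℕ) :
    psiMatrix (n + 1) = (upMatrix n)ᵀ * upMatrix n + 1 := by
  ext p q
  rw [psiMatrix, natCard_common_upper_eq]
  simp only [Matrix.add_apply, mul_apply, transpose_apply, upMatrix, ← ite_and, mul_ite, mul_one,
    mul_zero, Finset.sum_boole, Nat.card_eq_fintype_card, Fintype.card_subtype, one_apply,
    Nat.cast_add, Nat.cast_ite, Nat.cast_one, Nat.cast_zero]
  congr 4
  ext; tauto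

theorem prod_partition_succ_count_one {R : Type*} [CommMonoid R] (n : ℕ) (f : ℕ → R) :
    ∏ p : (n + 1).Partition, f (p.parts.count 1) =
      f 0 ^ Fintype.card {p : (n + 1).Partition // 1 ∉ p.parts} *
        ∏ p : n.Partition, f (p.parts.count 1 + 1) := by
  rw [mul_comm, ← Fintype.prod_subtype_mul_prod_subtype (fun p : (n + 1).Partition => 1 ∈ p.parts)]
  congr 1
  · refine Fintype.prod_equiv (Nat.Partition.partitionWithPartEquiv le_rfl (Nat.le_add_left 1 n))
      _ _ fun p => ?_
    rw [Nat.Partition.partitionWithPartEquiv_apply_parts, Multiset.count_erase_self,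
      Nat.sub_add_cancel (Multiset.one_le_count_iff_mem.2 p.2)]
  · rw [Finset.prod_congr rfl fun p _ => by rw [Multiset.count_eq_zero_of_notMem p.2],
      Finset.prod_const, Finset.card_univ]

theorem card_partition_succ (n : ℕ) :
    Fintype.card (n + 1).Partition =
      Fintype.card {p : (n + 1).Partition // 1 ∉ p.parts} + Fintype.card n.Partition := by
  have h := Fintype.card_congr
    (Nat.Partition.partitionWithPartEquiv le_rfl (Nat.le_add_left 1 n))
  have h' := Fintype.card_congr (Equiv.sumCompl fun p : (n + 1).Partition => 1 ∈ p.parts)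
  rw [Fintype.card_sum, h, Nat.add_sub_cancel] at h'
  rw [← h', add_comm]

theorem charpoly_psiMatrix (n : ℕ) :
    (psiMatrix n).charpoly = ∏ p : n.Partition, (X - C ((p.parts.count 1 : ℤ) + 1)) := by
  induction n with
  | zero =>
    have h (p q : Nat.Partition 0) : psiMatrix 0 p q = 1 := by
      have hle (p : Nat.Partition 0) (r : Nat.Partition 1) : PartitionLE p r := fun j _ => by simp
      simp [psiMatrix, hle]
    rw [charpoly, det_unique, charmatrix_apply_eq, h]
    simp
  | succ n ih =>
    have hc := card_partition_succ n
    have h : (psiMatrix (n + 1)) = (upMatrix n)ᵀ * upMatrix n - scalar _ (-1) := by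
      rw [psiMatrix_succ, map_neg, map_one, sub_neg_eq_add]
    rw [h, charpoly_sub_scalar, charpoly_mul_comm_of_le _ _ (by omega),
      ← psiMatrix_eq_mul_transpose, ih, hc, Nat.add_sub_cancel,
      prod_partition_succ_count_one n fun k => (X - C ((k : ℤ) + 1))]
    simp only [mul_comp, pow_comp, prod_comp, X_comp, sub_comp, C_comp]
    congr 2
    · simp [sub_eq_add_neg]
    · funext p
      simp only [map_add, map_neg, map_one, Nat.cast_add, Nat.cast_one]
      ring

/-- `det ψ_n = ∏_{λ ⊢ n} (m₁(λ) + 1)`, where `m₁(λ)` is the number of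
parts of `λ` equal to `1`. -/
theorem stmt13 (n : ℕ) (hn : 1 ≤ n) :
    (psiMatrix n).det = ∏ lam : Nat.Partition n, ((lam.parts.count 1 : ℤ) + 1) := by
  rw [det_eq_sign_charpoly_coeff, charpoly_psiMatrix, coeff_zero_eq_eval_zero, eval_prod]
  simp only [eval_sub, eval_X, eval_C, zero_sub, Finset.prod_neg]
  rw [Finset.card_univ, ← mul_assoc, ← mul_pow]
  simp
end

section
/- (Cai–Stanley) Fix n ≥ 5 and let M_n be the p(n)×p(n) integer matrix with rows and columns indexed by the partitions of n, whose (λ, ν)-entry equals the number of partitions μ of n+1 whose Young diagram contains both the Young diagram of λ and the Young diagram of ν. Then M_n has a Smith normal form over ℤ whose diagonal entries are: (n+1)(n−1)! with multiplicity 1; (n−k)! with multiplicity p(k+1) − 2p(k) + p(k−1) for each 3 ≤ k ≤ n−2; and 1 with multiplicity p(n) − p(n−1) + p(n−2); where p(m) denotes the number of partitions of m. -/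
open scoped Classical

/-- The number of partitions of `m`. -/
noncomputable def numPartitions (m : ℕ) : ℕ := Fintype.card (Nat.Partition m)

/-- The ring `ℤ[h₁, h₂, …]` of symmetric functions, with `X i` standing for `h_{i+1}`. -/
abbrev SymRing := MvPolynomial ℕ ℤ

/-- The complete homogeneous symmetric function `h k`. -/
noncomputable def hh : ℕ → SymRing
  | 0 => 1
  | k + 1 => MvPolynomial.X k

/-- The product of the `h k` for `k` in a multiset. -/
noncomputable def hProd (m : Multiset ℕ) : SymRing := (m.map hh).prod

/-- The derivation `∂/∂p₁`, which sends `h_{k+1}` to `h_k`. -/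
noncomputable def downD : Derivation ℤ SymRing SymRing :=
  MvPolynomial.mkDerivation ℤ hh

@[simp] theorem hh_zero : hh 0 = 1 := rfl

@[simp] theorem downD_hh_zero : downD (hh 0) = 0 := by simp

@[simp] theorem downD_hh_succ (k : ℕ) : downD (hh (k + 1)) = hh k :=
  MvPolynomial.mkDerivation_X ℤ hh k

@[simp] theorem hProd_zero : hProd 0 = 1 := by simp [hProd]

@[simp] theorem hProd_cons (a : ℕ) (m : Multiset ℕ) : hProd (a ::ₘ m) = hh a * hProd m := by
  simp [hProd]

theorem hProd_add (l m : Multiset ℕ) : hProd (l + m) = hProd l * hProd m := by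
  simp [hProd]

theorem hProd_replicate (j a : ℕ) : hProd (Multiset.replicate j a) = hh a ^ j := by
  simp [hProd]

theorem hProd_filter_ne_zero (m : Multiset ℕ) : hProd (m.filter (· ≠ 0)) = hProd m := by
  induction m using Multiset.induction_on with
  | empty => simp
  | cons a m ih =>
    by_cases ha : a = 0
    · subst ha; simp [ih]
    · simp [Multiset.filter_cons_of_pos, ha, ih]

/-- The span of the `h`-monomials of degree `n` on which the statistic `st` is at least `a`. -/
noncomputable def hFilt (st : Multiset ℕ → ℕ) (n a : ℕ) : Submodule ℤ SymRing :=
  Submodule.span ℤ (hProd '' {m | m.sum = n ∧ a ≤ st m})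

/-- The homogeneous part of degree `n`. -/
noncomputable def hDeg (n : ℕ) : Submodule ℤ SymRing :=
  Submodule.span ℤ (hProd '' {m | m.sum = n})

theorem hProd_mem_hFilt {st : Multiset ℕ → ℕ} {n a : ℕ} {m : Multiset ℕ} (hm : m.sum = n)
    (ha : a ≤ st m) : hProd m ∈ hFilt st n a :=
  Submodule.subset_span ⟨m, ⟨hm, ha⟩, rfl⟩

theorem hProd_mem_hDeg {n : ℕ} {m : Multiset ℕ} (hm : m.sum = n) : hProd m ∈ hDeg n :=
  Submodule.subset_span ⟨m, hm, rfl⟩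

theorem hFilt_le_hDeg (st : Multiset ℕ → ℕ) (n a : ℕ) : hFilt st n a ≤ hDeg n :=
  Submodule.span_mono (Set.image_mono fun _ h => h.1)

theorem hFilt_anti {st : Multiset ℕ → ℕ} {n a b : ℕ} (h : a ≤ b) : hFilt st n b ≤ hFilt st n a :=
  Submodule.span_mono (Set.image_mono fun _ hm => ⟨hm.1, h.trans hm.2⟩)

theorem hh_mem_hDeg (k : ℕ) : hh k ∈ hDeg k := by
  simpa [hProd] using hProd_mem_hDeg (n := k) (m := {k}) (by simp)

theorem mul_mem_hDeg {m n : ℕ} {x y : SymRing} (hx : x ∈ hDeg m) (hy : y ∈ hDeg n) :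
    x * y ∈ hDeg (m + n) := by
  induction hx using Submodule.span_induction with
  | mem x hx =>
    obtain ⟨l, hl, rfl⟩ := hx
    induction hy using Submodule.span_induction with
    | mem y hy =>
      obtain ⟨k, hk, rfl⟩ := hy
      rw [← hProd_add]
      exact hProd_mem_hDeg (by simp_all)
    | zero => simp
    | add x y _ _ hx hy => rw [mul_add]; exact add_mem hx hy
    | smul a x _ hx => rw [mul_smul_comm]; exact Submodule.smul_mem _ _ hx
  | zero => simp
  | add x y _ _ hx hy => rw [add_mul]; exact add_mem hx hy
  | smul a x _ hx => rw [smul_mul_assoc]; exact Submodule.smul_mem _ _ hx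

theorem hh_mul_mem_hFilt_sup {c n : ℕ} {x : SymRing} (hx : x ∈ hDeg n) :
    hh c * x ∈ hFilt Multiset.sup (c + n) c := by
  induction hx using Submodule.span_induction with
  | mem x hx =>
    obtain ⟨l, hl, rfl⟩ := hx
    rw [← hProd_cons]
    exact hProd_mem_hFilt (by simp_all) (by simp)
  | zero => simp
  | add x y _ _ hx hy => rw [mul_add]; exact add_mem hx hy
  | smul a x _ hx => rw [mul_smul_comm]; exact Submodule.smul_mem _ _ hx

theorem mul_mem_hFilt_sup {m n a : ℕ} {x y : SymRing} (hx : x ∈ hDeg m)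
    (hy : y ∈ hFilt Multiset.sup n a) : x * y ∈ hFilt Multiset.sup (m + n) a := by
  induction hx using Submodule.span_induction with
  | mem x hx =>
    obtain ⟨l, hl, rfl⟩ := hx
    induction hy using Submodule.span_induction with
    | mem y hy =>
      obtain ⟨k, hk, rfl⟩ := hy
      rw [← hProd_add]
      exact hProd_mem_hFilt (by simp_all) (by simp [hk.2])
    | zero => simp
    | add x y _ _ hx hy => rw [mul_add]; exact add_mem hx hy
    | smul a x _ hx => rw [mul_smul_comm]; exact Submodule.smul_mem _ _ hx
  | zero => simp
  | add x y _ _ hx hy => rw [add_mul]; exact add_mem hx hy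
  | smul a x _ hx => rw [smul_mul_assoc]; exact Submodule.smul_mem _ _ hx

theorem downD_hProd_mem (m : Multiset ℕ) (k : ℕ) (hm : m.sum = k + 1) :
    downD (hProd m) ∈ hDeg k := by
  induction m using Multiset.induction_on generalizing k with
  | empty => simp at hm
  | cons a m ih =>
    rw [hProd_cons, Derivation.leibniz, smul_eq_mul, smul_eq_mul]
    rw [Multiset.sum_cons] at hm
    refine add_mem ?_ ?_
    · rcases hs : m.sum with _ | s
      · have : downD (hProd m) = 0 := by
          have h0 : m.filter (· ≠ 0) = 0 := by
            rw [Multiset.filter_eq_nil]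
            intro x hx
            have := Multiset.le_sum_of_mem hx
            omega
          rw [← hProd_filter_ne_zero, h0]; simp
        simp [this]
      · have : k = a + s := by omega
        subst this
        exact mul_mem_hDeg (hh_mem_hDeg a) (ih s hs)
    · rcases a with _ | a
      · simp
      · rw [downD_hh_succ]
        have : k = m.sum + a := by omega
        subst this
        exact mul_mem_hDeg (hProd_mem_hDeg rfl) (hh_mem_hDeg a)

theorem downD_mem {k : ℕ} {x : SymRing} (hx : x ∈ hDeg (k + 1)) : downD x ∈ hDeg k := by
  induction hx using Submodule.span_induction with
  | mem x hx =>
    obtain ⟨m, hm, rfl⟩ := hx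
    exact downD_hProd_mem m k hm
  | zero => simp
  | add x y _ _ hx hy => rw [map_add]; exact add_mem hx hy
  | smul a x _ hx => rw [Derivation.map_smul]; exact Submodule.smul_mem _ _ hx

theorem downD_of_mem_hDeg_zero {x : SymRing} (hx : x ∈ hDeg 0) : downD x = 0 := by
  induction hx using Submodule.span_induction with
  | mem x hx =>
    obtain ⟨m, hm, rfl⟩ := hx
    have h0 : m.filter (· ≠ 0) = 0 := by
      rw [Multiset.filter_eq_nil]
      intro x hx
      have := Multiset.le_sum_of_mem hx
      have : m.sum = 0 := hm
      omega
    rw [← hProd_filter_ne_zero, h0]; simp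
  | zero => simp
  | add x y _ _ hx hy => rw [map_add, hx, hy, add_zero]
  | smul a x _ hx => rw [Derivation.map_smul, hx, smul_zero]

theorem exists_downD_eq_hh_mul (m c : ℕ) (x : SymRing) (hx : x ∈ hDeg m) :
    ∃ y ∈ hFilt Multiset.sup (c + m + 1) (c + 1), downD y = hh c * x := by
  induction m generalizing c x with
  | zero =>
    refine ⟨hh (c + 1) * x, hh_mul_mem_hFilt_sup (c := c + 1) (n := 0) hx, ?_⟩
    rw [Derivation.leibniz, downD_of_mem_hDeg_zero hx, downD_hh_succ, smul_zero, zero_add,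
      smul_eq_mul, mul_comm]
  | succ m ih =>
    obtain ⟨y, hy, hyx⟩ := ih (c + 1) _ (downD_mem hx)
    have e : c + (m + 1) + 1 = c + 1 + (m + 1) := by omega
    have e' : c + (m + 1) + 1 = c + 1 + m + 1 := by omega
    refine ⟨hh (c + 1) * x - y, sub_mem ?_ ?_, ?_⟩
    · rw [e]
      exact hh_mul_mem_hFilt_sup hx
    · rw [e']
      exact hFilt_anti (Nat.le_succ _) hy
    · rw [map_sub, hyx, Derivation.leibniz, downD_hh_succ, smul_eq_mul, smul_eq_mul]
      ring

/-- `∂/∂p₁` maps the part of the filtration by largest index onto the previous one. -/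
theorem exists_downD_eq {n a : ℕ} {x : SymRing} (hx : x ∈ hFilt Multiset.sup n a) :
    ∃ y ∈ hFilt Multiset.sup (n + 1) (a + 1), downD y = x := by
  induction hx using Submodule.span_induction with
  | mem x hx =>
    obtain ⟨m, ⟨hm, ha⟩, rfl⟩ := hx
    obtain ⟨c, l, hcl, hac⟩ : ∃ c l, hProd m = hh c * hProd l ∧ a ≤ c ∧ c + l.sum = n := by
      by_cases h : m = 0
      · subst h
        exact ⟨0, 0, by simp, by simpa using ha, by simpa using hm⟩
      · obtain ⟨c, hc, hmax⟩ := m.exists_max_image id h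
        refine ⟨c, m.erase c, ?_, ?_, ?_⟩
        · rw [← hProd_cons, Multiset.cons_erase hc]
        · exact ha.trans (Multiset.sup_le.2 hmax)
        · rw [← Multiset.sum_cons, Multiset.cons_erase hc, hm]
    obtain ⟨y, hy, hyx⟩ := exists_downD_eq_hh_mul l.sum c _ (hProd_mem_hDeg rfl)
    rw [hac.2] at hy
    exact ⟨y, hFilt_anti (by omega) hy, by rw [hyx, hcl]⟩
  | zero => exact ⟨0, by simp, by simp⟩
  | add x y _ _ hx hy =>
    obtain ⟨u, hu, rfl⟩ := hx
    obtain ⟨v, hv, rfl⟩ := hy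
    exact ⟨u + v, add_mem hu hv, by simp⟩
  | smul r x _ hx =>
    obtain ⟨u, hu, rfl⟩ := hx
    exact ⟨r • u, Submodule.smul_mem _ _ hu, by simp⟩

theorem exists_downD_chain (b : ℕ) (s : Multiset ℕ) :
    ∃ G : ℕ → SymRing, downD (G 0) = 0 ∧ (∀ k, downD (G (k + 1)) = G k) ∧
      ∀ k, G k - hProd ((b + k) ::ₘ b ::ₘ s) ∈
        hFilt Multiset.sup (b + k + b + s.sum) (b + k + 1) := by
  have start : ∃ g, downD g = 0 ∧
      g - hProd (b ::ₘ b ::ₘ s) ∈ hFilt Multiset.sup (b + b + s.sum) (b + 1) := by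
    have key : ∃ y ∈ hFilt Multiset.sup (b + b + s.sum) (b + 1),
        downD y = downD (hProd (b ::ₘ b ::ₘ s)) := by
      rcases hs : b + s.sum with _ | m
      · obtain rfl : b = 0 := by omega
        refine ⟨0, zero_mem _, ?_⟩
        rw [downD_of_mem_hDeg_zero (x := hProd _) (hProd_mem_hDeg (by simp; omega)), map_zero]
      · have hx : hProd (b ::ₘ s) ∈ hDeg (m + 1) := hProd_mem_hDeg (by simp [hs])
        rcases b with _ | b
        · obtain ⟨y, hy, hyx⟩ := exists_downD_eq_hh_mul m 0 _ (downD_mem hx)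
          refine ⟨y, ?_, ?_⟩
          · convert hy using 2
            omega
          · rw [hyx]; simp
        · have hm : m = b + s.sum := by omega
          have hz : hh b * hProd s + downD (hProd ((b + 1) ::ₘ s)) ∈ hDeg m :=
            add_mem (hm ▸ mul_mem_hDeg (hh_mem_hDeg b) (hProd_mem_hDeg rfl)) (downD_mem hx)
          obtain ⟨y, hy, hyx⟩ := exists_downD_eq_hh_mul m (b + 1) _ hz
          refine ⟨y, ?_, ?_⟩
          · convert hy using 2
            omega
          · rw [hyx]
            simp only [hProd_cons, Derivation.leibniz, smul_eq_mul, downD_hh_succ]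
            ring
    obtain ⟨y, hy, hyx⟩ := key
    exact ⟨hProd (b ::ₘ b ::ₘ s) - y, by rw [map_sub, hyx, sub_self], by simpa using hy⟩
  have step : ∀ k g, g - hProd ((b + k) ::ₘ b ::ₘ s) ∈
        hFilt Multiset.sup (b + k + b + s.sum) (b + k + 1) →
      ∃ g', downD g' = g ∧ g' - hProd ((b + (k + 1)) ::ₘ b ::ₘ s) ∈
        hFilt Multiset.sup (b + (k + 1) + b + s.sum) (b + (k + 1) + 1) := by
    intro k g hg
    have hD : downD (hProd ((b + (k + 1)) ::ₘ b ::ₘ s)) - hProd ((b + k) ::ₘ b ::ₘ s) ∈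
        hFilt Multiset.sup (b + k + b + s.sum) (b + k + 1) := by
      have : downD (hProd ((b + (k + 1)) ::ₘ b ::ₘ s)) - hProd ((b + k) ::ₘ b ::ₘ s) =
          hh (b + k + 1) * downD (hProd (b ::ₘ s)) := by
        rw [hProd_cons, Derivation.leibniz, ← add_assoc b k 1, downD_hh_succ,
          hProd_cons (b + k), smul_eq_mul, smul_eq_mul]
        ring
      rw [this]
      rcases hs : b + s.sum with _ | m
      · rw [downD_of_mem_hDeg_zero (x := hProd _) (hProd_mem_hDeg (by simp; omega))]
        simp
      · have := hh_mul_mem_hFilt_sup (c := b + k + 1)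
          (downD_mem (x := hProd (b ::ₘ s)) (k := m) (hProd_mem_hDeg (by simp [hs])))
        convert this using 2
        omega
    obtain ⟨y, hy, hyx⟩ := exists_downD_eq (sub_mem hg hD)
    refine ⟨hProd ((b + (k + 1)) ::ₘ b ::ₘ s) + y, ?_, ?_⟩
    · rw [map_add, hyx]; ring
    · rw [add_sub_cancel_left]
      convert hy using 2 <;> omega
  choose g₀ hg₀ hg₀' using start
  choose nxt hn hn' using step
  let G : (k : ℕ) → {g // g - hProd ((b + k) ::ₘ b ::ₘ s) ∈
        hFilt Multiset.sup (b + k + b + s.sum) (b + k + 1)} := fun k =>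
    Nat.rec ⟨g₀, by simpa using hg₀'⟩ (fun k g => ⟨nxt k g.1 g.2, hn' k g.1 g.2⟩) k
  exact ⟨fun k => (G k).1, hg₀, fun k => hn k _ _, fun k => (G k).2⟩

/-- The complete homogeneous symmetric function with an integer index. -/
noncomputable def hz (k : ℤ) : SymRing := if k < 0 then 0 else hh k.toNat

theorem hz_of_neg {k : ℤ} (hk : k < 0) : hz k = 0 := by simp [hz, hk]

theorem hz_of_nonneg {k : ℤ} (hk : 0 ≤ k) : hz k = hh k.toNat := by simp [hz, not_lt.2 hk]

theorem downD_hz (k : ℤ) : downD (hz k) = hz (k - 1) := by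
  rcases lt_trichotomy k 0 with h | rfl | h
  · rw [hz_of_neg h, hz_of_neg (by omega), map_zero]
  · simp [hz]
  · obtain ⟨m, rfl⟩ : ∃ m : ℕ, k = m + 1 := ⟨(k - 1).toNat, by omega⟩
    rw [hz_of_nonneg (by omega), hz_of_nonneg (by omega)]
    simp only [add_sub_cancel_right, Int.toNat_natCast]
    exact downD_hh_succ m

/-- The Jacobi–Trudi matrix of a sequence. -/
noncomputable def jtMatrix (N : ℕ) (c : ℕ → ℤ) : Matrix (Fin N) (Fin N) SymRing :=
  Matrix.of fun i j => hz (c i - i + j)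

theorem sum_det_updateRow_eq_sum_det_updateCol {ι R : Type*} [Fintype ι] [DecidableEq ι]
    [CommRing R] (A B : Matrix ι ι R) :
    ∑ i, (A.updateRow i (B i)).det = ∑ j, (A.updateCol j (fun i => B i j)).det := by
  simp_rw [← Matrix.cramer_apply, ← Matrix.cramer_transpose_apply,
    Matrix.cramer_eq_adjugate_mulVec, Matrix.mulVec, dotProduct, ← Matrix.adjugate_transpose,
    Matrix.transpose_apply]
  exact Finset.sum_comm

theorem Derivation.leibniz_finsetProd {R A ι : Type*} [CommRing R] [CommRing A] [Algebra R A]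
    [DecidableEq ι] (D : Derivation R A A) (s : Finset ι) (f : ι → A) :
    D (∏ i ∈ s, f i) = ∑ i ∈ s, ∏ j ∈ s, if j = i then D (f j) else f j := by
  induction s using Finset.induction_on with
  | empty => simp
  | insert a s ha ih =>
    rw [Finset.prod_insert ha, Derivation.leibniz, ih, Finset.sum_insert ha, Finset.prod_insert ha,
      smul_eq_mul, smul_eq_mul, add_comm, Finset.mul_sum]
    congr 1
    · rw [if_pos rfl, mul_comm]
      congr 1
      exact Finset.prod_congr rfl fun j hj => by rw [if_neg]; rintro rfl; exact ha hj
    · refine Finset.sum_congr rfl fun i hi => ?_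
      rw [Finset.prod_insert ha, if_neg]
      rintro rfl
      exact ha hi

theorem Derivation.det_eq_sum {R A ι : Type*} [CommRing R] [CommRing A] [Algebra R A]
    [Fintype ι] [DecidableEq ι] (D : Derivation R A A) (M : Matrix ι ι A) :
    D M.det = ∑ i, (M.updateCol i (fun j => D (M j i))).det := by
  simp_rw [Matrix.det_apply, map_sum]
  rw [Finset.sum_comm]
  refine Finset.sum_congr rfl fun σ _ => ?_
  rw [Units.smul_def, Derivation.map_smul_of_tower, Derivation.leibniz_finsetProd, Finset.smul_sum]
  refine Finset.sum_congr rfl fun i _ => ?_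
  rw [Units.smul_def]
  congr 1
  refine Finset.prod_congr rfl fun j _ => ?_
  rw [Matrix.updateCol_apply]
  split_ifs with h
  · rw [h]
  · rfl

theorem jtMatrix_update (N : ℕ) (c : ℕ → ℤ) (i : Fin N) (z : ℤ) :
    jtMatrix N (Function.update c i z) =
      (jtMatrix N c).updateRow i (fun j => hz (z - i + j)) := by
  ext k j
  rw [Matrix.updateRow_apply]
  split_ifs with h
  · subst h; simp [jtMatrix]
  · have : (k : ℕ) ≠ i := fun h' => h (Fin.ext h')
    simp [jtMatrix, this]

theorem det_jtMatrix_eq_zero {N : ℕ} {c : ℕ → ℤ} (i : ℕ) (hi : i + 1 < N)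
    (hc : c (i + 1) = c i + 1) : (jtMatrix N c).det = 0 := by
  refine Matrix.det_zero_of_row_eq (i := (⟨i, by omega⟩ : Fin N)) (j := ⟨i + 1, hi⟩) (by simp) ?_
  funext j
  simp only [jtMatrix, Matrix.of_apply]
  congr 1
  push_cast
  rw [hc]
  ring

theorem det_jtMatrix_update_neg {N : ℕ} (c : ℕ → ℤ) :
    (jtMatrix (N + 1) (Function.update c N (-1))).det = 0 := by
  refine Matrix.det_eq_zero_of_row_eq_zero (Fin.last N) fun j => ?_
  simp only [jtMatrix, Matrix.of_apply]
  refine hz_of_neg ?_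
  have := j.2
  simp
  omega

theorem downD_det_jtMatrix (N : ℕ) (c : ℕ → ℤ) :
    downD (jtMatrix N c).det =
      ∑ i ∈ Finset.range N, (jtMatrix N (Function.update c i (c i - 1))).det := by
  rw [Finset.sum_range fun i => (jtMatrix N (Function.update c i (c i - 1))).det]
  simp_rw [jtMatrix_update]
  rw [Derivation.det_eq_sum]
  refine (sum_det_updateRow_eq_sum_det_updateCol (jtMatrix N c)
    (Matrix.of fun i j => downD (jtMatrix N c i j))).symm.trans ?_
  refine Finset.sum_congr rfl fun i _ => ?_
  congr 2
  funext j
  simp only [jtMatrix, Matrix.of_apply, downD_hz]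
  congr 1
  ring

theorem det_eq_of_last_row {R : Type*} [CommRing R] {N : ℕ}
    (A : Matrix (Fin (N + 1)) (Fin (N + 1)) R) (hA : ∀ j, j ≠ Fin.last N → A (Fin.last N) j = 0) :
    A.det = A (Fin.last N) (Fin.last N) * (A.submatrix Fin.castSucc Fin.castSucc).det := by
  rw [Matrix.det_succ_row A (Fin.last N), Finset.sum_eq_single (Fin.last N)]
  · simp [← two_mul]
  · intro j _ hj
    rw [hA j hj]
    simp
  · simp

theorem hh_one_mul_det_jtMatrix {N : ℕ} {c : ℕ → ℤ} (hc : c N = 0) :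
    hh 1 * (jtMatrix (N + 1) c).det =
      ∑ i ∈ Finset.range (N + 1), (jtMatrix (N + 1) (Function.update c i (c i + 1))).det := by
  rw [Finset.sum_range fun i => (jtMatrix (N + 1) (Function.update c i (c i + 1))).det]
  simp_rw [jtMatrix_update]
  have key := sum_det_updateRow_eq_sum_det_updateCol (jtMatrix (N + 1) c)
    (Matrix.of fun i j => hz (c i + 1 - i + j))
  refine Eq.trans ?_ key.symm
  rw [Finset.sum_eq_single (Fin.last N)]
  · rw [det_eq_of_last_row (jtMatrix (N + 1) c), det_eq_of_last_row (Matrix.updateCol _ _ _)]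
    · have hs : ((jtMatrix (N + 1) c).updateCol (Fin.last N)
          (fun i => (Matrix.of fun i j : Fin (N + 1) => hz (c i + 1 - i + j)) i
            (Fin.last N))).submatrix Fin.castSucc Fin.castSucc =
          (jtMatrix (N + 1) c).submatrix Fin.castSucc Fin.castSucc := by
        ext i j
        rw [Matrix.submatrix_apply, Matrix.updateCol_ne (Fin.castSucc_lt_last j).ne]
        rfl
      rw [hs, Matrix.updateCol_self]
      simp [jtMatrix, hc, hz]
    · intro j hj
      have : (j : ℕ) < N := Fin.val_lt_last hj
      rw [Matrix.updateCol_ne hj]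
      simp only [jtMatrix, Matrix.of_apply, Fin.val_last, hc]
      exact hz_of_neg (by omega)
    · intro j hj
      have : (j : ℕ) < N := Fin.val_lt_last hj
      simp only [jtMatrix, Matrix.of_apply, Fin.val_last, hc]
      exact hz_of_neg (by omega)
  · intro j _ hj
    have hjN : (j : ℕ) < N := Fin.val_lt_last hj
    have hne : j ≠ (⟨j + 1, by omega⟩ : Fin (N + 1)) := by simp [Fin.ext_iff]
    refine Matrix.det_zero_of_column_eq hne fun i => ?_
    rw [Matrix.updateCol_self, Matrix.updateCol_ne hne.symm]
    simp only [jtMatrix, Matrix.of_apply]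
    congr 1
    push_cast
    ring
  · simp

theorem eq_one_of_antivary {N : ℕ} {x : Fin N → ℤ} (hx : StrictAnti x) (σ : Equiv.Perm (Fin N))
    (h : Antivary x ((fun i : Fin N => (i : ℤ)) ∘ σ)) : σ = 1 := by
  have hm : StrictMono σ := by
    intro i j hij
    by_contra hlt
    have hne : σ j ≠ σ i := fun h' => hij.ne' (σ.injective h')
    have hlt' : σ j < σ i := lt_of_le_of_ne (not_lt.1 hlt) hne
    have := h (i := j) (j := i) (by simpa using hlt')
    exact absurd (hx hij) (not_lt.2 this)
  have := Subsingleton.elim (hm.orderIsoOfSurjective σ σ.surjective) (OrderIso.refl (Fin N))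
  ext i
  exact congrArg Fin.val (DFunLike.congr_fun this i)

theorem sum_sq_lt_of_perm {N : ℕ} {c : ℕ → ℕ} (hc : Antitone c) {σ : Equiv.Perm (Fin N)}
    (hσ : σ ≠ 1) :
    ∑ i : Fin N, ((c i : ℤ)) ^ 2 < ∑ i : Fin N, ((c i : ℤ) - i + σ i) ^ 2 := by
  set x : Fin N → ℤ := fun i => (c i : ℤ) - i with hx
  have hxa : StrictAnti x := by
    intro i j hij
    have := hc (show (i : ℕ) ≤ j from hij.le)
    have h2 : (i : ℕ) < j := hij
    simp only [hx]
    omega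
  have hanti : Antivary x (fun i : Fin N => (i : ℤ)) := by
    intro i j hij
    exact (hxa (by simpa using hij)).le
  have hlt := (hanti.sum_mul_lt_sum_mul_comp_perm_iff (σ := σ)).2
    fun h => hσ (eq_one_of_antivary hxa σ h)
  have hsq : ∑ i : Fin N, ((σ i : ℕ) : ℤ) ^ 2 = ∑ i : Fin N, ((i : ℕ) : ℤ) ^ 2 :=
    Equiv.sum_comp σ (fun i : Fin N => ((i : ℕ) : ℤ) ^ 2)
  have e1 : ∀ i : Fin N, ((c i : ℤ)) ^ 2 = x i ^ 2 + 2 * (x i * (i : ℤ)) + (i : ℤ) ^ 2 := by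
    intro i; simp only [hx]; ring
  have e2 : ∀ i : Fin N, ((c i : ℤ) - i + σ i) ^ 2 =
      x i ^ 2 + 2 * (x i * (σ i : ℤ)) + (σ i : ℤ) ^ 2 := by
    intro i; simp only [hx]; ring
  simp only [smul_eq_mul] at hlt
  simp_rw [e1, e2, Finset.sum_add_distrib, ← Finset.mul_sum]
  rw [hsq]
  linarith

/-- The sum of the squares of the entries of a multiset. -/
def sumSq (m : Multiset ℕ) : ℕ := (m.map (· ^ 2)).sum

theorem hz_prod_mem {N n a : ℕ} (d : Fin N → ℤ) (hd : ∑ i, d i = n)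
    (hsq : (a : ℤ) ≤ ∑ i, d i ^ 2) : ∏ i, hz (d i) ∈ hFilt sumSq n a := by
  by_cases h : ∀ i, 0 ≤ d i
  · have hp : ∏ i, hz (d i) = hProd (Finset.univ.val.map fun i => (d i).toNat) := by
      rw [hProd, Multiset.map_map]
      exact Finset.prod_congr rfl fun i _ => hz_of_nonneg (h i)
    have hcast : ∀ i, ((d i).toNat : ℤ) = d i := fun i => Int.toNat_of_nonneg (h i)
    rw [hp]
    refine hProd_mem_hFilt ?_ ?_
    · have : ((∑ i, (d i).toNat : ℕ) : ℤ) = n := by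
        rw [← hd]
        push_cast
        exact Finset.sum_congr rfl fun i _ => hcast i
      exact_mod_cast this
    · zify
      rw [sumSq, Multiset.map_map]
      change _ ≤ ((∑ i, (d i).toNat ^ 2 : ℕ) : ℤ)
      push_cast
      refine hsq.trans_eq (Finset.sum_congr rfl fun i _ => ?_)
      rw [← Int.toNat_of_nonneg (h i), Int.toNat_natCast]
  · push Not at h
    obtain ⟨i, hi⟩ := h
    rw [Finset.prod_eq_zero (Finset.mem_univ i) (hz_of_neg hi)]
    exact zero_mem _

theorem det_jtMatrix_sub_mem {N n : ℕ} {c : ℕ → ℕ} (hc : Antitone c)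
    (hsum : ∑ i ∈ Finset.range N, c i = n) :
    (jtMatrix N fun i => (c i : ℤ)).det - hProd ((Finset.range N).val.map c) ∈
      hFilt sumSq n (sumSq ((Finset.range N).val.map c) + 1) := by
  have hsum' : ∑ i : Fin N, (c i : ℤ) = n := by
    rw [← hsum, Finset.sum_range]; push_cast; rfl
  have hsq' : (sumSq ((Finset.range N).val.map c) : ℤ) = ∑ i : Fin N, (c i : ℤ) ^ 2 := by
    rw [sumSq, Multiset.map_map]
    change ((∑ i ∈ Finset.range N, c i ^ 2 : ℕ) : ℤ) = _
    rw [Finset.sum_range]; push_cast; rfl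
  rw [← Matrix.det_transpose, Matrix.det_apply,
    ← Finset.add_sum_erase _ _ (Finset.mem_univ (1 : Equiv.Perm (Fin N)))]
  have h1 : Equiv.Perm.sign (1 : Equiv.Perm (Fin N)) •
      ∏ i, (jtMatrix N fun i => (c i : ℤ)).transpose ((1 : Equiv.Perm (Fin N)) i) i =
      hProd ((Finset.range N).val.map c) := by
    rw [hProd, Multiset.map_map]
    change _ = ∏ i ∈ Finset.range N, hh (c i)
    rw [Finset.prod_range]
    simp [jtMatrix, Matrix.transpose_apply, hz_of_nonneg]
  rw [h1, add_sub_cancel_left]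
  refine Submodule.sum_mem _ fun σ hσ => ?_
  rw [Units.smul_def]
  refine Submodule.smul_mem _ _ ?_
  have hσ1 : σ ≠ 1 := (Finset.mem_erase.1 hσ).1
  refine hz_prod_mem (fun i => (c i : ℤ) - i + σ i) ?_ ?_
  · rw [Finset.sum_add_distrib, Finset.sum_sub_distrib, hsum',
      Equiv.sum_comp σ (fun i : Fin N => ((i : ℕ) : ℤ))]
    ring
  · have := sum_sq_lt_of_perm hc hσ1
    push_cast
    rw [hsq']
    omega

/-- The lengths of the columns of a partition. -/
def colLen {n : ℕ} (a : Nat.Partition n) (i : ℕ) : ℕ := a.parts.countP (i + 1 ≤ ·)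

theorem partitionLE_iff {n m : ℕ} (a : Nat.Partition n) (b : Nat.Partition m) :
    PartitionLE a b ↔ ∀ i, colLen a i ≤ colLen b i := by
  constructor
  · intro h i
    have := h (i + 1) (by omega)
    rw [colLen, colLen, Multiset.countP_eq_card_filter, Multiset.countP_eq_card_filter]
    convert this
  · intro h j hj
    obtain ⟨i, rfl⟩ : ∃ i, j = i + 1 := ⟨j - 1, by omega⟩
    have := h i
    rw [colLen, colLen, Multiset.countP_eq_card_filter, Multiset.countP_eq_card_filter] at this
    convert this

theorem colLen_antitone {n : ℕ} (a : Nat.Partition n) : Antitone (colLen a) := by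
  intro i j hij
  rw [colLen, colLen, Multiset.countP_eq_card_filter, Multiset.countP_eq_card_filter]
  exact Multiset.card_le_card (Multiset.monotone_filter_right _ fun p hp => by omega)

theorem colLen_eq_zero {n : ℕ} (a : Nat.Partition n) {i : ℕ} (hi : n ≤ i) : colLen a i = 0 := by
  rw [colLen, Multiset.countP_eq_zero]
  intro p hp
  have := Nat.Partition.le_of_mem_parts hp
  omega

theorem sum_countP_succ_le (m : Multiset ℕ) (N : ℕ) (hm : ∀ x ∈ m, x ≤ N) :
    ∑ i ∈ Finset.range N, m.countP (i + 1 ≤ ·) = m.sum := by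
  induction m using Multiset.induction_on with
  | empty => simp
  | cons a m ih =>
    simp only [Multiset.countP_cons, Finset.sum_add_distrib, Multiset.sum_cons]
    rw [ih fun x hx => hm x (Multiset.mem_cons_of_mem hx), add_comm]
    congr 1
    have ha := hm a (Multiset.mem_cons_self a m)
    rw [← Finset.sum_filter, Finset.sum_const, smul_eq_mul, mul_one]
    have : (Finset.range N).filter (fun i => i + 1 ≤ a) = Finset.range a := by
      ext i; simp; omega
    rw [this, Finset.card_range]

theorem sum_colLen {n N : ℕ} (a : Nat.Partition n) (h : n ≤ N) :
    ∑ i ∈ Finset.range N, colLen a i = n := by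
  have := sum_countP_succ_le a.parts N fun x hx => (Nat.Partition.le_of_mem_parts hx).trans h
  rw [a.parts_sum] at this
  exact this

theorem count_succ_add_colLen {n : ℕ} (a : Nat.Partition n) (i : ℕ) :
    a.parts.count (i + 1) + colLen a (i + 1) = colLen a i := by
  simp only [colLen]
  generalize a.parts = m
  induction m using Multiset.induction_on with
  | empty => simp
  | cons a m ih =>
    simp only [Multiset.count_cons, Multiset.countP_cons]
    split_ifs <;> omega

theorem colLen_injective {n : ℕ} : Function.Injective (colLen (n := n)) := by
  intro a b h
  ext k
  rcases k with _ | k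
  · rw [Multiset.count_eq_zero_of_notMem, Multiset.count_eq_zero_of_notMem] <;>
    · intro h0
      exact absurd (Nat.Partition.parts_pos _ h0) (lt_irrefl 0)
  · have h1 := count_succ_add_colLen a k
    have h2 := count_succ_add_colLen b k
    rw [h] at h1
    omega

theorem exists_colLen_eq {n N : ℕ} {c : ℕ → ℕ} (hc : Antitone c) (hN : ∀ i, N ≤ i → c i = 0)
    (hsum : ∑ i ∈ Finset.range N, c i = n) : ∃ a : Nat.Partition n, colLen a = c := by
  set m : Multiset ℕ := ∑ j ∈ Finset.range N, Multiset.replicate (c j - c (j + 1)) (j + 1) with hm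
  have hcount : ∀ i, m.countP (i + 1 ≤ ·) = c i := by
    intro i
    have hM : ∀ M, (∑ j ∈ Finset.range M,
        Multiset.replicate (c j - c (j + 1)) (j + 1)).countP (i + 1 ≤ ·) + c (max i M) = c i := by
      intro M
      induction M with
      | zero => simp
      | succ M ih =>
        rw [Finset.sum_range_succ, Multiset.countP_add, ← ih]
        have hle := hc (Nat.le_succ M)
        rcases le_or_gt i M with h | h
        · have h1 : (Multiset.replicate (c M - c (M + 1)) (M + 1)).countP (i + 1 ≤ ·) =
              c M - c (M + 1) :=
            (Multiset.countP_eq_card.2 fun x hx => by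
              rw [Multiset.eq_of_mem_replicate hx]; omega).trans (Multiset.card_replicate _ _)
          rw [max_eq_right h, max_eq_right (by omega), h1]
          simp only [Nat.succ_eq_add_one] at hle
          omega
        · have h1 : (Multiset.replicate (c M - c (M + 1)) (M + 1)).countP (i + 1 ≤ ·) = 0 :=
            Multiset.countP_eq_zero.2 fun x hx => by
              rw [Multiset.eq_of_mem_replicate hx]; omega
          rw [max_eq_left h.le, max_eq_left (by omega), h1, add_zero]
    have := hM N
    rw [hN _ (le_max_right i N), add_zero] at this
    exact this
  have hmem : ∀ x ∈ m, 0 < x ∧ x ≤ N := by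
    intro x hx
    rw [hm, Multiset.mem_sum] at hx
    obtain ⟨j, hj, hx⟩ := hx
    rw [Multiset.eq_of_mem_replicate hx]
    have := Finset.mem_range.1 hj
    omega
  refine ⟨⟨m, fun {x} hx => (hmem x hx).1, ?_⟩, funext hcount⟩
  rw [← sum_countP_succ_le m N fun x hx => (hmem x hx).2, ← hsum]
  exact Finset.sum_congr rfl fun i _ => hcount i

theorem exists_eq_update_succ {f g : ℕ → ℕ} {N : ℕ} (hle : ∀ i, f i ≤ g i)
    (hsum : ∑ i ∈ Finset.range N, g i = ∑ i ∈ Finset.range N, f i + 1)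
    (hN : ∀ i, N ≤ i → g i = f i) : ∃ i < N, g = Function.update f i (f i + 1) := by
  obtain ⟨i, hi, hlt⟩ : ∃ i ∈ Finset.range N, f i < g i := by
    by_contra! h
    have := Finset.sum_le_sum h
    omega
  have hiN := Finset.mem_range.1 hi
  refine ⟨i, hiN, ?_⟩
  have hle' : ∀ j ∈ Finset.range N, Function.update f i (f i + 1) j ≤ g j := by
    intro j _
    rcases eq_or_ne j i with rfl | h
    · simpa using hlt
    · simpa [h] using hle j
  have hs : ∑ j ∈ Finset.range N, Function.update f i (f i + 1) j = ∑ i ∈ Finset.range N, g i := by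
    rw [hsum, Finset.sum_update_of_mem hi, ← Finset.add_sum_erase _ f hi, Finset.sdiff_singleton_eq_erase]
    omega
  have heq := (Finset.sum_eq_sum_iff_of_le hle').1 hs
  funext j
  rcases lt_or_ge j N with h | h
  · exact (heq j (Finset.mem_range.2 h)).symm
  · rw [hN j h, Function.update_of_ne (by omega)]

theorem update_succ_injective {f : ℕ → ℕ} {i j : ℕ}
    (h : Function.update f i (f i + 1) = Function.update f j (f j + 1)) : i = j := by
  by_contra hij
  have := congrFun h i
  rw [Function.update_self, Function.update_of_ne hij] at this
  omega

/-- The Jacobi–Trudi determinant of size `N` attached to the columns of a partition. -/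
noncomputable def schurDet (N : ℕ) {n : ℕ} (a : Nat.Partition n) : SymRing :=
  (jtMatrix N fun i => (colLen a i : ℤ)).det

theorem cast_update (f : ℕ → ℕ) (i z : ℕ) :
    (fun k => ((Function.update f i z k : ℕ) : ℤ)) = Function.update (fun k => (f k : ℤ)) i z := by
  funext k
  rcases eq_or_ne k i with rfl | h
  · simp
  · simp [h]

theorem hh_one_mul_schurDet {n : ℕ} (a : Nat.Partition n) :
    hh 1 * schurDet (n + 1) a =
      ∑ b : Nat.Partition (n + 1) with PartitionLE a b, schurDet (n + 1) b := by
  have ha0 : colLen a n = 0 := colLen_eq_zero a le_rfl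
  rw [schurDet, hh_one_mul_det_jtMatrix (by simpa using ha0)]
  have key : ∀ i ∈ Finset.range (n + 1),
      (jtMatrix (n + 1) (Function.update (fun k => (colLen a k : ℤ)) i (colLen a i + 1))).det =
      ∑ b : Nat.Partition (n + 1) with PartitionLE a b,
        if colLen b = Function.update (colLen a) i (colLen a i + 1) then schurDet (n + 1) b
        else 0 := by
    intro i hi
    have hiN := Finset.mem_range.1 hi
    by_cases h : ∃ b : Nat.Partition (n + 1),
        colLen b = Function.update (colLen a) i (colLen a i + 1)
    · obtain ⟨b, hb⟩ := h
      rw [Finset.sum_eq_single b]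
      · rw [if_pos hb, schurDet, hb, cast_update]
        push_cast
        rfl
      · intro b' _ hne
        rw [if_neg]
        intro hb'
        exact hne (colLen_injective (hb'.trans hb.symm))
      · intro hnot
        exfalso
        refine hnot (Finset.mem_filter.2 ⟨Finset.mem_univ _, (partitionLE_iff a b).2 fun k => ?_⟩)
        rw [hb]
        rcases eq_or_ne k i with rfl | hk
        · simp
        · simp [hk]
    · rw [Finset.sum_eq_zero fun b _ => if_neg fun hb => h ⟨b, hb⟩]
      rcases i with _ | i
      · exfalso
        refine h (exists_colLen_eq (N := n + 1) ?_ ?_ ?_)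
        · intro j k hjk
          rcases j with _ | j <;> rcases k with _ | k
          · simp
          · simpa using (colLen_antitone a (Nat.zero_le (k + 1))).trans (Nat.le_succ _)
          · omega
          · simpa using colLen_antitone a hjk
        · intro j hj
          rw [Function.update_of_ne (by omega), colLen_eq_zero a (by omega)]
        · rw [Finset.sum_update_of_mem hi, Finset.sdiff_singleton_eq_erase]
          have := Finset.add_sum_erase _ (colLen a) hi
          rw [sum_colLen a (by omega)] at this
          omega
      · have hanti := colLen_antitone a (Nat.le_succ i)
        rcases hanti.eq_or_lt with heq | hlt
        · refine det_jtMatrix_eq_zero i hiN ?_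
          rw [Function.update_self, Function.update_of_ne (by omega), ← heq]
        · exfalso
          refine h (exists_colLen_eq (N := n + 1) (antitone_nat_of_succ_le fun j => ?_) ?_ ?_)
          · have hj := colLen_antitone a (Nat.le_succ j)
            simp only [Function.update_apply]
            split_ifs with h1 h2 h2
            · omega
            · obtain rfl : j = i := by omega
              exact hlt
            · subst h2; exact hj.trans (Nat.le_succ _)
            · exact hj
          · intro j hj
            rw [Function.update_of_ne (by omega), colLen_eq_zero a (by omega)]
          · rw [Finset.sum_update_of_mem hi, Finset.sdiff_singleton_eq_erase]
            have := Finset.add_sum_erase _ (colLen a) hi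
            rw [sum_colLen a (by omega)] at this
            omega
  rw [Finset.sum_congr rfl key, Finset.sum_comm]
  refine Finset.sum_congr rfl fun b hb => ?_
  have hle := (partitionLE_iff a b).1 (Finset.mem_filter.1 hb).2
  obtain ⟨i, hi, hbi⟩ := exists_eq_update_succ (N := n + 1) hle
    (by rw [sum_colLen a (by omega), sum_colLen b le_rfl])
    (fun i hi => by rw [colLen_eq_zero a (by omega), colLen_eq_zero b hi])
  rw [Finset.sum_eq_single i]
  · rw [if_pos hbi]
  · intro j _ hj
    rw [if_neg]
    intro hbj
    exact hj (update_succ_injective (hbj.symm.trans hbi))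
  · intro h
    exact absurd (Finset.mem_range.2 hi) h

theorem downD_schurDet {n : ℕ} (b : Nat.Partition (n + 1)) :
    downD (schurDet (n + 1) b) =
      ∑ a : Nat.Partition n with PartitionLE a b, schurDet (n + 1) a := by
  rw [schurDet, downD_det_jtMatrix]
  have key : ∀ i ∈ Finset.range (n + 1),
      (jtMatrix (n + 1) (Function.update (fun k => (colLen b k : ℤ)) i (colLen b i - 1))).det =
      ∑ a : Nat.Partition n with PartitionLE a b,
        if colLen b = Function.update (colLen a) i (colLen a i + 1) then schurDet (n + 1) a
        else 0 := by
    intro i hi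
    have hiN := Finset.mem_range.1 hi
    by_cases h : ∃ a : Nat.Partition n,
        colLen b = Function.update (colLen a) i (colLen a i + 1)
    · obtain ⟨a, ha⟩ := h
      rw [Finset.sum_eq_single a]
      · rw [if_pos ha, schurDet, ha, cast_update]
        congr 2
        funext k
        rcases eq_or_ne k i with rfl | hk
        · simp
        · simp [hk]
      · intro a' _ hne
        rw [if_neg]
        intro ha'
        refine hne (colLen_injective (funext fun k => ?_))
        have := congrFun (ha'.symm.trans ha) k
        rcases eq_or_ne k i with rfl | hk
        · simpa using this
        · simpa [hk] using this
      · intro hnot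
        exfalso
        refine hnot (Finset.mem_filter.2 ⟨Finset.mem_univ _, (partitionLE_iff a b).2 fun k => ?_⟩)
        rw [ha]
        rcases eq_or_ne k i with rfl | hk
        · simp
        · simp [hk]
    · rw [Finset.sum_eq_zero fun a _ => if_neg fun ha => h ⟨a, ha⟩]
      rcases (colLen_antitone b (Nat.le_succ i)).eq_or_lt with heq | hlt
      · rcases Nat.lt_or_ge (i + 1) (n + 1) with hi' | hi'
        · refine det_jtMatrix_eq_zero i hi' ?_
          rw [Function.update_self, Function.update_of_ne (by omega), ← heq]
          ring
        · obtain rfl : i = n := by omega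
          rw [colLen_eq_zero b le_rfl] at heq
          rw [← heq]
          exact det_jtMatrix_update_neg _
      · exfalso
        have hback : colLen b = Function.update (Function.update (colLen b) i (colLen b i - 1)) i
            (Function.update (colLen b) i (colLen b i - 1) i + 1) := by
          rw [Function.update_self, Function.update_idem, Nat.sub_add_cancel (by omega),
            Function.update_eq_self]
        suffices ∃ a : Nat.Partition n,
            colLen a = Function.update (colLen b) i (colLen b i - 1) by
          obtain ⟨a, ha⟩ := this
          exact h ⟨a, by rw [ha]; exact hback⟩
        refine exists_colLen_eq (N := n + 1) (antitone_nat_of_succ_le fun j => ?_) ?_ ?_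
        · have hj : colLen b (j + 1) ≤ colLen b j := colLen_antitone b (Nat.le_succ j)
          simp only [Function.update_apply]
          split_ifs with h1 h2 h2
          · omega
          · subst h1; omega
          · subst h2; simp only [Nat.succ_eq_add_one] at hlt; omega
          · exact hj
        · intro j hj
          rw [Function.update_of_ne (by omega), colLen_eq_zero b (by omega)]
        · rw [Finset.sum_update_of_mem hi, Finset.sdiff_singleton_eq_erase]
          have := Finset.add_sum_erase _ (colLen b) hi
          rw [sum_colLen b le_rfl] at this
          omega
  rw [Finset.sum_congr rfl key, Finset.sum_comm]
  refine Finset.sum_congr rfl fun a ha => ?_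
  have hle := (partitionLE_iff a b).1 (Finset.mem_filter.1 ha).2
  obtain ⟨i, hi, hbi⟩ := exists_eq_update_succ (N := n + 1) hle
    (by rw [sum_colLen a (by omega), sum_colLen b le_rfl])
    (fun i hi => by rw [colLen_eq_zero a (by omega), colLen_eq_zero b hi])
  rw [Finset.sum_eq_single i]
  · rw [if_pos hbi]
  · intro j _ hj
    rw [if_neg]
    intro hbj
    exact hj (update_succ_injective (hbj.symm.trans hbi))
  · intro h
    exact absurd (Finset.mem_range.2 hi) h

theorem downD_hh_one_mul_schurDet {n : ℕ} (a : Nat.Partition n) :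
    downD (hh 1 * schurDet (n + 1) a) =
      ∑ b : Nat.Partition n, psiMatrix n b a • schurDet (n + 1) b := by
  rw [hh_one_mul_schurDet, map_sum]
  simp_rw [downD_schurDet, Finset.sum_filter]
  rw [← Finset.sum_filter, Finset.sum_comm]
  refine Finset.sum_congr rfl fun b _ => ?_
  rw [← Finset.sum_filter, Finset.sum_const, Finset.filter_filter, psiMatrix, natCast_zsmul,
    Nat.card_eq_fintype_card, Fintype.card_subtype]
  congr 2
  ext c
  simp [and_comm]

theorem hDeg_le_of_forall_exists {st : Multiset ℕ → ℕ} {n B : ℕ}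
    (hst : ∀ m : Multiset ℕ, st (m.filter (· ≠ 0)) = st m)
    (hB : ∀ m : Multiset ℕ, m.sum = n → st m ≤ B) (V : Submodule ℤ SymRing)
    (h : ∀ a : Nat.Partition n, ∃ v ∈ V, v - hProd a.parts ∈ hFilt st n (st a.parts + 1)) :
    hDeg n ≤ V := by
  have key : ∀ d k, B + 1 ≤ k + d → hFilt st n k ≤ V := by
    intro d
    induction d with
    | zero =>
      intro k hk
      refine Submodule.span_le.2 ?_
      rintro _ ⟨m, ⟨hm, hkm⟩, rfl⟩
      have := hB m hm
      omega
    | succ d ih =>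
      intro k hk
      refine Submodule.span_le.2 ?_
      rintro _ ⟨m, ⟨hm, hkm⟩, rfl⟩
      obtain ⟨v, hv, hvm⟩ := h (Nat.Partition.ofSums n m hm)
      have hp : (Nat.Partition.ofSums n m hm).parts = m.filter (· ≠ 0) := rfl
      rw [hp, hProd_filter_ne_zero, hst] at hvm
      have := sub_mem hv (ih (st m + 1) (by omega) hvm)
      rwa [sub_sub_cancel] at this
  refine (Submodule.span_mono (Set.image_mono fun m hm => ?_)).trans (key (B + 1) 0 (by omega))
  exact ⟨hm, Nat.zero_le _⟩

theorem exists_antitone_map_range (n : ℕ) (m : Multiset ℕ) (hm : m.card ≤ n) :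
    ∃ c : ℕ → ℕ, Antitone c ∧ (∀ i, n ≤ i → c i = 0) ∧
      (Finset.range n).val.map c = m + Multiset.replicate (n - m.card) 0 := by
  set L := m.sort (· ≥ ·) with hL
  have hLm : (L : Multiset ℕ) = m := m.sort_eq _
  have hlen : L.length = m.card := by rw [← hLm]; rfl
  have hsorted : L.Pairwise (· ≥ ·) := m.pairwise_sort _
  refine ⟨fun i => L.getD i 0, ?_, ?_, ?_⟩
  · intro i j hij
    rcases lt_or_ge j L.length with hj | hj
    · simp only [List.getD_eq_getElem _ _ hj, List.getD_eq_getElem _ _ (hij.trans_lt hj)]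
      rcases hij.eq_or_lt with rfl | hlt
      · exact le_rfl
      · exact List.pairwise_iff_getElem.1 hsorted i j _ _ hlt
    · show L.getD j 0 ≤ L.getD i 0
      rw [List.getD_eq_default _ _ hj]
      exact Nat.zero_le _
  · intro i hi
    exact List.getD_eq_default _ _ (by omega)
  · have : (List.range n).map (fun i => L.getD i 0) = L ++ List.replicate (n - m.card) 0 := by
      refine List.ext_getElem (by simp; omega) fun i h1 h2 => ?_
      rw [List.getElem_map, List.getElem_range]
      rcases lt_or_ge i L.length with hi | hi
      · rw [List.getElem_append_left hi, List.getD_eq_getElem _ _ hi]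
      · rw [List.getElem_append_right hi, List.getElem_replicate, List.getD_eq_default _ _ hi]
    calc (Finset.range n).val.map (fun i => L.getD i 0)
        = (((List.range n).map (fun i => L.getD i 0) : List ℕ) : Multiset ℕ) := rfl
      _ = (L : Multiset ℕ) + Multiset.replicate (n - m.card) 0 := by rw [this]; rfl
      _ = _ := by rw [hLm]

theorem hProd_add_replicate_zero (m : Multiset ℕ) (k : ℕ) :
    hProd (m + Multiset.replicate k 0) = hProd m := by
  rw [hProd_add, hProd_replicate]
  simp

theorem sumSq_add_replicate_zero (m : Multiset ℕ) (k : ℕ) :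
    sumSq (m + Multiset.replicate k 0) = sumSq m := by
  simp [sumSq]

theorem sumSq_filter_ne_zero (m : Multiset ℕ) : sumSq (m.filter (· ≠ 0)) = sumSq m := by
  induction m using Multiset.induction_on with
  | empty => simp
  | cons a m ih =>
    by_cases ha : a = 0
    · subst ha; simpa [sumSq] using ih
    · simpa [sumSq, Multiset.filter_cons_of_pos, ha] using ih

theorem sumSq_le (m : Multiset ℕ) : sumSq m ≤ m.sum ^ 2 := by
  induction m using Multiset.induction_on with
  | empty => simp [sumSq]
  | cons a m ih =>
    simp only [sumSq, Multiset.map_cons, Multiset.sum_cons] at ih ⊢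
    nlinarith [Nat.zero_le (a * m.sum)]

theorem card_parts_le {n : ℕ} (a : Nat.Partition n) : a.parts.card ≤ n := by
  have := Multiset.card_nsmul_le_sum (s := a.parts) (a := 1) fun x hx => a.parts_pos hx
  rw [a.parts_sum] at this
  simpa using this

theorem schurDet_mem_hDeg {n : ℕ} (a : Nat.Partition n) : schurDet (n + 1) a ∈ hDeg n := by
  have h1 := hFilt_le_hDeg _ _ _ (det_jtMatrix_sub_mem (colLen_antitone a)
    (sum_colLen a (Nat.le_succ n)))
  have h2 : hProd ((Finset.range (n + 1)).val.map (colLen a)) ∈ hDeg n :=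
    hProd_mem_hDeg (sum_colLen a (Nat.le_succ n))
  have := add_mem h1 h2
  rwa [sub_add_cancel] at this

theorem hDeg_le_span_schurDet (n : ℕ) :
    hDeg n ≤ Submodule.span ℤ
      (Set.range fun a : Nat.Partition n => schurDet (n + 1) a) := by
  refine hDeg_le_of_forall_exists (st := sumSq) (B := n ^ 2) sumSq_filter_ne_zero
    (fun m hm => hm ▸ sumSq_le m) _ fun a => ?_
  obtain ⟨c, hc, hc0, hmap⟩ := exists_antitone_map_range (n + 1) a.parts
    ((card_parts_le a).trans (Nat.le_succ n))
  have hsum : ∑ i ∈ Finset.range (n + 1), c i = n := by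
    change ((Finset.range (n + 1)).val.map c).sum = n
    rw [hmap]
    simp [a.parts_sum]
  obtain ⟨b, rfl⟩ := exists_colLen_eq hc hc0 hsum
  refine ⟨_, Submodule.subset_span ⟨b, rfl⟩, ?_⟩
  have := det_jtMatrix_sub_mem hc hsum
  rwa [hmap, hProd_add_replicate_zero, sumSq_add_replicate_zero] at this

theorem hProd_eq_monomial (m : Multiset ℕ) (hm : ∀ x ∈ m, 0 < x) :
    hProd m = MvPolynomial.monomial (Multiset.toFinsupp (m.map Nat.pred)) 1 := by
  induction m using Multiset.induction_on with
  | empty => simp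
  | cons a m ih =>
    obtain ⟨k, rfl⟩ : ∃ k, a = k + 1 := ⟨a - 1, by have := hm a (by simp); omega⟩
    rw [hProd_cons, ih fun x hx => hm x (Multiset.mem_cons_of_mem hx), Multiset.map_cons,
      ← Multiset.singleton_add, map_add, Multiset.toFinsupp_singleton]
    simp only [hh, MvPolynomial.X, Nat.pred_succ, MvPolynomial.monomial_mul, one_mul]

theorem linearIndependent_hProd (n : ℕ) :
    LinearIndependent ℤ (fun a : Nat.Partition n => hProd a.parts) := by
  have hinj : Function.Injective
      (fun a : Nat.Partition n => Multiset.toFinsupp (a.parts.map Nat.pred)) := by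
    intro a b h
    have h' : a.parts.map Nat.pred = b.parts.map Nat.pred := Multiset.toFinsupp.injective h
    have hs : ∀ c : Nat.Partition n, (c.parts.map Nat.pred).map Nat.succ = c.parts := by
      intro c
      rw [Multiset.map_map]
      exact (Multiset.map_congr rfl fun x hx => Nat.succ_pred_eq_of_pos (c.parts_pos hx)).trans
        (Multiset.map_id' _)
    exact Nat.Partition.ext (by rw [← hs a, ← hs b, h'])
  have := (MvPolynomial.basisMonomials ℕ ℤ).linearIndependent.comp _ hinj
  have e : (⇑(MvPolynomial.basisMonomials ℕ ℤ) ∘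
      fun a : Nat.Partition n => Multiset.toFinsupp (a.parts.map Nat.pred)) =
        fun a => hProd a.parts := by
    funext a
    rw [Function.comp_apply, MvPolynomial.coe_basisMonomials]
    exact (hProd_eq_monomial _ fun x hx => a.parts_pos hx).symm
  rw [e] at this
  exact this

theorem hDeg_eq_span (n : ℕ) :
    hDeg n = Submodule.span ℤ (Set.range fun a : Nat.Partition n => hProd a.parts) := by
  refine le_antisymm (Submodule.span_le.2 ?_) (Submodule.span_le.2 ?_)
  · rintro _ ⟨m, hm, rfl⟩
    refine Submodule.subset_span ⟨Nat.Partition.ofSums n m hm, ?_⟩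
    exact hProd_filter_ne_zero m
  · rintro _ ⟨a, rfl⟩
    exact hProd_mem_hDeg a.parts_sum

theorem exists_basis_hDeg {n : ℕ} {ι : Type*} [Fintype ι] (hι : Fintype.card ι = numPartitions n)
    (v : ι → SymRing) (hv : ∀ i, v i ∈ hDeg n) (hspan : hDeg n ≤ Submodule.span ℤ (Set.range v)) :
    ∃ b : Module.Basis ι ℤ (hDeg n), ∀ i, (b i : SymRing) = v i := by
  have hb := Module.Basis.span (linearIndependent_hProd n)
  rw [← hDeg_eq_span] at hb
  have : Module.Finite ℤ (hDeg n) := Module.Finite.of_basis hb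
  have hrank : Fintype.card ι = Module.finrank ℤ (hDeg n) := by
    rw [Module.finrank_eq_card_basis hb, hι, numPartitions]
  have htop : ⊤ ≤ Submodule.span ℤ (Set.range fun i => (⟨v i, hv i⟩ : hDeg n)) := by
    rintro ⟨x, hx⟩ -
    have hx' := hspan hx
    have hr : Set.range v = (hDeg n).subtype '' Set.range fun i => (⟨v i, hv i⟩ : hDeg n) := by
      rw [← Set.range_comp]; rfl
    rw [hr, Submodule.span_image] at hx'
    obtain ⟨y, hy, hyx⟩ := hx'
    have : (⟨x, hx⟩ : hDeg n) = y := Subtype.ext hyx.symm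
    rw [this]
    exact hy
  refine ⟨basisOfTopLeSpanOfCardEqFinrank _ htop hrank, fun i => ?_⟩
  rw [coe_basisOfTopLeSpanOfCardEqFinrank]

theorem downD_hh_one_mul_mem {n : ℕ} {x : SymRing} (hx : x ∈ hDeg n) :
    downD (hh 1 * x) ∈ hDeg n := by
  refine downD_mem ?_
  rw [add_comm]
  exact mul_mem_hDeg (hh_mem_hDeg 1) hx

/-- The operator `x ↦ ∂/∂p₁ (p₁ x)` in degree `n`. -/
noncomputable def psiMap (n : ℕ) : hDeg n →ₗ[ℤ] hDeg n :=
  LinearMap.restrict ((downD : SymRing →ₗ[ℤ] SymRing) ∘ₗ LinearMap.mulLeft ℤ (hh 1))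
    fun _ hx => downD_hh_one_mul_mem hx

theorem coe_psiMap {n : ℕ} (x : hDeg n) : (psiMap n x : SymRing) = downD (hh 1 * (x : SymRing)) :=
  rfl

theorem exists_basis_toMatrix_psiMap (n : ℕ) :
    ∃ s : Module.Basis (Nat.Partition n) ℤ (hDeg n),
      LinearMap.toMatrix s s (psiMap n) = psiMatrix n := by
  obtain ⟨s, hs⟩ := exists_basis_hDeg (n := n) rfl (fun a => schurDet (n + 1) a)
    schurDet_mem_hDeg (hDeg_le_span_schurDet n)
  refine ⟨s, ?_⟩
  ext b a
  have key : psiMap n (s a) = ∑ b, psiMatrix n b a • s b := by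
    apply Subtype.ext
    rw [coe_psiMap, hs, downD_hh_one_mul_schurDet, AddSubmonoidClass.coe_finsetSum]
    exact Finset.sum_congr rfl fun b _ => by rw [← hs b]; rfl
  rw [LinearMap.toMatrix_apply, key, Module.Basis.repr_sum_self]

theorem exists_mul_psiMatrix_mul_eq_diagonal {n : ℕ} {ι : Type*} [Fintype ι]
    (e f : Module.Basis ι ℤ (hDeg n)) (α : ι → ℤ) (h : ∀ i, psiMap n (e i) = α i • f i) :
    ∃ (P Q : Matrix (Nat.Partition n) (Nat.Partition n) ℤ) (β : Nat.Partition n → ℤ),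
      IsUnit P.det ∧ IsUnit Q.det ∧ P * psiMatrix n * Q = Matrix.diagonal β ∧
      Finset.univ.val.map β = Finset.univ.val.map α := by
  obtain ⟨s, hs⟩ := exists_basis_toMatrix_psiMap n
  set σ : ι ≃ Nat.Partition n := e.indexEquiv s
  set e' := e.reindex σ with he'
  set f' := f.reindex σ with hf'
  refine ⟨f'.toMatrix s, s.toMatrix e', α ∘ σ.symm, ?_, ?_, ?_, ?_⟩
  · have := f'.invertibleToMatrix s
    exact (Matrix.isUnit_iff_isUnit_det _).1 (isUnit_of_invertible _)
  · have := s.invertibleToMatrix e'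
    exact (Matrix.isUnit_iff_isUnit_det _).1 (isUnit_of_invertible _)
  · rw [← hs, basis_toMatrix_mul_linearMap_toMatrix_mul_basis_toMatrix]
    ext i j
    rw [LinearMap.toMatrix_apply, he', Module.Basis.reindex_apply, h, map_smul,
      Finsupp.smul_apply, hf', Module.Basis.repr_reindex_apply, Module.Basis.repr_self,
      Matrix.diagonal_apply, Finsupp.single_apply, Function.comp_apply]
    by_cases hij : i = j
    · subst hij; simp
    · rw [if_neg hij, if_neg fun h => hij (σ.symm.injective h.symm), smul_zero]
  · rw [← Multiset.map_map]
    congr 1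
    simp

/-- The vectors `u_i = B_i - c_i u_{i-1}` obtained from a chain `B` with coefficients `c`. -/
noncomputable def chainVec {W : Type*} [AddCommGroup W] (c : ℕ → ℤ) (B : ℕ → W) : ℕ → W
  | 0 => B 0
  | i + 1 => B (i + 1) - c (i + 1) • chainVec c B i

theorem chainVec_mem {W : Type*} [AddCommGroup W] {c : ℕ → ℤ} {B : ℕ → W} {V : Submodule ℤ W}
    {i : ℕ} (hB : ∀ j ≤ i, B j ∈ V) : chainVec c B i ∈ V := by
  induction i with
  | zero => exact hB 0 le_rfl
  | succ i ih =>
    exact sub_mem (hB _ le_rfl) (V.smul_mem _ (ih fun j hj => hB j (hj.trans (Nat.le_succ i))))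

theorem chain_mem_of_chainVec_mem {W : Type*} [AddCommGroup W] {c : ℕ → ℤ} {B : ℕ → W}
    {V : Submodule ℤ W} {m i : ℕ} (hV : ∀ j < m, chainVec c B j ∈ V) (hi : i < m) : B i ∈ V := by
  rcases i with _ | i
  · exact hV 0 hi
  · have := add_mem (hV (i + 1) hi) (V.smul_mem (c (i + 1)) (hV i (by omega)))
    rwa [chainVec, sub_add_cancel] at this

theorem map_chainVec {W : Type*} [AddCommGroup W] (T : W →ₗ[ℤ] W) {c : ℕ → ℤ} {B : ℕ → W} {m : ℕ}
    (hstep : ∀ i, i + 1 < m → T (B i) = c i • B i + B (i + 1)) {i : ℕ} (hi : i + 1 < m) :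
    T (chainVec c B i) =
      ((-1) ^ i * ∏ j ∈ Finset.range (i + 1), c j) • B 0 + B (i + 1) := by
  induction i with
  | zero => simp [chainVec, hstep 0 hi]
  | succ i ih =>
    rw [chainVec, map_sub, map_smul, ih (by omega), hstep _ hi, Finset.prod_range_succ _ (i + 1)]
    module

theorem map_chainVec_last {W : Type*} [AddCommGroup W] (T : W →ₗ[ℤ] W) {c : ℕ → ℤ} {B : ℕ → W}
    {i : ℕ} (hstep : ∀ j < i, T (B j) = c j • B j + B (j + 1))
    (hlast : T (B i) = c i • B i) :
    T (chainVec c B i) = (∏ j ∈ Finset.range (i + 1), c j) • (((-1 : ℤ) ^ i) • B 0) := by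
  rcases i with _ | i
  · simp [chainVec, hlast]
  · rw [chainVec, map_sub, map_smul,
      map_chainVec T (m := i + 2) (fun j hj => hstep j (by omega)) (by omega), hlast,
      Finset.prod_range_succ _ (i + 1)]
    module

theorem exists_bases_of_chains {n : ℕ} {C : Type*} [Fintype C] (m : C → ℕ) (c : C → ℕ → ℤ)
    (B : C → ℕ → SymRing) (hB : ∀ x i, i < m x → B x i ∈ hDeg n)
    (hstep : ∀ x i, i + 1 < m x →
      downD (hh 1 * B x i) = c x i • B x i + B x (i + 1))
    (hlast : ∀ x i, i + 1 = m x → downD (hh 1 * B x i) = c x i • B x i)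
    (hspan : hDeg n ≤ Submodule.span ℤ (Set.range fun p : Σ x, Fin (m x) => B p.1 p.2))
    (hcard : Fintype.card (Σ x, Fin (m x)) = numPartitions n) :
    ∃ e f : Module.Basis (Σ x, Fin (m x)) ℤ (hDeg n), ∀ p,
      psiMap n (e p) =
        (if (p.2 : ℕ) + 1 = m p.1 then ∏ j ∈ Finset.range (m p.1), c p.1 j else 1) • f p := by
  set T : SymRing →ₗ[ℤ] SymRing :=
    (downD : SymRing →ₗ[ℤ] SymRing) ∘ₗ LinearMap.mulLeft ℤ (hh 1) with hT
  have hTdef : ∀ x, T x = downD (hh 1 * x) := fun _ => rfl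
  set u : (Σ x, Fin (m x)) → SymRing := fun p => chainVec (c p.1) (B p.1) p.2 with hu
  set w : (Σ x, Fin (m x)) → SymRing := fun p =>
    if (p.2 : ℕ) + 1 = m p.1 then ((-1 : ℤ) ^ (p.2 : ℕ)) • B p.1 0
    else ((-1) ^ (p.2 : ℕ) * ∏ j ∈ Finset.range ((p.2 : ℕ) + 1), c p.1 j) • B p.1 0 +
      B p.1 (p.2 + 1) with hw
  obtain ⟨e, he⟩ := exists_basis_hDeg hcard u
    (fun p => chainVec_mem fun j hj => hB _ _ (hj.trans_lt p.2.2)) (by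
      refine hspan.trans (Submodule.span_le.2 ?_)
      rintro _ ⟨⟨x, i⟩, rfl⟩
      exact chain_mem_of_chainVec_mem (c := c x) (B := B x)
        (fun j hj => Submodule.subset_span ⟨⟨x, ⟨j, hj⟩⟩, rfl⟩) i.2)
  obtain ⟨f, hf⟩ := exists_basis_hDeg hcard w
    (fun p => by
      have h0 := hB p.1 0 (by have := p.2.2; omega)
      simp only [hw]
      split_ifs with h
      · exact Submodule.smul_mem _ _ h0
      · exact add_mem (Submodule.smul_mem _ _ h0) (hB _ _ (by have := p.2.2; omega))) (by
      refine hspan.trans (Submodule.span_le.2 ?_)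
      rintro _ ⟨⟨x, ⟨i, hi⟩⟩, rfl⟩
      have h0 : B x 0 ∈ Submodule.span ℤ (Set.range w) := by
        have hmem : w ⟨x, ⟨m x - 1, by omega⟩⟩ ∈ Submodule.span ℤ (Set.range w) :=
          Submodule.subset_span ⟨_, rfl⟩
        simp only [hw] at hmem
        rw [if_pos (by omega)] at hmem
        have := Submodule.smul_mem _ ((-1 : ℤ) ^ (m x - 1)) hmem
        rwa [smul_smul, ← mul_pow, neg_one_mul, neg_neg, one_pow, one_smul] at this
      rcases i with _ | i
      · exact h0
      · have hmem : w ⟨x, ⟨i, by omega⟩⟩ ∈ Submodule.span ℤ (Set.range w) :=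
          Submodule.subset_span ⟨_, rfl⟩
        simp only [hw] at hmem
        rw [if_neg (by omega)] at hmem
        exact (Submodule.add_mem_iff_right _ (Submodule.smul_mem _ _ h0)).1 hmem)
  refine ⟨e, f, fun p => Subtype.ext ?_⟩
  rw [coe_psiMap, he, Submodule.coe_smul, hf, ← hTdef]
  simp only [hu, hw]
  split_ifs with h
  · rw [map_chainVec_last T (fun j hj => hstep _ j (by omega)) (hlast _ _ h), h]
  · rw [one_smul]
    exact map_chainVec T (hstep p.1) (by have := p.2.2; omega)

/-- A multiset of integers `≥ 2` whose largest element is repeated. -/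
def IsTwinTop (p : Multiset ℕ) : Prop :=
  (∀ x ∈ p, 2 ≤ x) ∧ ∃ b s, p = b ::ₘ b ::ₘ s ∧ ∀ x ∈ s, x ≤ b

/-- The index type of the chains in degree `n`. -/
abbrev ChainIndex (n : ℕ) :=
  Option (Σ k : Fin n, {a : Nat.Partition (k + 1) // IsTwinTop a.parts})

/-- The length of a chain in degree `n`. -/
def chainLength (n : ℕ) : ChainIndex n → ℕ
  | none => n
  | some q => n - q.1

/-- The diagonal coefficients of the operator along a chain. -/
def chainCoef (n : ℕ) : ChainIndex n → ℕ → ℤ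
  | none, i => if i + 1 = n then n + 1 else i + 1
  | some _, i => i + 1

theorem Multiset.exists_cons_max {p : Multiset ℕ} (hp : p ≠ 0) :
    ∃ a s, p = a ::ₘ s ∧ ∀ x ∈ s, x ≤ a := by
  obtain ⟨a, ha, hmax⟩ := Finset.exists_max_image p.toFinset id
    (Multiset.toFinset_nonempty.2 hp)
  obtain ⟨s, rfl⟩ := Multiset.exists_cons_of_mem (Multiset.mem_toFinset.1 ha)
  exact ⟨a, s, rfl, fun x hx => hmax x (by simp [hx])⟩

theorem Multiset.cons_max_inj {a a' : ℕ} {s s' : Multiset ℕ} (h : a ::ₘ s = a' ::ₘ s')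
    (hs : ∀ x ∈ s, x ≤ a) (hs' : ∀ x ∈ s', x ≤ a') : a = a' ∧ s = s' := by
  have haa : a = a' := by
    have h1 : a ∈ a' ::ₘ s' := h ▸ Multiset.mem_cons_self a s
    have h2 : a' ∈ a ::ₘ s := h ▸ Multiset.mem_cons_self a' s'
    rw [Multiset.mem_cons] at h1 h2
    have h3 : a ≤ a' := h1.elim le_of_eq (hs' a)
    have h4 : a' ≤ a := h2.elim le_of_eq (hs a')
    omega
  subst haa
  exact ⟨rfl, (Multiset.cons_inj_right a).1 h⟩

theorem Multiset.filter_ne_one_add_replicate (p : Multiset ℕ) :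
    p.filter (· ≠ 1) + Multiset.replicate (p.count 1) 1 = p := by
  conv_rhs => rw [← Multiset.filter_add_not (· ≠ 1) p]
  congr 1
  rw [← Multiset.filter_eq']
  exact Multiset.filter_congr fun x _ => by simp

theorem downD_hh_one_mul_pow_mul (i : ℕ) (v : SymRing) :
    downD (hh 1 * (hh 1 ^ i * v)) = ((i : ℤ) + 1) • (hh 1 ^ i * v) + hh 1 ^ (i + 1) * downD v := by
  rw [← mul_assoc, ← pow_succ', Derivation.leibniz, Derivation.leibniz_pow, downD_hh_succ, hh_zero,
    Nat.add_sub_cancel]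
  simp only [smul_eq_mul, nsmul_eq_mul, zsmul_eq_mul]
  push_cast
  ring

theorem hh_one_pow_mem_hDeg (i : ℕ) : hh 1 ^ i ∈ hDeg i := by
  rw [← hProd_replicate]
  exact hProd_mem_hDeg (by simp)

theorem exists_chains {n : ℕ} (hn : 1 ≤ n) :
    ∃ (B : ChainIndex n → ℕ → SymRing)
      (f : (Σ x : ChainIndex n, Fin (chainLength n x)) → Nat.Partition n),
      (∀ x i, i < chainLength n x → B x i ∈ hDeg n) ∧
      (∀ x i, i + 1 < chainLength n x →
        downD (hh 1 * B x i) = chainCoef n x i • B x i + B x (i + 1)) ∧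
      (∀ x i, i + 1 = chainLength n x →
        downD (hh 1 * B x i) = chainCoef n x i • B x i) ∧
      Function.Bijective f ∧
      ∀ p, B p.1 p.2 - hProd (f p).parts ∈
        hFilt Multiset.sup n ((f p).parts.sup + 1) := by
  have hdata : ∀ q : Σ k : Fin n, {a : Nat.Partition (k + 1) // IsTwinTop a.parts},
      ∃ (b : ℕ) (s : Multiset ℕ) (G : ℕ → SymRing), q.2.1.parts = b ::ₘ b ::ₘ s ∧
        (2 ≤ b ∧ ∀ x ∈ s, 2 ≤ x ∧ x ≤ b) ∧ b + b + s.sum = q.1 + 1 ∧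
        downD (G 0) = 0 ∧ (∀ k, downD (G (k + 1)) = G k) ∧
        ∀ k, G k - hProd ((b + k) ::ₘ b ::ₘ s) ∈
          hFilt Multiset.sup (b + k + b + s.sum) (b + k + 1) := by
    rintro ⟨k, a, h2, b, s, hbs, hs⟩
    obtain ⟨G, hG⟩ := exists_downD_chain b s
    refine ⟨b, s, G, hbs, ⟨h2 b (by simp [hbs]), fun x hx => ⟨h2 x (by simp [hbs, hx]), hs x hx⟩⟩,
      ?_, hG⟩
    have := a.parts_sum
    rw [hbs] at this
    simpa [add_assoc] using this
  choose b s G hparts hbs hsum hG0 hG hGf using hdata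
  set B : ChainIndex n → ℕ → SymRing := fun x i => match x with
    | none => hh 1 ^ i * hh (n - i)
    | some q => hh 1 ^ i * G q (n - q.1 - 1 - i) with hBdef
  set g : (Σ x : ChainIndex n, Fin (chainLength n x)) → Multiset ℕ := fun p => match p with
    | ⟨none, i⟩ => (n - i) ::ₘ Multiset.replicate i 1
    | ⟨some q, i⟩ => (b q + (n - q.1 - 1 - i)) ::ₘ b q ::ₘ (s q + Multiset.replicate i 1) with hgdef
  have hgpos : ∀ p, ∀ {x}, x ∈ g p → 0 < x := by
    rintro ⟨_ | q, i, hi⟩ x hx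
    · simp only [chainLength] at hi
      simp only [hgdef, Multiset.mem_cons, Multiset.mem_replicate] at hx
      omega
    · have := hbs q
      simp only [hgdef, Multiset.mem_cons, Multiset.mem_add, Multiset.mem_replicate] at hx
      rcases hx with rfl | rfl | hx | hx
      · omega
      · omega
      · have := this.2 x hx; omega
      · omega
  have hgsum : ∀ p, (g p).sum = n := by
    rintro ⟨_ | q, i, hi⟩
    · simp only [chainLength] at hi
      simp [hgdef]; omega
    · have := hsum q
      simp only [chainLength] at hi
      simp [hgdef]; omega
  have hqinj : ∀ q q' : Σ k : Fin n, {a : Nat.Partition (k + 1) // IsTwinTop a.parts},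
      q.2.1.parts = q'.2.1.parts → q = q' := by
    rintro ⟨k, a, ha⟩ ⟨k', a', ha'⟩ h
    dsimp only at h
    have hk : (k : ℕ) + 1 = k' + 1 := by rw [← a.parts_sum, h, a'.parts_sum]
    obtain rfl : k = k' := Fin.ext (by omega)
    obtain rfl : a = a' := Nat.Partition.ext h
    rfl
  have htail : ∀ q i j, ∀ x ∈ b q ::ₘ (s q + Multiset.replicate i 1), x ≤ b q + j := by
    intro q i j x hx
    have := hbs q
    simp only [Multiset.mem_cons, Multiset.mem_add, Multiset.mem_replicate] at hx
    rcases hx with rfl | hx | hx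
    · omega
    · have := this.2 x hx; omega
    · omega
  have htail' : ∀ q i, ∀ x ∈ s q + Multiset.replicate i 1, x ≤ b q := by
    intro q i x hx
    exact htail q i 0 x (Multiset.mem_cons_of_mem hx)
  have hone : ∀ i j, i < n → ∀ x ∈ Multiset.replicate j 1, x ≤ n - i := by
    intro i j hi x hx
    have := Multiset.eq_of_mem_replicate hx
    omega
  have hbone : ∀ q i j, Multiset.replicate j 1 ≠ b q ::ₘ (s q + Multiset.replicate i 1) := by
    intro q i j h
    have := Multiset.eq_of_mem_replicate (h ▸ Multiset.mem_cons_self (b q) _ : b q ∈ Multiset.replicate j 1)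
    have := (hbs q).1
    omega
  have hcount : ∀ q, (s q).count 1 = 0 := by
    intro q
    refine Multiset.count_eq_zero.2 fun h => ?_
    have := (hbs q).2 1 h
    omega
  have hginj : Function.Injective g := by
    rintro ⟨_ | q, i, hi⟩ ⟨_ | q', i', hi'⟩ h
    · simp only [chainLength] at hi hi'
      have := (Multiset.cons_max_inj h (hone _ _ hi) (hone _ _ hi')).1
      obtain rfl : i = i' := by simp only at this; omega
      rfl
    · exact (hbone _ _ _ (Multiset.cons_max_inj h (hone _ _ hi) (htail _ _ _)).2).elim
    · exact (hbone _ _ _ (Multiset.cons_max_inj h (htail _ _ _) (hone _ _ hi')).2.symm).elim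
    · have h1 := (Multiset.cons_max_inj h (htail _ _ _) (htail _ _ _)).2
      obtain ⟨h2, h3⟩ := Multiset.cons_max_inj h1 (htail' _ _) (htail' _ _)
      have h4 : i = i' := by
        have := congrArg (Multiset.count 1) h3
        simpa [hcount] using this
      subst h4
      have h5 : s q = s q' := (add_left_inj _).1 h3
      obtain rfl := hqinj q q' (by rw [hparts, hparts, h2, h5])
      rfl
  have hBg : ∀ p, B p.1 p.2 - hProd (g p) ∈ hFilt Multiset.sup n ((g p).sup + 1) := by
    rintro ⟨_ | q, i, hi⟩
    · simp only [hBdef, hgdef]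
      rw [hProd_cons, hProd_replicate, mul_comm, sub_self]
      exact zero_mem _
    · simp only [chainLength] at hi
      have h1 := mul_mem_hFilt_sup (hh_one_pow_mem_hDeg i) (hGf q (n - q.1 - 1 - i))
      have := hsum q
      rw [show i + (b q + (n - q.1 - 1 - i) + b q + (s q).sum) = n by omega] at h1
      have h2 : (g ⟨some q, i, hi⟩).sup ≤ b q + (n - q.1 - 1 - i) := by
        refine Multiset.sup_le.2 fun x hx => ?_
        rcases Multiset.mem_cons.1 hx with rfl | hx
        · exact le_rfl
        · exact htail _ _ _ x hx
      refine hFilt_anti (Nat.succ_le_succ h2) ?_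
      rw [mul_sub] at h1
      simp only [hBdef, hgdef]
      rwa [← Multiset.cons_add, ← Multiset.cons_add, hProd_add, hProd_replicate, mul_comm (hProd _)]
  refine ⟨B, fun p => ⟨g p, hgpos p, hgsum p⟩, ?_, ?_, ?_, ⟨?_, ?_⟩, ?_⟩
  · intro x i hi
    have := add_mem (hFilt_le_hDeg _ _ _ (hBg ⟨x, i, hi⟩)) (hProd_mem_hDeg (hgsum ⟨x, i, hi⟩))
    rwa [sub_add_cancel] at this
  · rintro (_ | q) i hi
    · simp only [chainLength] at hi
      simp only [hBdef, downD_hh_one_mul_pow_mul, chainCoef]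
      rw [if_neg (by omega), show n - i = n - (i + 1) + 1 by omega, downD_hh_succ]
    · simp only [chainLength] at hi
      simp only [hBdef, downD_hh_one_mul_pow_mul, chainCoef]
      rw [show n - q.1 - 1 - i = n - q.1 - 1 - (i + 1) + 1 by omega, hG]
  · rintro (_ | q) i hi
    · simp only [chainLength] at hi
      subst hi
      simp only [hBdef, downD_hh_one_mul_pow_mul, chainCoef]
      rw [if_pos trivial, Nat.add_sub_cancel_left, downD_hh_succ, hh_zero]
      simp only [zsmul_eq_mul]
      push_cast
      ring
    · simp only [chainLength] at hi
      simp only [hBdef, downD_hh_one_mul_pow_mul, chainCoef]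
      rw [show n - q.1 - 1 - i = 0 by omega, hG0, mul_zero, add_zero]
  · intro p q h
    exact hginj (congrArg Nat.Partition.parts h)
  · intro a
    have ha := Multiset.filter_ne_one_add_replicate a.parts
    have hsuma := a.parts_sum
    rw [← ha] at hsuma
    simp only [Multiset.sum_add, Multiset.sum_replicate, smul_eq_mul, mul_one] at hsuma
    have h2 : ∀ x ∈ a.parts.filter (· ≠ 1), 2 ≤ x := by
      intro x hx
      have := (Multiset.mem_filter.1 hx).2
      have := a.parts_pos (Multiset.mem_filter.1 hx).1
      omega
    suffices ∃ p, g p = a.parts from this.imp fun p hp => Nat.Partition.ext hp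
    generalize a.parts.count 1 = t at *
    generalize a.parts.filter (· ≠ 1) = F at *
    rw [← ha]
    rcases eq_or_ne F 0 with rfl | hF
    · rw [Multiset.sum_zero, zero_add] at hsuma
      obtain ⟨t, rfl⟩ : ∃ u, t = u + 1 := ⟨t - 1, by omega⟩
      refine ⟨⟨none, t, by simp only [chainLength]; omega⟩, ?_⟩
      simp [hgdef, ← hsuma, Multiset.replicate_succ]
    obtain ⟨c, F, rfl, hc⟩ := Multiset.exists_cons_max hF
    have hc2 := h2 c (Multiset.mem_cons_self _ _)
    rw [Multiset.sum_cons] at hsuma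
    rcases eq_or_ne F 0 with rfl | hF
    · rw [Multiset.sum_zero, add_zero] at hsuma
      refine ⟨⟨none, t, by simp only [chainLength]; omega⟩, ?_⟩
      simp [hgdef, ← hsuma]
    obtain ⟨b', s', rfl, hb'⟩ := Multiset.exists_cons_max hF
    have hbc := hc b' (Multiset.mem_cons_self _ _)
    have hb2 := h2 b' (by simp)
    rw [Multiset.sum_cons] at hsuma
    let q : Σ k : Fin n, {a : Nat.Partition (k + 1) // IsTwinTop a.parts} :=
      ⟨⟨b' + b' + s'.sum - 1, by omega⟩, ⟨⟨b' ::ₘ b' ::ₘ s', fun {x} hx => by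
        have := h2 x (by simp at hx ⊢; tauto)
        omega, by simp; omega⟩, fun x hx => h2 x (by simp at hx ⊢; tauto), b', s', rfl, hb'⟩⟩
    have hq : b' ::ₘ b' ::ₘ s' = b q ::ₘ b q ::ₘ s q := hparts q
    obtain ⟨h3, h4⟩ := Multiset.cons_max_inj ((Multiset.cons_max_inj hq
      (fun x hx => (Multiset.mem_cons.1 hx).elim le_of_eq (hb' x))
      (fun x hx => (Multiset.mem_cons.1 hx).elim le_of_eq fun h => ((hbs q).2 x h).2)).2) hb'
      fun x h => ((hbs q).2 x h).2
    have hqk : (q.1 : ℕ) = b' + b' + s'.sum - 1 := rfl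
    refine ⟨⟨some q, t, by simp only [chainLength, hqk]; omega⟩, ?_⟩
    simp only [hgdef, ← h3, ← h4, hqk]
    rw [show b' + (n - (b' + b' + s'.sum - 1) - 1 - t) = c by omega, Multiset.cons_add,
      Multiset.cons_add]
  · exact hBg

/-- The number of partitions of `l` without parts equal to `1` and with repeated largest part. -/
noncomputable def numTwinTop (l : ℕ) : ℕ :=
  Fintype.card {a : Nat.Partition l // IsTwinTop a.parts}

theorem numTwinTop_eq_zero {l : ℕ} (hl : l < 4) : numTwinTop l = 0 := by
  rw [numTwinTop, Fintype.card_eq_zero_iff]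
  refine ⟨fun ⟨a, h2, b, s, hbs, _⟩ => ?_⟩
  have h := a.parts_sum
  have := h2 b (by simp [hbs])
  rw [hbs, Multiset.sum_cons, Multiset.sum_cons] at h
  omega

theorem card_sigma_chainLength {n : ℕ} (hn : 1 ≤ n) :
    Fintype.card (Σ x : ChainIndex n, Fin (chainLength n x)) = numPartitions n := by
  obtain ⟨B, f, -, -, -, hf, -⟩ := exists_chains hn
  exact Fintype.card_of_bijective hf

theorem sum_chainIndex {M : Type*} [AddCommMonoid M] (n : ℕ) (w : ℕ → M) (w₀ : M)
    (v : ChainIndex n → M) (h0 : v none = w₀) (hv : ∀ q, v (some q) = w q.1) :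
    ∑ x, v x = w₀ + ∑ k ∈ Finset.range n, numTwinTop (k + 1) • w k := by
  rw [Fintype.sum_option, h0, Fintype.sum_sigma, Finset.sum_range]
  simp [hv, numTwinTop]

theorem numPartitions_eq_add_sum {n : ℕ} (hn : 1 ≤ n) :
    numPartitions n = n + ∑ k ∈ Finset.range n, numTwinTop (k + 1) * (n - k) := by
  rw [← card_sigma_chainLength hn, Fintype.card_sigma]
  simp only [Fintype.card_fin]
  exact sum_chainIndex n (fun k => n - k) n _ rfl fun _ => rfl

theorem numPartitions_succ {n : ℕ} (hn : 1 ≤ n) :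
    numPartitions (n + 1) =
      numPartitions n + 1 + ∑ k ∈ Finset.range (n + 1), numTwinTop (k + 1) := by
  have h : ∑ k ∈ Finset.range (n + 1), numTwinTop (k + 1) * (n + 1 - k) =
      ∑ k ∈ Finset.range n, numTwinTop (k + 1) * (n - k) +
        ∑ k ∈ Finset.range (n + 1), numTwinTop (k + 1) := by
    rw [Finset.sum_range_succ, Finset.sum_range_succ, ← add_assoc, ← Finset.sum_add_distrib]
    congr 1
    · refine Finset.sum_congr rfl fun k hk => ?_
      rw [Nat.succ_sub (Finset.mem_range.1 hk).le, Nat.mul_succ]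
    · simp
  rw [numPartitions_eq_add_sum (n := n + 1) (by omega), numPartitions_eq_add_sum hn, h]
  ring

theorem numTwinTop_succ {k : ℕ} (hk : 2 ≤ k) :
    numTwinTop (k + 1) =
      numPartitions (k + 1) + numPartitions (k - 1) - 2 * numPartitions k := by
  obtain ⟨k, rfl⟩ : ∃ j, k = j + 1 := ⟨k - 1, by omega⟩
  have h1 := numPartitions_succ (n := k + 1) (by omega)
  have h2 := numPartitions_succ (n := k) (by omega)
  rw [Finset.sum_range_succ] at h1
  rw [Nat.add_sub_cancel]
  omega

theorem chainLength_pos {n : ℕ} (hn : 1 ≤ n) (x : ChainIndex n) : 0 < chainLength n x := by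
  rcases x with _ | q
  · exact hn
  · exact Nat.sub_pos_of_lt q.1.2

theorem prod_chainCoef_none {n : ℕ} (hn : 1 ≤ n) :
    ∏ j ∈ Finset.range n, chainCoef n none j = ((n : ℤ) + 1) * (Nat.factorial (n - 1) : ℤ) := by
  obtain ⟨n, rfl⟩ : ∃ j, n = j + 1 := ⟨n - 1, by omega⟩
  rw [Finset.prod_range_succ, ← Finset.prod_range_add_one_eq_factorial, mul_comm]
  push_cast
  congr 1
  · simp [chainCoef]
  · refine Finset.prod_congr rfl fun j hj => ?_
    have := Finset.mem_range.1 hj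
    simp only [chainCoef]
    rw [if_neg (by omega)]

theorem prod_chainCoef_some {n : ℕ}
    (q : Σ k : Fin n, {a : Nat.Partition (k + 1) // IsTwinTop a.parts}) (m : ℕ) :
    ∏ j ∈ Finset.range m, chainCoef n (some q) j = (Nat.factorial m : ℤ) := by
  rw [← Finset.prod_range_add_one_eq_factorial]
  push_cast
  rfl

theorem map_chain_diagonal {n : ℕ} (hn : 1 ≤ n) :
    (Finset.univ.val.map fun p : Σ x : ChainIndex n, Fin (chainLength n x) =>
      if (p.2 : ℕ) + 1 = chainLength n p.1 then
        ∏ j ∈ Finset.range (chainLength n p.1), chainCoef n p.1 j else 1) =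
    (n - 1 + ∑ k ∈ Finset.range n, numTwinTop (k + 1) * (n - k - 1)) • ({1} : Multiset ℤ) +
      ∑ k ∈ Finset.range n, numTwinTop (k + 1) • ({(Nat.factorial (n - k) : ℤ)} : Multiset ℤ) +
      {((n : ℤ) + 1) * (Nat.factorial (n - 1) : ℤ)} := by
  rw [← Multiset.sum_map_singleton (Multiset.map _ _), Multiset.map_map]
  change ∑ p : Σ x : ChainIndex n, Fin (chainLength n x), ({_} : Multiset ℤ) = _
  rw [Fintype.sum_sigma]
  have hin : ∀ (m : ℕ) (_ : 0 < m) (A : ℤ),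
      ∑ i : Fin m, ({if (i : ℕ) + 1 = m then A else 1} : Multiset ℤ) = (m - 1) • {1} + {A} := by
    intro m hm A
    obtain ⟨m, rfl⟩ : ∃ j, m = j + 1 := ⟨m - 1, by omega⟩
    rw [Fin.sum_univ_castSucc]
    have : ∀ i : Fin m, ¬ (i : ℕ) = m := fun i => i.2.ne
    simp [this]
  simp only
  rw [Finset.sum_congr rfl fun x _ => hin _ (chainLength_pos hn x) _,
    sum_chainIndex n (fun k => (n - k - 1) • ({1} : Multiset ℤ) + {(Nat.factorial (n - k) : ℤ)})
      ((n - 1) • {1} + {((n : ℤ) + 1) * (Nat.factorial (n - 1) : ℤ)})]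
  · simp only [smul_add, Finset.sum_add_distrib, smul_smul, add_smul, Finset.sum_smul]
    abel
  · rw [← prod_chainCoef_none hn]
    rfl
  · intro q
    rw [prod_chainCoef_some]
    rfl

theorem sum_numTwinTop_smul_factorial {n : ℕ} (hn : 5 ≤ n) :
    ∑ k ∈ Finset.range n, numTwinTop (k + 1) • ({(Nat.factorial (n - k) : ℤ)} : Multiset ℤ) =
      numTwinTop n • {1} + ∑ k ∈ Finset.Icc 3 (n - 2), Multiset.replicate
        (numPartitions (k + 1) + numPartitions (k - 1) - 2 * numPartitions k)
          (Nat.factorial (n - k) : ℤ) := by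
  obtain ⟨n, rfl⟩ : ∃ j, n = j + 1 := ⟨n - 1, by omega⟩
  rw [Finset.sum_range_succ, add_comm]
  congr 1
  · simp
  · symm
    refine (Finset.sum_congr rfl fun k hk => ?_).trans
      (Finset.sum_subset (fun k hk => ?_) fun k hk hk' => ?_)
    · rw [← numTwinTop_succ (by rw [Finset.mem_Icc] at hk; omega), Multiset.nsmul_singleton]
    · rw [Finset.mem_Icc] at hk
      rw [Finset.mem_range]
      omega
    · rw [Finset.mem_Icc] at hk'
      rw [Finset.mem_range] at hk
      rw [numTwinTop_eq_zero (by omega), zero_smul]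

theorem multiplicity_one {n : ℕ} (hn : 5 ≤ n) :
    n - 1 + ∑ k ∈ Finset.range n, numTwinTop (k + 1) * (n - k - 1) + numTwinTop n =
      numPartitions n + numPartitions (n - 2) - numPartitions (n - 1) := by
  obtain ⟨n, rfl⟩ : ∃ j, n = j + 2 := ⟨n - 2, by omega⟩
  have h : ∑ k ∈ Finset.range (n + 2), numTwinTop (k + 1) * (n + 2 - k - 1) =
      ∑ k ∈ Finset.range (n + 1), numTwinTop (k + 1) * (n + 1 - k) := by
    rw [Finset.sum_range_succ]
    simp only [show n + 2 - (n + 1) - 1 = 0 by omega, mul_zero, add_zero]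
    exact Finset.sum_congr rfl fun k _ => by rw [show n + 2 - k - 1 = n + 1 - k by omega]
  have h1 := numPartitions_succ (n := n) (by omega)
  have h2 := numPartitions_succ (n := n + 1) (by omega)
  have h3 := numPartitions_eq_add_sum (n := n + 1) (by omega)
  rw [Finset.sum_range_succ] at h2
  rw [add_assoc n 1 1] at h2
  norm_num at h2
  rw [h, Nat.add_sub_cancel, show n + 2 - 1 = n + 1 by omega]
  omega

/-- Cai–Stanley: For `n ≥ 5`, the matrix `ψ_n` has a Smith normal form
over `ℤ` whose diagonal entries are `(n+1)(n-1)!` with multiplicity `1`; `(n-k)!` with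
multiplicity `p(k+1) - 2p(k) + p(k-1)` for `3 ≤ k ≤ n-2`; and `1` with multiplicity
`p(n) - p(n-1) + p(n-2)`. -/
theorem stmt14 (n : ℕ) (hn : 5 ≤ n) :
    ∃ P Q : Matrix (Nat.Partition n) (Nat.Partition n) ℤ,
      IsUnit P.det ∧ IsUnit Q.det ∧
      (∀ lam nu : Nat.Partition n, lam ≠ nu → (P * psiMatrix n * Q) lam nu = 0) ∧
      (Finset.univ.val.map (fun lam : Nat.Partition n => (P * psiMatrix n * Q) lam lam)) =
        Multiset.replicate (numPartitions n + numPartitions (n - 2) - numPartitions (n - 1))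
            (1 : ℤ) +
        (∑ k ∈ Finset.Icc 3 (n - 2),
          Multiset.replicate
            (numPartitions (k + 1) + numPartitions (k - 1) - 2 * numPartitions k)
            ((Nat.factorial (n - k) : ℤ))) +
        Multiset.replicate 1 (((n : ℤ) + 1) * (Nat.factorial (n - 1) : ℤ)) := by
  have hn1 : 1 ≤ n := by omega
  obtain ⟨B, g, hB, hstep, hlast, hg, hBg⟩ := exists_chains hn1
  obtain ⟨e, f, hef⟩ := exists_bases_of_chains (chainLength n) (chainCoef n) B hB hstep hlast
    (hDeg_le_of_forall_exists (st := Multiset.sup) (B := n)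
      (fun m => by
        induction m using Multiset.induction_on with
        | empty => simp
        | cons a m ih =>
          by_cases ha : a = 0
          · subst ha; simpa using ih
          · simp [Multiset.filter_cons_of_pos, ha, ih])
      (fun m hm => Multiset.sup_le.2 fun x hx =>
        (Multiset.single_le_sum (by simp) x hx).trans hm.le) _
      fun a => by
        obtain ⟨p, rfl⟩ := hg.2 a
        exact ⟨_, Submodule.subset_span ⟨p, rfl⟩, hBg p⟩)
    (card_sigma_chainLength hn1)
  obtain ⟨P, Q, β, hP, hQ, hPQ, hβ⟩ := exists_mul_psiMatrix_mul_eq_diagonal e f _ hef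
  refine ⟨P, Q, hP, hQ, fun a b hab => ?_, ?_⟩
  · rw [hPQ, Matrix.diagonal_apply_ne _ hab]
  · simp only [hPQ, Matrix.diagonal_apply_eq]
    rw [hβ, map_chain_diagonal hn1, sum_numTwinTop_smul_factorial hn, ← add_assoc, ← add_smul,
      multiplicity_one hn, Multiset.nsmul_singleton, Multiset.replicate_one]
end
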